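/- arXiv:1911.01924 — 3 statements merged into one kernel-verified Lean document; each statement's English description precedes it below -/
import Mathlib

section
/- For every natural number n ≥ 1, f_{A,sol}(n) ≤ n^{7·μ(n) + 6}, where f_{A,sol}(n) denotes the number of isomorphism classes of solvable A-groups of order n. -/
/-- A Sylow `p`-subgroup: a `p`-subgroup whose index is coprime to `p`. -/
def IsSylow' (p : ℕ) {G : Type*} [Group G] (P : Subgroup G) : Prop :=
  IsPGroup p P ∧ Nat.Coprime P.index p

/-- An `A`-group: a finite group all of whose Sylow subgroups are abelian. -/
def IsAGroup (G : Type*) [Group G] : Prop :=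
  ∀ p : ℕ, p.Prime → ∀ P : Subgroup G, IsSylow' p P → ∀ a b : P, a * b = b * a

/-- Two group structures give isomorphic groups. -/
def GroupIsoOf {α β : Type} (g : Group α) (h : Group β) : Prop :=
  letI := g; letI := h; Nonempty (α ≃* β)

/-- The number of isomorphism classes of groups of order `n` lying in the class `S`
(a class of groups closed under isomorphism, given as a predicate on group structures). -/
noncomputable def numGroups (n : ℕ) (S : (G : Type) → Group G → Prop) : ℕ :=
  Nat.card (Quot fun g h : {g : Group (Fin n) // S (Fin n) g} => GroupIsoOf g.1 h.1)

/-- `μ(n)`: the largest exponent to which a prime divides `n`. -/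
def muExp (n : ℕ) : ℕ := n.factorization.support.sup n.factorization

/-- `λ(n)`: the number of prime divisors of `n` counted with multiplicity. -/
def lamExp (n : ℕ) : ℕ := n.factorization.sum fun _ e => e

open Multiplicative

/-- every `p`-subgroup is commutative -/
def AGp (G : Type) [Group G] : Prop :=
  ∀ p : ℕ, p.Prime → ∀ P : Subgroup G, IsPGroup p P → ∀ a ∈ P, ∀ b ∈ P, a * b = b * a

/-- finite solvable A-groups with all prime exponents at most `m` -/
structure Good (m : ℕ) (G : Type) [Group G] : Prop where
  fin : Finite G
  sol : Group.IsSolvable G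
  ag : AGp G
  ex : ∀ p : ℕ, p.Prime → (Nat.card G).factorization p ≤ m

lemma factorization_le_of_dvd {a b p m : ℕ} (hb : b ≠ 0) (h : a ∣ b) (hm : b.factorization p ≤ m) :
    a.factorization p ≤ m := by
  have ha : a ≠ 0 := ne_zero_of_dvd_ne_zero hb h
  exact le_trans ((Nat.factorization_le_iff_dvd ha hb).2 h p) hm

lemma AGp_of_injective {G K : Type} [Group G] [Group K] (h : AGp G) (f : K →* G)
    (hf : Function.Injective f) : AGp K := by
  intro p hp P hP a ha b hb
  apply hf
  rw [map_mul, map_mul]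
  exact h p hp (P.map f) (hP.map f) _ (Subgroup.mem_map_of_mem f ha) _ (Subgroup.mem_map_of_mem f hb)

lemma AGp_of_surjective {G K : Type} [Group G] [Group K] [Finite G] (h : AGp G) (f : G →* K)
    (hf : Function.Surjective f) : AGp K := by
  intro p hp P hP a ha b hb
  have : Fact p.Prime := ⟨hp⟩
  obtain ⟨Q, hQ⟩ := hP.exists_le_sylow
  obtain ⟨R, rfl⟩ := Sylow.mapSurjective_surjective hf p Q
  have ha' := hQ ha
  have hb' := hQ hb
  rw [Sylow.coe_mapSurjective] at ha' hb'
  obtain ⟨x, hx, rfl⟩ := ha'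
  obtain ⟨y, hy, rfl⟩ := hb'
  rw [← map_mul, ← map_mul, h p hp R R.2 x hx y hy]

lemma Good.injective {m : ℕ} {G K : Type} [Group G] [Group K] (h : Good m G) (f : K →* G)
    (hf : Function.Injective f) : Good m K := by
  have := h.fin
  have := h.sol
  have : Finite K := Finite.of_injective f hf
  refine ⟨inferInstance, Group.isSolvable_of_isSolvable_injective hf, AGp_of_injective h.ag f hf, ?_⟩
  intro p hp
  exact factorization_le_of_dvd Nat.card_pos.ne' (Subgroup.card_dvd_of_injective f hf) (h.ex p hp)

lemma Good.subgroup {m : ℕ} {G : Type} [Group G] (h : Good m G) (K : Subgroup G) : Good m K :=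
  h.injective K.subtype K.subtype_injective

lemma Good.surjective {m : ℕ} {G K : Type} [Group G] [Group K] (h : Good m G) (f : G →* K)
    (hf : Function.Surjective f) : Good m K := by
  have := h.fin
  have := h.sol
  have : Finite K := Finite.of_surjective f hf
  refine ⟨inferInstance, Group.isSolvable_of_surjective hf, AGp_of_surjective h.ag f hf, ?_⟩
  intro p hp
  exact factorization_le_of_dvd Nat.card_pos.ne' (Subgroup.card_dvd_of_surjective f hf) (h.ex p hp)

/-- generators of `p`-groups -/
lemma exists_gens_aux {p : ℕ} (hp : p.Prime) {S : Type} [Group S] [Finite S] (hS : IsPGroup p S) :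
    ∀ k : ℕ, ∃ x : Fin k → S, Subgroup.closure (Set.range x) = ⊤ ∨
      p ^ k ∣ Nat.card (Subgroup.closure (Set.range x)) := by
  have : Fact p.Prime := ⟨hp⟩
  intro k
  induction k with
  | zero => exact ⟨Fin.elim0, Or.inr (by simp)⟩
  | succ k ih =>
    obtain ⟨x, hx⟩ := ih
    by_cases ht : Subgroup.closure (Set.range x) = ⊤
    · refine ⟨Fin.cons 1 x, Or.inl ?_⟩
      rw [eq_top_iff, ← ht]
      apply Subgroup.closure_mono
      rw [Fin.range_cons]
      exact Set.subset_insert _ _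
    · replace hx := hx.resolve_left ht
      obtain ⟨y, hy⟩ : ∃ y, y ∉ Subgroup.closure (Set.range x) := by
        by_contra! hcon
        exact ht (eq_top_iff.2 fun y _ => hcon y)
      refine ⟨Fin.cons y x, Or.inr ?_⟩
      set A := Subgroup.closure (Set.range x) with hA
      set B := Subgroup.closure (Set.range (Fin.cons y x : Fin (k+1) → S)) with hB
      have hlt : A < B := by
        rw [SetLike.lt_iff_le_and_exists]
        refine ⟨Subgroup.closure_mono ?_, y, Subgroup.subset_closure ⟨0, rfl⟩, hy⟩
        rw [Fin.range_cons]
        exact Set.subset_insert _ _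
      obtain ⟨a, ha⟩ := (IsPGroup.iff_card.1 (hS.to_subgroup A))
      obtain ⟨b, hb⟩ := (IsPGroup.iff_card.1 (hS.to_subgroup B))
      have hab : Nat.card A < Nat.card B := by
        apply lt_of_le_of_ne (Subgroup.card_le_of_le hlt.le)
        intro h
        exact hlt.ne (Subgroup.eq_of_le_of_card_ge hlt.le h.ge)
      rw [ha] at hx hab
      rw [hb] at hab ⊢
      have h1 := (Nat.pow_lt_pow_iff_right hp.one_lt).1 hab
      have h2 := (Nat.pow_dvd_pow_iff_le_right hp.one_lt).1 hx
      exact pow_dvd_pow _ (by omega)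

lemma exists_gens {p : ℕ} (hp : p.Prime) {S : Type} [Group S] [Finite S] (hS : IsPGroup p S)
    {m : ℕ} (hm : (Nat.card S).factorization p ≤ m) :
    ∃ x : Fin m → S, Subgroup.closure (Set.range x) = ⊤ := by
  have : Fact p.Prime := ⟨hp⟩
  obtain ⟨x, hx⟩ := exists_gens_aux hp hS m
  refine ⟨x, hx.elim id fun h => ?_⟩
  obtain ⟨a, ha⟩ := IsPGroup.iff_card.1 hS
  rw [ha, hp.factorization_pow] at hm
  simp at hm
  apply Subgroup.eq_top_of_le_card
  rw [ha]
  exact le_trans (Nat.pow_le_pow_right hp.pos hm) (Nat.le_of_dvd Nat.card_pos h)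

lemma card_hom_le {p : ℕ} (hp : p.Prime) {S X : Type} [Group S] [Finite S] (hS : IsPGroup p S)
    {m : ℕ} (hm : (Nat.card S).factorization p ≤ m) [Group X] [Finite X] :
    Nat.card (S →* X) ≤ Nat.card X ^ m := by
  obtain ⟨x, hx⟩ := exists_gens hp hS hm
  have : Nat.card X ^ m = Nat.card (Fin m → X) := by
    rw [Nat.card_fun]; simp
  rw [this]
  apply Nat.card_le_card_of_injective (fun f : S →* X => fun i => f (x i))
  intro f g hfg
  apply MonoidHom.eq_of_eqOn_dense hx
  rintro _ ⟨i, rfl⟩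
  exact congrFun hfg i

/-- simple modules -/
def IsSimp {H W : Type} [Group H] [AddCommGroup W] (ρ : H →* AddMonoid.End W) : Prop :=
  Nontrivial W ∧ ∀ X : AddSubgroup W, (∀ h, ∀ x ∈ X, ρ h x ∈ X) → X = ⊥ ∨ X = ⊤

/-- isomorphic modules -/
def Cj {H W : Type} [Group H] [AddCommGroup W] (ρ σ : H →* AddMonoid.End W) : Prop :=
  ∃ t : W ≃+ W, ∀ h w, t (ρ h w) = σ h (t w)

lemma Cj.refl {H W : Type} [Group H] [AddCommGroup W] (ρ : H →* AddMonoid.End W) : Cj ρ ρ :=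
  ⟨AddEquiv.refl W, fun _ _ => rfl⟩

lemma Cj.symm {H W : Type} [Group H] [AddCommGroup W] {ρ σ : H →* AddMonoid.End W} (h : Cj ρ σ) :
    Cj σ ρ := by
  obtain ⟨t, ht⟩ := h
  refine ⟨t.symm, fun h w => ?_⟩
  apply t.injective
  rw [ht]; simp

lemma Cj.trans {H W : Type} [Group H] [AddCommGroup W] {ρ σ τ : H →* AddMonoid.End W}
    (h : Cj ρ σ) (h' : Cj σ τ) : Cj ρ τ := by
  obtain ⟨t, ht⟩ := h
  obtain ⟨s, hs⟩ := h'
  exact ⟨t.trans s, fun h w => by simp [ht, hs]⟩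

/-- counting with an equivalence relation -/
lemma card_le_of_classes {ι : Type} [Finite ι] (r : Setoid ι) (a c : ℕ)
    (ha : ∀ s : Set ι, (∀ i ∈ s, ∀ j ∈ s, r i j → i = j) → Nat.card s ≤ a)
    (hc : ∀ i, Nat.card {j // r i j} ≤ c) : Nat.card ι ≤ a * c := by
  classical
  let out : ι → ι := fun i => (Quotient.mk r i).out
  have hout : ∀ i, r (out i) i := fun i => Quotient.exact (Quotient.out_eq _)
  have h1 : Nat.card (Set.range out) ≤ a := by
    apply ha
    rintro _ ⟨i, rfl⟩ _ ⟨j, rfl⟩ hij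
    have : r i j := r.trans (r.symm (hout i)) (r.trans hij (hout j))
    simp only [out, Quotient.sound this]
  have := Fintype.ofFinite ι
  have := Fintype.ofFinite (Set.range out)
  have h2 : Nat.card ι ≤ Nat.card (Set.range out) * c := by
    have h3 : Nat.card ι = ∑ x : Set.range out, Nat.card {j // out j = x} := by
      rw [← Nat.card_sigma]
      apply Nat.card_congr
      refine ⟨fun j => ⟨⟨out j, j, rfl⟩, j, rfl⟩, fun x => x.2.1, fun _ => rfl, ?_⟩
      rintro ⟨⟨_, i, rfl⟩, j, hj⟩
      simp only at hj
      ext <;> simp [hj]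
    rw [h3]
    have h4 : ∀ x ∈ (Finset.univ : Finset (Set.range out)), Nat.card {j // out j = x} ≤ c := by
      rintro ⟨_, i, rfl⟩ _
      refine le_trans ?_ (hc i)
      apply Nat.card_le_card_of_injective
        (fun j : {j // out j = out i} => (⟨j.1, ?_⟩ : {j // r i j}))
      · intro x y hxy
        simpa [Subtype.ext_iff] using hxy
      · have := j.2
        have h5 := hout j.1
        rw [this] at h5
        exact r.trans (r.symm (hout i)) h5
    refine le_trans (Finset.sum_le_card_nsmul _ _ _ h4) ?_
    simp
  exact h2.trans (Nat.mul_le_mul_right _ h1)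

/-- counting with a map -/
lemma card_le_of_fibers {ι κ : Type} [Finite ι] [Finite κ] (f : ι → κ) (c : ℕ)
    (hc : ∀ k, Nat.card {j // f j = k} ≤ c) : Nat.card ι ≤ Nat.card κ * c := by
  have := Fintype.ofFinite κ
  rw [Nat.card_congr (Equiv.sigmaFiberEquiv f).symm, Nat.card_sigma]
  refine le_trans (Finset.sum_le_card_nsmul _ _ c fun x _ => hc x) ?_
  simp


lemma elem_ab_aux {p : ℕ} [Fact p.Prime] {N : Type} [AddCommGroup N] [Finite N] [Nontrivial N]
    [Module (ZMod p) N] : ∃ b : ℕ, 1 ≤ b ∧ Nonempty ((Fin b → ZMod p) ≃+ N) := by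
  have : Module.Finite (ZMod p) N := Module.Finite.of_finite
  exact ⟨_, Module.finrank_pos (R := ZMod p) (M := N),
    ⟨(Module.finBasis (ZMod p) N).equivFun.symm.toAddEquiv⟩⟩

lemma elem_ab_equiv' {p : ℕ} (hp : p.Prime) {N : Type} [AddCommGroup N] [Finite N] [Nontrivial N]
    (hexp : ∀ x : N, p • x = 0) :
    ∃ b : ℕ, 1 ≤ b ∧ Nonempty ((Fin b → ZMod p) ≃+ N) := by
  have : Fact p.Prime := ⟨hp⟩
  have := AddCommGroup.zmodModule hexp
  exact elem_ab_aux (p := p)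

lemma elem_ab_equiv {p : ℕ} (hp : p.Prime) {N : Type} [Group N] [Finite N] [Nontrivial N]
    (hc : ∀ a b : N, a * b = b * a) (hexp : ∀ x : N, x ^ p = 1) :
    ∃ b : ℕ, 1 ≤ b ∧ Nonempty (Multiplicative (Fin b → ZMod p) ≃* N) := by
  let _ : CommGroup N := { (inferInstance : Group N) with mul_comm := hc }
  obtain ⟨b, hb, ⟨e⟩⟩ := elem_ab_equiv' hp (N := Additive N) (fun x => hexp x.toMul)
  exact ⟨b, hb, ⟨AddEquiv.toMultiplicativeLeft e⟩⟩

lemma exists_min_normal {G : Type} [Group G] [Finite G] (hs : Group.IsSolvable G)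
    (T : Subgroup G) (hT : T.Normal) (hT1 : T ≠ ⊥) :
    ∃ p b : ℕ, p.Prime ∧ 1 ≤ b ∧ ∃ j : Multiplicative (Fin b → ZMod p) →* G,
      Function.Injective j ∧ j.range.Normal ∧ j.range ≤ T ∧
      ∀ X : Subgroup G, X.Normal → X ≤ j.range → X = ⊥ ∨ X = j.range := by
  classical
  obtain ⟨N, ⟨hN, hN1, hNT⟩, hmin⟩ := Set.Finite.exists_minimal (s := {N : Subgroup G | N.Normal ∧ N ≠ ⊥ ∧ N ≤ T})
    (Set.toFinite _) ⟨T, hT, hT1, le_rfl⟩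
  have hmin' : ∀ X : Subgroup G, X.Normal → X ≤ N → X = ⊥ ∨ X = N := by
    intro X hX hXN
    by_cases h : X = ⊥
    · exact Or.inl h
    · exact Or.inr (le_antisymm hXN (hmin ⟨hX, h, hXN.trans hNT⟩ hXN))
  have hcomm : ∀ x ∈ N, ∀ y ∈ N, x * y = y * x := by
    have h1 : ⁅N, N⁆ < N := Group.IsSolvable.commutator_lt_of_ne_bot hN1
    have h2 : ⁅N, N⁆ = ⊥ := (hmin' _ inferInstance h1.le).resolve_right h1.ne
    intro x hx y hy
    have := Subgroup.commutator_mem_commutator hx hy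
    rw [h2, Subgroup.mem_bot, commutatorElement_eq_one_iff_mul_comm] at this
    exact this
  have hNn : Nontrivial N := (Subgroup.nontrivial_iff_ne_bot N).2 hN1
  have hcard : Nat.card N ≠ 1 := Finite.one_lt_card.ne'
  obtain ⟨p, hp, hpd⟩ := Nat.exists_prime_and_dvd hcard
  have : Fact p.Prime := ⟨hp⟩
  have hexp : ∀ x ∈ N, x ^ p = 1 := by
    let X : Subgroup G :=
      { carrier := {x | x ∈ N ∧ x ^ p = 1}
        mul_mem' := by
          rintro a b ⟨ha, ha'⟩ ⟨hb, hb'⟩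
          refine ⟨N.mul_mem ha hb, ?_⟩
          have : Commute a b := hcomm a ha b hb
          rw [this.mul_pow, ha', hb', one_mul]
        one_mem' := ⟨N.one_mem, one_pow _⟩
        inv_mem' := by
          rintro a ⟨ha, ha'⟩
          exact ⟨N.inv_mem ha, by rw [inv_pow, ha', inv_one]⟩ }
    have hX : X.Normal := ⟨by
      rintro x ⟨hx, hx'⟩ g
      exact ⟨hN.conj_mem x hx g, by rw [conj_pow, hx']; simp⟩⟩
    have hXN : X ≤ N := fun x hx => hx.1
    rcases hmin' X hX hXN with h | h
    · obtain ⟨x, hx⟩ := exists_prime_orderOf_dvd_card' p hpd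
      have hx1 : (x : G) ∈ X := ⟨x.2, by
        rw [← Subgroup.coe_pow, ← hx, pow_orderOf_eq_one]; rfl⟩
      rw [h, Subgroup.mem_bot] at hx1
      have : x = 1 := Subtype.ext hx1
      rw [this, orderOf_one] at hx
      exact absurd hx.symm hp.one_lt.ne'
    · intro x hx
      rw [← h] at hx
      exact hx.2
  obtain ⟨b, hb, ⟨e'⟩⟩ := elem_ab_equiv (N := N) hp (fun a b => Subtype.ext (hcomm a a.2 b b.2))
    (fun x => Subtype.ext (hexp _ x.2))
  refine ⟨p, b, hp, hb, N.subtype.comp e'.toMonoidHom, ?_, ?_, ?_, ?_⟩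
  · exact N.subtype_injective.comp e'.injective
  all_goals
    have hr : (N.subtype.comp e'.toMonoidHom).range = N := by
      rw [MonoidHom.range_comp, MonoidHom.range_eq_top.2 (by exact e'.surjective), ← MonoidHom.range_eq_map]
      exact N.range_subtype
    rw [hr]
  · exact hN
  · exact hNT
  · exact hmin'

lemma exists_action {G W : Type} [Group G] [AddCommGroup W] (j : Multiplicative W →* G)
    (hj : Function.Injective j) (hn : j.range.Normal) :
    ∃ ρ : G →* AddMonoid.End W, ∀ g w, j (ofAdd (ρ g w)) = g * j (ofAdd w) * g⁻¹ := by
  have h : ∀ g w, ∃ w', j (ofAdd w') = g * j (ofAdd w) * g⁻¹ := by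
    intro g w
    obtain ⟨w', hw'⟩ := hn.conj_mem (j (ofAdd w)) ⟨_, rfl⟩ g
    exact ⟨toAdd w', hw'⟩
  choose f hf using h
  have hinj : ∀ {a b : W}, j (ofAdd a) = j (ofAdd b) → a = b := fun h => ofAdd.injective (hj h)
  refine ⟨
    { toFun := fun g => { toFun := f g, map_zero' := ?_, map_add' := ?_ }
      map_one' := ?_
      map_mul' := ?_ }, fun g w => hf g w⟩
  · apply hinj; rw [hf]; simp
  · intro x y; apply hinj; rw [hf]; simp [hf]
  · ext w; apply hinj; change j (ofAdd (f 1 w)) = _; rw [hf]; simp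
  · intro x y; ext w; apply hinj
    change j (ofAdd (f (x * y) w)) = j (ofAdd (f x (f y w)))
    simp [hf, mul_assoc]

lemma isSimp_of_min {G H W : Type} [Group G] [Group H] [AddCommGroup W] [Nontrivial W]
    (j : Multiplicative W →* G)
    (hj : Function.Injective j)
    (hmin : ∀ X : Subgroup G, X.Normal → X ≤ j.range → X = ⊥ ∨ X = j.range)
    (π : H → G) (hπ : Function.Surjective π)
    (ρ : H →* AddMonoid.End W)
    (hρ : ∀ h w, j (ofAdd (ρ h w)) = π h * j (ofAdd w) * (π h)⁻¹) : IsSimp ρ := by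
  refine ⟨inferInstance, fun X hX => ?_⟩
  let Y : Subgroup G := (AddSubgroup.toSubgroup X).map j
  have hY : Y.Normal := ⟨by
    rintro _ ⟨x, hx, rfl⟩ g
    obtain ⟨h, rfl⟩ := hπ g
    exact ⟨ofAdd (ρ h (toAdd x)), hX h _ hx, hρ h _⟩⟩
  rcases hmin Y hY (Subgroup.map_le_range _ _) with h | h
  · left
    rw [eq_bot_iff]
    intro x hx
    have : j (ofAdd x) ∈ Y := ⟨ofAdd x, hx, rfl⟩
    rw [h, Subgroup.mem_bot] at this
    have := hj (this.trans j.map_one.symm)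
    simpa using this
  · right
    rw [eq_top_iff]
    intro x _
    have : j (ofAdd x) ∈ Y := h ▸ ⟨ofAdd x, rfl⟩
    obtain ⟨y, hy, hyx⟩ := this
    rw [hj hyx] at hy
    exact hy


lemma exists_selfcent {m : ℕ} {K : Type} [Group K] (hK : Good m K) :
    ∃ A : Subgroup K, A.Normal ∧ (∀ a ∈ A, ∀ b ∈ A, a * b = b * a) ∧
      ∀ k, (∀ a ∈ A, k * a = a * k) → k ∈ A := by
  have := hK.fin
  have := hK.sol
  obtain ⟨A, ⟨hA, hAc⟩, hmax⟩ := Set.Finite.exists_maximal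
    (s := {A : Subgroup K | A.Normal ∧ (∀ a ∈ A, ∀ b ∈ A, a * b = b * a)})
    (Set.toFinite _) ⟨⊥, inferInstance, by
      intro a ha b hb
      rw [Subgroup.mem_bot] at ha hb
      rw [ha, hb]⟩
  refine ⟨A, hA, hAc, fun k hk => ?_⟩
  by_contra hkA
  let C := Subgroup.centralizer (A : Set K)
  have hC : C.Normal := inferInstance
  have hAC : A ≤ C := fun a ha => by
    rw [Subgroup.mem_centralizer_iff]
    intro b hb
    exact hAc b hb a ha
  have hkC : k ∈ C := by
    rw [Subgroup.mem_centralizer_iff]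
    intro b hb
    exact (hk b hb).symm
  let T := C.map (QuotientGroup.mk' A)
  have hT : T.Normal := hC.map _ (QuotientGroup.mk'_surjective A)
  have hT1 : T ≠ ⊥ := by
    intro h
    have : QuotientGroup.mk' A k ∈ T := ⟨k, hkC, rfl⟩
    rw [h, Subgroup.mem_bot] at this
    exact hkA ((QuotientGroup.eq_one_iff k).1 this)
  obtain ⟨q, b, hq, hb, j, hj, hjn, hjT, -⟩ := exists_min_normal
    (G := K ⧸ A) inferInstance T hT hT1
  have : Fact q.Prime := ⟨hq⟩
  let D := j.range.comap (QuotientGroup.mk' A)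
  have hDn : D.Normal := hjn.comap _
  have hAD : A ≤ D := fun a ha => by
    rw [Subgroup.mem_comap, show QuotientGroup.mk' A a = 1 from (QuotientGroup.eq_one_iff a).2 ha]
    exact one_mem _
  have hDC : D ≤ C := fun d hd => by
    obtain ⟨c, hc, hcd⟩ := hjT hd
    have : c⁻¹ * d ∈ A := QuotientGroup.eq.1 hcd
    have := C.mul_mem hc (hAC this)
    simpa using this
  have hpg : IsPGroup q j.range := by
    have : IsPGroup q (Multiplicative (Fin b → ZMod q)) := by
      apply IsPGroup.of_card (n := b)
      rw [Nat.card_congr Multiplicative.toAdd, Nat.card_fun]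
      simp
    exact this.of_surjective _ j.rangeRestrict_surjective
  let f : D →* j.range := ((QuotientGroup.mk' A).comp D.subtype).codRestrict j.range (fun d => d.2)
  have hf : Function.Surjective f := by
    rintro ⟨y, hy⟩
    obtain ⟨x, rfl⟩ := QuotientGroup.mk'_surjective A y
    exact ⟨⟨x, hy⟩, rfl⟩
  obtain ⟨S⟩ : Nonempty (Sylow q D) := inferInstance
  have hST : ((S.mapSurjective hf : Sylow q j.range) : Subgroup j.range) = ⊤ := by
    exact ((S.mapSurjective hf).3 (hpg.to_subgroup ⊤) le_top).symm
  rw [Sylow.coe_mapSurjective] at hST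
  have key : ∀ d : D, ∃ s ∈ S, ∃ a ∈ A, (d : K) = s * a := by
    intro d
    have : f d ∈ Subgroup.map f (S : Subgroup D) := hST ▸ Subgroup.mem_top _
    obtain ⟨s, hs, hsd⟩ := this
    refine ⟨s, hs, (s : K)⁻¹ * d, ?_, by simp⟩
    exact QuotientGroup.eq.1 (congrArg Subtype.val hsd)
  have hAGD := AGp_of_injective hK.ag D.subtype D.subtype_injective
  have hDc : ∀ x ∈ D, ∀ y ∈ D, x * y = y * x := by
    intro x hx y hy
    obtain ⟨s, hs, a, ha, h1⟩ := key ⟨x, hx⟩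
    obtain ⟨t, ht, c, hc, h2⟩ := key ⟨y, hy⟩
    simp only at h1 h2
    have hst : (s : K) * t = t * s := congrArg Subtype.val (hAGD q hq S S.2 s hs t ht)
    have hcen : ∀ z ∈ D, ∀ a ∈ A, a * z = z * a := fun z hz a ha =>
      (Subgroup.mem_centralizer_iff.1 (hDC hz)) a ha
    have e1 := hcen t t.2 a ha
    have e2 := hcen s s.2 c hc
    have e3 := hAc a ha c hc
    rw [h1, h2]
    calc (s : K) * a * (t * c) = s * (a * t) * c := by group
      _ = (s * t) * (a * c) := by rw [e1]; group
      _ = t * (s * c) * a := by rw [hst, e3]; group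
      _ = t * c * (s * a) := by rw [← e2]; group
  have hDA : D ≤ A := hmax ⟨hDn, hDc⟩ hAD
  have : j.range = ⊥ := by
    rw [eq_bot_iff]
    intro y hy
    obtain ⟨x, rfl⟩ := QuotientGroup.mk'_surjective A y
    have : x ∈ A := hDA hy
    exact (QuotientGroup.eq_one_iff x).2 this
  rw [MonoidHom.range_eq_bot_iff] at this
  have h01 : (ofAdd (fun _ => 1) : Multiplicative (Fin b → ZMod q)) = 1 := hj (by rw [this]; rfl)
  have := congrFun (ofAdd.injective h01) ⟨0, hb⟩
  exact one_ne_zero this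

lemma exists_selfcent_map {m : ℕ} {K M : Type} [Group K] [Monoid M] (hK : Good m K) (f : K →* M) :
    ∃ A : Subgroup K, A.Normal ∧ (∀ a ∈ A, ∀ b ∈ A, f a * f b = f b * f a) ∧
      ∀ k, (∀ a ∈ A, f k * f a = f a * f k) → k ∈ A := by
  let g := f.toHomUnits
  have hg : ∀ x, (g x : M) = f x := fun x => rfl
  obtain ⟨A, hA, hAc, hAm⟩ := exists_selfcent (hK.surjective g.rangeRestrict g.rangeRestrict_surjective)
  refine ⟨A.comap g.rangeRestrict, hA.comap _, ?_, ?_⟩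
  · intro a ha b hb
    have := hAc _ ha _ hb
    have := congrArg (fun x => ((x.1 : Mˣ) : M)) this
    exact this
  · intro k hk
    apply hAm
    rintro ⟨_, a, rfl⟩ ha
    apply Subtype.ext
    apply Units.ext
    exact hk a ha

lemma field_case {p : ℕ} [hpf : Fact p.Prime] {H N F : Type} [Group H] [AddCommGroup N] [Finite N]
    [Nontrivial N] (ρ : H →* AddMonoid.End N) (b : ℕ) (hN : Nat.card N = p ^ b) [Field F] [Finite F]
    (i : F →+* AddMonoid.End N) (A : Subgroup H)
    (hconj : ∀ h x, ∃ y, i y = ρ h * i x * ρ h⁻¹) (hA : ∀ a ∈ A, ∃ x, i x = ρ a)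
    (hcent : ∀ h, (∀ x, ρ h * i x = i x * ρ h) → h ∈ A) :
    ∃ (B : Subgroup H) (m : ℕ), B.index ≤ b ∧ 1 ≤ m ∧ m ≤ b ∧
      ∃ (φ : B →* (GaloisField p m)ˣ) (θ : GaloisField p m →+ N), θ ≠ 0 ∧
        ∀ (x : B) k, θ (φ x * k) = ρ x (θ k) := by
  have hp : p.Prime := hpf.out
  have : Nontrivial (AddMonoid.End N) := by
    obtain ⟨v, hv⟩ := exists_ne (0 : N)
    exact ⟨1, 0, fun h => hv (DFunLike.congr_fun h v)⟩
  have hinj : Function.Injective i := i.injective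
  have hchar : CharP F p := by
    obtain ⟨q, hq⟩ := CharP.exists F
    have h1 : ((p ^ b : ℕ) : F) = 0 := by
      apply hinj
      rw [map_natCast, map_zero]
      ext v
      rw [AddMonoid.End.natCast_apply, ← hN]
      simp
    have h2 : q ∣ p ^ b := (CharP.cast_eq_zero_iff F q _).1 h1
    have hq' : q.Prime := (CharP.char_is_prime_or_zero F q).resolve_right (CharP.char_ne_zero_of_finite F q)
    have : q = p := (Nat.prime_dvd_prime_iff_eq hq' hp).1 (hq'.dvd_of_dvd_pow h2)
    rwa [← this]
  have := Fintype.ofFinite F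
  obtain ⟨m, -, hm⟩ := FiniteField.card F p
  obtain ⟨v, hv⟩ := exists_ne (0 : N)
  let θF : F →+ N := (AddMonoidHom.eval v).comp i.toAddMonoidHom
  have hθ : ∀ x, θF x = i x v := fun x => rfl
  have hθi : Function.Injective θF := by
    rw [injective_iff_map_eq_zero]
    intro x hx
    by_contra hx0
    apply hv
    have : i (x⁻¹ * x) v = 0 := by
      rw [map_mul]
      change i x⁻¹ (i x v) = 0
      rw [← hθ x, hx, map_zero]
    rw [inv_mul_cancel₀ hx0, map_one] at this
    exact this
  have hmb : (m : ℕ) ≤ b := by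
    have h1 : Nat.card F ≤ Nat.card N := Nat.card_le_card_of_injective _ hθi
    rw [hN, Nat.card_eq_fintype_card, hm] at h1
    exact (Nat.pow_le_pow_iff_right hp.one_lt).1 h1
  have hindex : A.index ≤ m := by
    choose c hc using hconj
    let _ : Algebra (ZMod p) F := ZMod.algebra F p
    have hcm : ∀ h k x, c (h * k) x = c h (c k x) := by
      intro h k x
      apply hinj
      simp only [hc, map_mul, mul_inv_rev, mul_assoc]
    have hc1 : ∀ x, c 1 x = x := by
      intro x; apply hinj; rw [hc]; simp
    let f : H → (F ≃ₐ[ZMod p] F) := fun h => AlgEquiv.ofRingEquiv (f :=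
      { toFun := c h
        invFun := c h⁻¹
        left_inv := fun x => by rw [← hcm]; simp [hc1]
        right_inv := fun x => by rw [← hcm]; simp [hc1]
        map_mul' := fun x y => by
          apply hinj
          rw [map_mul, hc, hc, hc, map_mul]
          have : ρ h⁻¹ * ρ h = 1 := by rw [← map_mul]; simp
          calc ρ h * (i x * i y) * ρ h⁻¹ = ρ h * i x * 1 * i y * ρ h⁻¹ := by simp only [mul_assoc, mul_one]
            _ = _ := by rw [← this]; simp only [mul_assoc]
        map_add' := fun x y => by
          apply hinj
          rw [map_add, hc, hc, hc, map_add, mul_add, add_mul] }) (by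
        intro r
        obtain ⟨n, rfl⟩ := ZMod.natCast_zmod_surjective r
        rw [map_natCast]
        apply hinj
        change i (c h n) = _
        rw [hc, map_natCast, (Nat.cast_commute n (ρ h)).symm.eq, mul_assoc, ← map_mul]
        simp)
    have hf : ∀ h x, f h x = c h x := fun h x => rfl
    have h1 : Nat.card (F ≃ₐ[ZMod p] F) ≤ m := by
      have := AlgEquiv.card_le (F := ZMod p) (K := F)
      have h2 : Module.finrank (ZMod p) F = m := by
        have h3 := Module.card_eq_pow_finrank (K := ZMod p) (V := F)
        rw [hm, ZMod.card] at h3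
        exact (Nat.pow_right_injective hp.two_le h3).symm
      rw [Nat.card_eq_fintype_card]
      exact this.trans h2.le
    refine le_trans ?_ h1
    apply Nat.card_le_card_of_injective (fun x : H ⧸ A => f x.out)
    intro x y hxy
    rw [← QuotientGroup.out_eq' x, ← QuotientGroup.out_eq' y, QuotientGroup.eq]
    apply hcent
    intro z
    have h3 : c (x.out⁻¹ * y.out) z = z := by
      rw [hcm]
      have h4 : f x.out z = f y.out z := by
        have h5 : f x.out = f y.out := hxy
        rw [h5]
      rw [hf, hf] at h4
      rw [← h4, ← hcm]; simp [hc1]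
    have h6 := hc (x.out⁻¹ * y.out) z
    rw [h3] at h6
    conv_rhs => rw [h6]
    rw [mul_assoc _ (ρ _), ← map_mul]; simp
  choose g hg using hA
  let φF : A →* F :=
    { toFun := fun a => g a.1 a.2
      map_one' := by apply hinj; rw [hg]; simp
      map_mul' := fun a a' => by apply hinj; rw [map_mul, hg, hg, hg]; simp }
  have hφ : ∀ a : A, i (φF a) = ρ a := fun a => hg _ _
  have := Fintype.ofFinite (GaloisField p m)
  let e : GaloisField p m ≃+* F := FiniteField.ringEquivOfCardEq (by
    rw [hm, ← Nat.card_eq_fintype_card, GaloisField.card p m m.pos.ne'])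
  refine ⟨A, m, hindex.trans hmb, m.pos, hmb, (e.symm.toMonoidHom.comp φF).toHomUnits,
    θF.comp e.toAddEquiv.toAddMonoidHom, ?_, ?_⟩
  · intro h
    have h1 := DFunLike.congr_fun h 1
    change θF (e 1) = 0 at h1
    rw [map_one, ← map_zero θF] at h1
    exact one_ne_zero (hθi h1)
  · intro x k
    change θF (e (e.symm (φF x) * k)) = ρ x (θF (e k))
    rw [map_mul, e.apply_symm_apply, hθ, hθ, map_mul, hφ]
    rfl


lemma exists_pow_idem {M : Type} [Monoid M] [Finite M] (x : M) :
    ∃ k, 1 ≤ k ∧ x ^ k * x ^ k = x ^ k := by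
  obtain ⟨a, c, hac, h⟩ := Finite.exists_ne_map_eq_of_infinite (fun n : ℕ => x ^ n)
  wlog hlt : a < c generalizing a c
  · exact this c a hac.symm h.symm (lt_of_le_of_ne (not_lt.1 hlt) hac.symm)
  obtain ⟨t, rfl⟩ := Nat.exists_eq_add_of_lt hlt
  have h : x ^ a = x ^ (a + t + 1) := h
  have h1 : ∀ n, a ≤ n → x ^ (n + (t + 1)) = x ^ n := by
    intro n hn
    obtain ⟨d, rfl⟩ := Nat.exists_eq_add_of_le hn
    rw [show a + d + (t + 1) = (a + t + 1) + d by ring, pow_add, ← h, pow_add]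
  have h2 : ∀ s n, a ≤ n → x ^ (n + s * (t + 1)) = x ^ n := by
    intro s
    induction s with
    | zero => simp
    | succ s ih =>
      intro n hn
      rw [show n + (s + 1) * (t + 1) = (n + s * (t + 1)) + (t + 1) by ring, h1 _ (by omega), ih n hn]
  refine ⟨(a + 1) * (t + 1), Nat.mul_pos (by omega) (by omega), ?_⟩
  rw [← pow_add]
  apply h2
  nlinarith

lemma isField_of_idem {H N : Type} [Group H] [AddCommGroup N] [Finite N]
    (ρ : H →* AddMonoid.End N) (hρ : IsSimp ρ) (E : Subring (AddMonoid.End N))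
    (hc : ∀ x ∈ E, ∀ y ∈ E, x * y = y * x)
    (hconj : ∀ h, ∀ x ∈ E, ρ h * x * ρ h⁻¹ ∈ E)
    (hid : ∀ x ∈ E, x * x = x → x = 0 ∨ x = 1) : IsField E := by
  have hN := hρ.1
  let _ : CommRing E := { (inferInstance : Ring E) with
    mul_comm := fun a b => Subtype.ext (hc a a.2 b b.2) }
  have hfin : Finite (AddMonoid.End N) := DFunLike.finite _
  have hnil : ∀ x : E, IsNilpotent x → x = 0 := by
    intro x hx
    let Y : AddSubgroup N :=
      { carrier := {v | ∀ y : E, IsNilpotent y → (y : AddMonoid.End N) v = 0}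
        add_mem' := by
          intro a b ha hb y hy
          rw [map_add, ha y hy, hb y hy, add_zero]
        zero_mem' := by
          intro y hy
          rw [map_zero]
        neg_mem' := by
          intro a ha y hy
          rw [map_neg, ha y hy, neg_zero] }
    have hY : ∀ h, ∀ v ∈ Y, ρ h v ∈ Y := by
      intro h v hv y hy
      have h1 := hconj h⁻¹ y y.2
      have h2 : IsNilpotent (⟨_, h1⟩ : E) := by
        obtain ⟨k, hk⟩ := hy
        refine ⟨k, Subtype.ext ?_⟩
        have hk' : (y : AddMonoid.End N) ^ k = 0 := congrArg Subtype.val hk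
        have h3 : ∀ k, (ρ h⁻¹ * (y : AddMonoid.End N) * ρ h⁻¹⁻¹) ^ k = ρ h⁻¹ * (y : AddMonoid.End N) ^ k * ρ h⁻¹⁻¹ := by
          intro k
          induction k with
          | zero => simp [← map_mul]
          | succ k ih =>
            have h4 : ρ h⁻¹⁻¹ * ρ h⁻¹ = 1 := by rw [← map_mul]; simp
            rw [pow_succ, ih, pow_succ]
            calc ρ h⁻¹ * (y : AddMonoid.End N) ^ k * ρ h⁻¹⁻¹ * (ρ h⁻¹ * y * ρ h⁻¹⁻¹)
                = ρ h⁻¹ * (y : AddMonoid.End N) ^ k * (ρ h⁻¹⁻¹ * ρ h⁻¹) * y * ρ h⁻¹⁻¹ := by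
                  simp only [mul_assoc]
              _ = _ := by rw [h4]; simp only [mul_assoc, one_mul]
        rw [SubmonoidClass.coe_pow, h3, hk']
        simp
      have h5 := hv _ h2
      simp only [inv_inv] at h5
      have h6 : ρ h (ρ h⁻¹ ((y : AddMonoid.End N) (ρ h v))) = 0 := by
        change ρ h⁻¹ ((y : AddMonoid.End N) (ρ h v)) = 0 at h5
        rw [h5, map_zero]
      change (ρ h * ρ h⁻¹) ((y : AddMonoid.End N) (ρ h v)) = 0 at h6
      rw [← map_mul] at h6
      simpa using h6
    rcases hρ.2 Y hY with h | h
    · exfalso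
      have hnilp := IsNoetherianRing.isNilpotent_nilradical E
      classical
      have hex : ∃ k, nilradical E ^ k = 0 := hnilp
      obtain ⟨v0, hv0⟩ := exists_ne (0 : N)
      have h10 : (1 : E) ≠ 0 := fun h1 => hv0 (DFunLike.congr_fun (congrArg Subtype.val h1) v0)
      have hne : Nontrivial E := ⟨1, 0, h10⟩
      have hk0 : Nat.find hex ≠ 0 := by
        intro h0
        have h1 := Nat.find_spec hex
        rw [h0, pow_zero] at h1
        exact one_ne_zero h1
      obtain ⟨k, hk⟩ := Nat.exists_eq_succ_of_ne_zero hk0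
      have hk1 : nilradical E ^ k ≠ 0 := Nat.find_min hex (by omega)
      have hk2 : nilradical E ^ (k + 1) = 0 := by
        have h1 := Nat.find_spec hex
        rwa [hk] at h1
      obtain ⟨z, hz, hz0⟩ := Submodule.exists_mem_ne_zero_of_ne_bot hk1
      obtain ⟨v, hv⟩ : ∃ v, (z : AddMonoid.End N) v ≠ 0 := by
        by_contra! hcon
        exact hz0 (Subtype.ext (AddMonoidHom.ext hcon))
      apply hv
      have : (z : AddMonoid.End N) v ∈ Y := by
        intro y hy
        have h1 : z * y ∈ nilradical E ^ (k + 1) := by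
          rw [pow_succ]
          exact Ideal.mul_mem_mul hz (mem_nilradical.2 hy)
        rw [hk2] at h1
        have h2 : z * y = 0 := h1
        rw [mul_comm] at h2
        exact DFunLike.congr_fun (congrArg Subtype.val h2) v
      rw [h] at this
      exact this
    · apply Subtype.ext
      apply AddMonoidHom.ext
      intro v
      have : v ∈ Y := h ▸ AddSubgroup.mem_top v
      exact this x hx
  have hunit : ∀ x : E, x ≠ 0 → ∃ y, x * y = 1 := by
    intro x hx
    obtain ⟨k, hk, hkk⟩ := exists_pow_idem x
    rcases hid _ (x ^ k).2 (congrArg Subtype.val hkk) with h | h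
    · exact absurd (hnil x ⟨k, Subtype.ext h⟩) hx
    · refine ⟨x ^ (k - 1), ?_⟩
      rw [← pow_succ', Nat.sub_add_cancel hk]
      exact Subtype.ext h
  obtain ⟨v, hv⟩ := exists_ne (0 : N)
  refine ⟨⟨0, 1, ?_⟩, fun x y => mul_comm x y, fun {x} hx => hunit x hx⟩
  intro h
  exact hv (DFunLike.congr_fun (congrArg Subtype.val h) v).symm


theorem struct_lemma {p : ℕ} [hpf : Fact p.Prime] {μ : ℕ} (b : ℕ) : ∀ (H N : Type) [Group H]
    [AddCommGroup N] [Finite N] (_ : Good μ H) (ρ : H →* AddMonoid.End N) (_ : IsSimp ρ)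
    (_ : Nat.card N = p ^ b),
    ∃ (B : Subgroup H) (m : ℕ), B.index ≤ b ∧ 1 ≤ m ∧ m ≤ b ∧
      ∃ (φ : B →* (GaloisField p m)ˣ) (θ : GaloisField p m →+ N), θ ≠ 0 ∧
        ∀ (x : B) k, θ (φ x * k) = ρ x (θ k) := by
  have hp := hpf.out
  induction b using Nat.strong_induction_on with
  | _ b IH =>
  intro H N _ _ _ hH ρ hρ hN
  have hNn := hρ.1
  have := hH.fin
  obtain ⟨A, hAn, hAc, hAm⟩ := exists_selfcent_map hH ρ
  let E : Subring (AddMonoid.End N) := Subring.closure (ρ '' A)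
  have hAE : ∀ a ∈ A, ρ a ∈ E := fun a ha => Subring.subset_closure ⟨a, ha, rfl⟩
  have hc : ∀ x ∈ E, ∀ y ∈ E, x * y = y * x := by
    intro x hx y hy
    let _ := Subring.closureCommRingOfComm (s := ρ '' A) (by
      rintro _ ⟨a, ha, rfl⟩ _ ⟨c, hc, rfl⟩
      exact hAc a ha c hc)
    exact congrArg Subtype.val (mul_comm (⟨x, hx⟩ : Subring.closure (ρ '' A)) ⟨y, hy⟩)
  have hii : ∀ h, ρ h⁻¹ * ρ h = 1 := fun h => by rw [← map_mul]; simp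
  have hii' : ∀ h, ρ h * ρ h⁻¹ = 1 := fun h => by rw [← map_mul]; simp
  have hcmul : ∀ h x y, ρ h * (x * y) * ρ h⁻¹ = (ρ h * x * ρ h⁻¹) * (ρ h * y * ρ h⁻¹) := by
    intro h x y
    calc ρ h * (x * y) * ρ h⁻¹ = ρ h * x * 1 * y * ρ h⁻¹ := by simp only [mul_assoc, mul_one]
      _ = _ := by rw [← hii h]; simp only [mul_assoc]
  have hcc : ∀ h k x, ρ h * (ρ k * x * ρ k⁻¹) * ρ h⁻¹ = ρ (h * k) * x * ρ (h * k)⁻¹ := by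
    intro h k x
    simp only [map_mul, mul_inv_rev, mul_assoc]
  have hconj : ∀ h, ∀ x ∈ E, ρ h * x * ρ h⁻¹ ∈ E := by
    intro h x hx
    induction hx using Subring.closure_induction with
    | mem x hx =>
      obtain ⟨a, ha, rfl⟩ := hx
      rw [← map_mul, ← map_mul]
      exact hAE _ (hAn.conj_mem a ha h)
    | zero => simp [E.zero_mem]
    | one => simp [hii', E.one_mem]
    | add x y _ _ hx hy => rw [mul_add, add_mul]; exact E.add_mem hx hy
    | neg x _ hx => rw [mul_neg, neg_mul]; exact E.neg_mem hx
    | mul x y _ _ hx hy => rw [hcmul]; exact E.mul_mem hx hy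
  -- minimal idempotent
  have hfin : Finite (AddMonoid.End N) := DFunLike.finite _
  obtain ⟨e, ⟨heE, hee, he0⟩, hemin⟩ := Set.exists_min_image
    {e : AddMonoid.End N | e ∈ E ∧ e * e = e ∧ e ≠ 0}
    (fun e => Nat.card (AddMonoidHom.range (e : N →+ N))) (Set.toFinite _) ⟨1, E.one_mem, one_mul 1, by
      obtain ⟨v, hv⟩ := exists_ne (0 : N)
      exact fun h => hv (DFunLike.congr_fun h v)⟩
  have hmin : ∀ f ∈ E, f * f = f → e * f = f → f = 0 ∨ f = e := by
    intro f hf hff hef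
    by_cases hf0 : f = 0
    · exact Or.inl hf0
    right
    have h1 := hemin f ⟨hf, hff, hf0⟩
    have h2 : AddMonoidHom.range (f : N →+ N) ≤ AddMonoidHom.range (e : N →+ N) := by
      rintro _ ⟨v, rfl⟩
      exact ⟨f v, DFunLike.congr_fun hef v⟩
    have h3 := AddSubgroup.eq_of_le_of_card_ge h2 h1
    have h4 : f * e = e := by
      apply AddMonoidHom.ext
      intro v
      have : e v ∈ AddMonoidHom.range (f : N →+ N) := h3 ▸ ⟨v, rfl⟩
      obtain ⟨w, hw⟩ := this
      change f (e v) = e v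
      rw [← hw]
      exact DFunLike.congr_fun hff w
    rw [← h4, hc f hf e heE, hef]
  have horth : ∀ h, e * (ρ h * e * ρ h⁻¹) = 0 ∨ ρ h * e * ρ h⁻¹ = e := by
    have main : ∀ h, e * (ρ h * e * ρ h⁻¹) = 0 ∨ e * (ρ h * e * ρ h⁻¹) = e := by
      intro h
      have h1 := hconj h e heE
      have h2 : (ρ h * e * ρ h⁻¹) * (ρ h * e * ρ h⁻¹) = ρ h * e * ρ h⁻¹ := by rw [← hcmul, hee]
      apply hmin _ (E.mul_mem heE h1)
      · generalize ρ h * e * ρ h⁻¹ = g at h1 h2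
        calc e * g * (e * g) = e * (g * e) * g := by simp only [mul_assoc]
          _ = e * (e * g) * g := by rw [hc g h1 e heE]
          _ = (e * e) * (g * g) := by simp only [mul_assoc]
          _ = e * g := by rw [hee, h2]
      · rw [← mul_assoc, hee]
    intro h
    rcases main h with h1 | h1
    · exact Or.inl h1
    right
    rcases main h⁻¹ with h2 | h2
    · exfalso
      apply he0
      rw [← h1]
      have h3 : ρ h * (e * (ρ h⁻¹ * e * ρ h⁻¹⁻¹)) * ρ h⁻¹ = ρ h * 0 * ρ h⁻¹ := by rw [h2]
      rw [hcmul h e, hcc h h⁻¹ e, mul_inv_cancel, inv_one, map_one, one_mul, mul_one, mul_zero,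
        zero_mul] at h3
      rw [hc e heE _ (hconj h e heE), h3]
    · have h3 : ρ h * (e * (ρ h⁻¹ * e * ρ h⁻¹⁻¹)) * ρ h⁻¹ = ρ h * e * ρ h⁻¹ := by rw [h2]
      rw [hcmul h e, hcc h h⁻¹ e, mul_inv_cancel, inv_one, map_one, one_mul, mul_one] at h3
      rw [← h3, hc _ (hconj h e heE) e heE, h1]
  by_cases he1 : e = 1
  · -- field case
    have hfield : IsField E := isField_of_idem ρ hρ E hc hconj (by
      intro x hx hxx
      have := hmin x hx hxx (by rw [he1, one_mul])
      rwa [he1] at this)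
    let _ := hfield.toField
    exact field_case ρ b hN E.subtype A (fun h x => ⟨⟨_, hconj h x x.2⟩, rfl⟩)
      (fun a ha => ⟨⟨_, hAE a ha⟩, rfl⟩) (fun h hh => hAm h (fun a ha => hh ⟨_, hAE a ha⟩))
  · -- induction
    let H0 : Subgroup H :=
      { carrier := {h | ρ h * e * ρ h⁻¹ = e}
        one_mem' := by simp
        mul_mem' := by
          intro a c ha hc
          change ρ (a * c) * e * ρ (a * c)⁻¹ = e
          rw [← hcc, hc, ha]
        inv_mem' := by
          intro a ha
          change ρ a⁻¹ * e * ρ a⁻¹⁻¹ = e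
          have ha : ρ a * e * ρ a⁻¹ = e := ha
          conv_lhs => rw [← ha]
          rw [hcc]; simp }
    have hH0 : ∀ h, h ∈ H0 ↔ ρ h * e * ρ h⁻¹ = e := fun h => Iff.rfl
    let N0 : AddSubgroup N := AddMonoidHom.range (e : N →+ N)
    have hN0 : ∀ v ∈ N0, e v = v := by
      rintro _ ⟨v, rfl⟩
      exact DFunLike.congr_fun hee v
    have hcomm : ∀ h v, ρ h (e v) = (ρ h * e * ρ h⁻¹) (ρ h v) := by
      intro h v
      have : ρ h * e = ρ h * e * ρ h⁻¹ * ρ h := by rw [mul_assoc _ (ρ h⁻¹), hii, mul_one]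
      exact DFunLike.congr_fun this v
    have hin : ∀ h ∈ H0, ∀ v ∈ N0, ρ h v ∈ N0 := by
      intro h hh v hv
      rw [← hN0 v hv, hcomm, (hH0 h).1 hh]
      exact ⟨_, rfl⟩
    have hout : ∀ h, h ∉ H0 → ∀ v ∈ N0, e (ρ h v) = 0 := by
      intro h hh v hv
      rw [← hN0 v hv, hcomm]
      exact DFunLike.congr_fun ((horth h).resolve_right hh) _
    let ρ0 : H0 →* AddMonoid.End N0 :=
      { toFun := fun h =>
          { toFun := fun v => ⟨ρ h v, hin h h.2 v v.2⟩
            map_zero' := by ext; simp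
            map_add' := by intro x y; ext; simp }
        map_one' := by
          apply AddMonoidHom.ext; intro v; apply Subtype.ext
          change ρ ((1 : H0) : H) (v : N) = v
          simp
        map_mul' := by
          intro x y
          apply AddMonoidHom.ext; intro v; apply Subtype.ext
          change ρ ((x * y : H0) : H) (v : N) = ρ x (ρ y v)
          rw [Subgroup.coe_mul, map_mul]; rfl }
    have hρ0 : ∀ (h : H0) (v : N0), ((ρ0 h v : N0) : N) = ρ h v := fun h v => rfl
    have hsimp : IsSimp ρ0 := by
      constructor
      · obtain ⟨v, hv⟩ : ∃ v, e v ≠ 0 := by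
          by_contra! hcon
          exact he0 (AddMonoidHom.ext hcon)
        exact ⟨⟨e v, v, rfl⟩, 0, fun h => hv (congrArg Subtype.val h)⟩
      · intro X hX
        let Y : AddSubgroup N := AddSubgroup.closure {y | ∃ h : H, ∃ x ∈ X, y = ρ h (x : N)}
        have hY : ∀ h, ∀ y ∈ Y, ρ h y ∈ Y := by
          intro h y hy
          induction hy using AddSubgroup.closure_induction with
          | mem y hy =>
            obtain ⟨k, x, hx, rfl⟩ := hy
            apply AddSubgroup.subset_closure
            refine ⟨h * k, x, hx, ?_⟩
            rw [map_mul]; rfl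
          | zero => rw [map_zero]; exact Y.zero_mem
          | add x y _ _ hx hy => rw [map_add]; exact Y.add_mem hx hy
          | neg x _ hx => rw [map_neg]; exact Y.neg_mem hx
        have hYX : ∀ y ∈ Y, ∃ x ∈ X, (x : N) = e y := by
          intro y hy
          induction hy using AddSubgroup.closure_induction with
          | mem y hy =>
            obtain ⟨k, x, hx, rfl⟩ := hy
            by_cases hk : k ∈ H0
            · refine ⟨ρ0 ⟨k, hk⟩ x, hX _ _ hx, ?_⟩
              rw [hρ0, hN0]
              exact hin k hk x x.2
            · exact ⟨0, X.zero_mem, by rw [hout k hk x x.2]; rfl⟩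
          | zero => exact ⟨0, X.zero_mem, by rw [map_zero]; rfl⟩
          | add x y _ _ hx hy =>
            obtain ⟨x', hx', hx⟩ := hx
            obtain ⟨y', hy', hy⟩ := hy
            exact ⟨x' + y', X.add_mem hx' hy', by rw [map_add, ← hx, ← hy]; rfl⟩
          | neg x _ hx =>
            obtain ⟨x', hx', hx⟩ := hx
            exact ⟨-x', X.neg_mem hx', by rw [map_neg, ← hx]; rfl⟩
        rcases hρ.2 Y hY with h | h
        · left
          rw [eq_bot_iff]
          intro x hx
          have : (x : N) ∈ Y := AddSubgroup.subset_closure ⟨1, x, hx, by simp⟩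
          rw [h] at this
          exact Subtype.ext this
        · right
          rw [eq_top_iff]
          intro x _
          obtain ⟨y, hy, hyx⟩ := hYX x (h ▸ AddSubgroup.mem_top _)
          rw [hN0 x x.2] at hyx
          rwa [← Subtype.ext hyx]
    -- cardinalities
    obtain ⟨b0, -, hb0⟩ := (Nat.dvd_prime_pow hp).1 (hN ▸ AddSubgroup.card_addSubgroup_dvd_card N0)
    have hlt : b0 < b := by
      apply (Nat.pow_lt_pow_iff_right hp.one_lt).1
      rw [← hb0, ← hN]
      apply lt_of_le_of_ne (AddSubgroup.card_le_card_addGroup N0)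
      intro h
      apply he1
      have h1 := (AddSubgroup.card_eq_iff_eq_top N0).1 h
      apply AddMonoidHom.ext
      intro v
      exact hN0 v (h1 ▸ AddSubgroup.mem_top v)
    have hmulle : b0 * H0.index ≤ b := by
      apply (Nat.pow_le_pow_iff_right hp.one_lt).1
      rw [pow_mul, ← hb0, ← hN, Subgroup.index, ← Nat.card_fun]
      have := Fintype.ofFinite (H ⧸ H0)
      classical
      let F : (H ⧸ H0 → N0) →+ N :=
        { toFun := fun n => ∑ q, ρ q.out (n q : N)
          map_zero' := by simp
          map_add' := by intro x y; simp [Finset.sum_add_distrib] }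
      have hF : ∀ n, F n = ∑ q, ρ q.out (n q : N) := fun n => rfl
      apply Nat.card_le_card_of_injective F
      rw [injective_iff_map_eq_zero]
      intro n hn
      ext q'
      have h1 : e (ρ (q'.out)⁻¹ (F n)) = 0 := by rw [hn, map_zero, map_zero]
      rw [hF, map_sum, map_sum, Finset.sum_eq_single q'] at h1
      · have h2 : ρ (q'.out)⁻¹ (ρ q'.out (n q' : N)) = n q' := DFunLike.congr_fun (hii q'.out) _
        rw [h2, hN0 _ (n q').2] at h1
        exact h1
      · intro q _ hq
        have h2 : ρ (q'.out)⁻¹ (ρ q.out (n q : N)) = ρ ((q'.out)⁻¹ * q.out) (n q : N) := by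
          rw [map_mul]; rfl
        rw [h2]
        apply hout _ _ _ (n q).2
        intro h3
        apply hq
        have := QuotientGroup.eq.2 h3
        rw [QuotientGroup.out_eq', QuotientGroup.out_eq'] at this
        exact this.symm
      · simp
    obtain ⟨B0, m, hB0, hm1, hm, φ, θ, hθ, hθφ⟩ := IH b0 hlt H0 N0 (hH.subgroup H0) ρ0 hsimp hb0
    let eB := B0.equivMapOfInjective H0.subtype H0.subtype_injective
    refine ⟨B0.map H0.subtype, m, ?_, hm1, hm.trans hlt.le, φ.comp eB.symm.toMonoidHom,
      N0.subtype.comp θ, ?_, ?_⟩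
    · rw [Subgroup.index_map_subtype]
      exact le_trans (Nat.mul_le_mul_right _ hB0) hmulle
    · intro h
      apply hθ
      ext k
      exact DFunLike.congr_fun h k
    · intro x k
      obtain ⟨y, rfl⟩ := eB.surjective x
      change ((θ (φ (eB.symm (eB y)) * k) : N0) : N) = ρ (eB y) (θ k)
      rw [eB.symm_apply_apply, hθφ]
      rfl


lemma card_hom_comm_le {μ : ℕ} {B : Type} [Group B] [Finite B]
    (hB : ∀ p : ℕ, p.Prime → (Nat.card B).factorization p ≤ μ) (c : ℕ) :
    ∀ (C : Type) [CommGroup C] [Finite C], Nat.card C = c → Nat.card (B →* C) ≤ c ^ μ := by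
  induction c using Nat.strong_induction_on with
  | _ c IH =>
  intro C _ _ hC
  by_cases h1 : c = 1
  · have : Subsingleton C := (Nat.card_eq_one_iff_unique.1 (hC.trans h1)).1
    have : Nat.card (B →* C) ≤ 1 := by
      have : Subsingleton (B →* C) := ⟨fun f g => MonoidHom.ext fun x => Subsingleton.elim _ _⟩
      exact Finite.card_le_one_iff_subsingleton.2 this
    rw [h1, one_pow]; exact this
  obtain ⟨q, hq, hqc⟩ := Nat.exists_prime_and_dvd h1
  have : Fact q.Prime := ⟨hq⟩
  obtain ⟨z, hz⟩ := exists_prime_orderOf_dvd_card' q (hC ▸ hqc)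
  let Z := Subgroup.zpowers z
  have hZ : Nat.card Z = q := by rw [Nat.card_zpowers, hz]
  have hCZ : Nat.card C = Nat.card (C ⧸ Z) * Nat.card Z := Subgroup.card_eq_card_quotient_mul_card_subgroup Z
  have hpos : 0 < Nat.card (C ⧸ Z) := Nat.card_pos
  have hlt : Nat.card (C ⧸ Z) < c := by
    rw [← hC, hCZ, hZ]
    exact lt_mul_of_one_lt_right hpos hq.one_lt
  have hIH := IH _ hlt (C ⧸ Z) rfl
  have hfB : Finite (B →* C) := DFunLike.finite _
  have hfB' : Finite (B →* C ⧸ Z) := DFunLike.finite _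
  have hfZ : Finite (B →* Z) := DFunLike.finite _
  have P : Sylow q B := default
  have hfP : Finite (P →* Z) := DFunLike.finite _
  have hBZ : Nat.card (B →* Z) ≤ q ^ μ := by
    have h2 : Nat.card (P →* Z) ≤ Nat.card Z ^ μ := card_hom_le hq P.2
      (factorization_le_of_dvd Nat.card_pos.ne' (Subgroup.card_subgroup_dvd_card _) (hB q hq))
    rw [hZ] at h2
    refine le_trans ?_ h2
    apply Nat.card_le_card_of_injective (fun f : B →* Z => f.comp (P : Subgroup B).subtype)
    intro f g hfg
    have h3 : (P : Subgroup B) ≤ (f / g).ker := by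
      intro x hx
      rw [MonoidHom.mem_ker, MonoidHom.div_apply, div_eq_one]
      exact DFunLike.congr_fun hfg (⟨x, hx⟩ : P)
    have h4 := Subgroup.index_dvd_of_le h3
    have h5 : (f / g).ker.index ∣ q := by
      rw [Subgroup.index_ker, ← hZ]
      exact Subgroup.card_subgroup_dvd_card _
    have h6 : (f / g).ker.index = 1 := by
      rcases (Nat.dvd_prime hq).1 h5 with h | h
      · exact h
      · rw [h] at h4
        exact absurd h4 P.not_dvd_index
    have h7 := Subgroup.index_eq_one.1 h6
    ext x
    have : x ∈ (f / g).ker := h7 ▸ Subgroup.mem_top x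
    rw [MonoidHom.mem_ker, MonoidHom.div_apply, div_eq_one] at this
    rw [this]
  have hfib := card_le_of_fibers (fun f : B →* C => (QuotientGroup.mk' Z).comp f) (q ^ μ) (by
    intro k
    by_cases hne : Nonempty {j : B →* C // (QuotientGroup.mk' Z).comp j = k}
    · obtain ⟨f0, hf0⟩ := hne
      refine le_trans ?_ hBZ
      have key : ∀ f : {j : B →* C // (QuotientGroup.mk' Z).comp j = k}, ∀ x, (f.1 / f0) x ∈ Z := by
        intro f x
        have h := DFunLike.congr_fun (f.2.trans hf0.symm) x
        have h' : (QuotientGroup.mk (f.1 x) : C ⧸ Z) = QuotientGroup.mk (f0 x) := h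
        rw [eq_comm, QuotientGroup.eq] at h'
        rw [MonoidHom.div_apply, div_eq_inv_mul]
        exact h'
      apply Nat.card_le_card_of_injective
        (fun f : {j : B →* C // (QuotientGroup.mk' Z).comp j = k} => (f.1 / f0).codRestrict Z (key f))
      intro f g hfg
      apply Subtype.ext
      ext x
      have := congrArg Subtype.val (DFunLike.congr_fun hfg x)
      simpa using this
    · rw [not_nonempty_iff] at hne
      simp)
  rw [← hC, hCZ, mul_pow, hZ]
  exact hfib.trans (Nat.mul_le_mul_right _ hIH)

/-- independence of simple modules -/
lemma simple_indep {H W ι : Type} [Group H] [AddCommGroup W] [Finite W]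
    (ρ : ι → H →* AddMonoid.End W) (hs : ∀ i, IsSimp (ρ i))
    (hd : ∀ i j, Cj (ρ i) (ρ j) → i = j) (R : AddSubgroup (ι → W))
    (hR : ∀ h, ∀ r ∈ R, (fun i => ρ i h (r i)) ∈ R) (hne : ∀ i, ∃ r ∈ R, r i ≠ 0) (s : Finset ι) :
    ∀ w : ι → W, ∃ r ∈ R, ∀ i ∈ s, r i = w i := by
  classical
  induction s using Finset.induction_on with
  | empty => exact fun w => ⟨0, R.zero_mem, by simp⟩
  | insert i0 s hi0 IH =>
    let X : AddSubgroup W :=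
      { carrier := {x | ∃ r ∈ R, (∀ i ∈ s, r i = 0) ∧ r i0 = x}
        zero_mem' := ⟨0, R.zero_mem, fun _ _ => rfl, rfl⟩
        add_mem' := by
          rintro _ _ ⟨r, hr, hr0, rfl⟩ ⟨r', hr', hr0', rfl⟩
          exact ⟨r + r', R.add_mem hr hr', fun i hi => by simp [hr0 i hi, hr0' i hi], rfl⟩
        neg_mem' := by
          rintro _ ⟨r, hr, hr0, rfl⟩
          exact ⟨-r, R.neg_mem hr, fun i hi => by simp [hr0 i hi], rfl⟩ }
    rcases (hs i0).2 X (by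
      rintro h _ ⟨r, hr, hr0, rfl⟩
      exact ⟨_, hR h r hr, fun i hi => by simp [hr0 i hi], rfl⟩) with hX | hX
    · exfalso
      have hz : ∀ r ∈ R, (∀ i ∈ s, r i = 0) → r i0 = 0 := by
        intro r hr hr0
        have : r i0 ∈ X := ⟨r, hr, hr0, rfl⟩
        rw [hX] at this
        exact this
      have huniq : ∀ r ∈ R, ∀ r' ∈ R, (∀ i ∈ s, r i = r' i) → r i0 = r' i0 := by
        intro r hr r' hr' h
        rw [← sub_eq_zero]
        exact hz (r - r') (R.sub_mem hr hr') (fun i hi => by simp [h i hi])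
      choose L hLR hL using IH
      let g : ι → W →+ W := fun j =>
        { toFun := fun w => L (Pi.single j w) i0
          map_zero' := hz _ (hLR _) (fun i hi => by rw [hL _ i hi]; simp)
          map_add' := fun x y => by
            have := huniq (L (Pi.single j (x + y))) (hLR _) (L (Pi.single j x) + L (Pi.single j y))
              (R.add_mem (hLR _) (hLR _)) (fun i hi => by
                rw [Pi.add_apply, hL _ i hi, hL _ i hi, hL _ i hi, Pi.single_add]; rfl)
            exact this }
      have hg : ∀ j w, g j w = L (Pi.single j w) i0 := fun _ _ => rfl
      obtain ⟨r, hr, hr0⟩ := hne i0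
      have hsum : r i0 = ∑ j ∈ s, g j (r j) := by
        have := huniq r hr (∑ j ∈ s, L (Pi.single j (r j))) (R.sum_mem fun j _ => hLR _) (by
          intro i hi
          rw [Finset.sum_apply, Finset.sum_congr rfl (fun j _ => hL (Pi.single j (r j)) i hi),
            Finset.sum_eq_single i]
          · simp
          · intro j _ hj; simp [hj.symm]
          · intro h; exact absurd hi h)
        rw [this, Finset.sum_apply]
        rfl
      obtain ⟨j, hj, hgj⟩ : ∃ j ∈ s, g j (r j) ≠ 0 := by
        by_contra! hcon
        exact hr0 (hsum.trans (Finset.sum_eq_zero hcon))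
      have heq : ∀ h w, g j (ρ j h w) = ρ i0 h (g j w) := by
        intro h w
        apply huniq _ (hLR _) _ (hR h _ (hLR _))
        intro i hi
        rw [hL _ i hi]
        change _ = ρ i h (L (Pi.single j w) i)
        rw [hL _ i hi]
        by_cases hij : i = j
        · subst hij; simp
        · simp [hij]
      have hker : (g j).ker = ⊥ := by
        rcases (hs j).2 (g j).ker (by
          intro h x hx
          rw [AddMonoidHom.mem_ker] at hx ⊢
          rw [heq, hx, map_zero]) with h | h
        · exact h
        · exfalso
          apply hgj
          have : r j ∈ (g j).ker := h ▸ AddSubgroup.mem_top _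
          exact this
      have hinj : Function.Injective (g j) := (AddMonoidHom.ker_eq_bot_iff _).1 hker
      have hbij : Function.Bijective (g j) := ⟨hinj, Finite.surjective_of_injective hinj⟩
      have := hd j i0 ⟨AddEquiv.ofBijective (g j) hbij, fun h w => heq h w⟩
      exact hi0 (this ▸ hj)
    · intro w
      obtain ⟨r, hr, hrw⟩ := IH w
      have : w i0 - r i0 ∈ X := hX ▸ AddSubgroup.mem_top _
      obtain ⟨r', hr', hr0', hr1⟩ := this
      refine ⟨r + r', R.add_mem hr hr', fun i hi => ?_⟩
      rcases Finset.mem_insert.1 hi with rfl | hi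
      · rw [Pi.add_apply, hr1]; abel
      · rw [Pi.add_apply, hr0' i hi, add_zero, hrw i hi]

lemma card_fibre {H W ι K : Type} [Group H] [Finite H] [AddCommGroup W] [Finite W] [AddCommGroup K]
    [Finite K] [Finite ι] (B : Subgroup H) (φ : B → K → K)
    (ρ : ι → H →* AddMonoid.End W) (hs : ∀ i, IsSimp (ρ i))
    (hd : ∀ i j, Cj (ρ i) (ρ j) → i = j) (θ : ι → K →+ W) (hθ : ∀ i, θ i ≠ 0)
    (hθφ : ∀ i (x : B) k, θ i (φ x k) = ρ i x (θ i k)) :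
    Nat.card W ^ Nat.card ι ≤ Nat.card K ^ B.index := by
  classical
  have := Fintype.ofFinite (H ⧸ B)
  have := Fintype.ofFinite ι
  let F : (H ⧸ B → K) →+ (ι → W) :=
    { toFun := fun n i => ∑ q, ρ i q.out (θ i (n q))
      map_zero' := by ext i; simp
      map_add' := by intro x y; ext i; simp [Finset.sum_add_distrib] }
  have hF : ∀ n i, F n i = ∑ q, ρ i q.out (θ i (n q)) := fun _ _ => rfl
  have hsingle : ∀ h k, (fun i => ρ i h (θ i k)) ∈ F.range := by
    intro h k
    have hx : (QuotientGroup.mk h : H ⧸ B).out⁻¹ * h ∈ B := by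
      rw [← QuotientGroup.eq, QuotientGroup.out_eq']
    refine ⟨Pi.single (QuotientGroup.mk h) (φ ⟨_, hx⟩ k), ?_⟩
    ext i
    rw [hF, Finset.sum_eq_single (QuotientGroup.mk h)]
    · rw [Pi.single_eq_same, hθφ]
      change (ρ i _ * ρ i _) (θ i k) = _
      rw [← map_mul]
      simp
    · intro q _ hq; simp [hq]
    · simp
  have htop : F.range = ⊤ := by
    rw [eq_top_iff]
    intro w _
    obtain ⟨r, hr, hrw⟩ := simple_indep ρ hs hd F.range (by
      rintro h _ ⟨n, rfl⟩
      have : (fun i => ρ i h (F n i)) = ∑ q : H ⧸ B, fun i => ρ i (h * q.out) (θ i (n q)) := by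
        ext i
        rw [hF, map_sum, Finset.sum_apply]
        refine Finset.sum_congr rfl fun q _ => ?_
        rw [map_mul]; rfl
      rw [this]
      exact F.range.sum_mem fun q _ => hsingle _ _) (by
      intro i
      obtain ⟨k, hk⟩ : ∃ k, θ i k ≠ 0 := by
        by_contra! hcon
        exact hθ i (AddMonoidHom.ext hcon)
      exact ⟨_, hsingle 1 k, by simpa using hk⟩) Finset.univ w
    have : r = w := funext fun i => hrw i (Finset.mem_univ i)
    exact this ▸ hr
  have hsurj : Function.Surjective F := AddMonoidHom.range_eq_top.1 htop
  have := Nat.card_le_card_of_surjective F hsurj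
  rwa [Nat.card_fun, Nat.card_fun] at this

lemma num1 (b : ℕ) : b ^ 9 ≤ 2 ^ (5 * b) := by
  by_cases hb : b < 11
  · interval_cases b <;> norm_num
  · push Not at hb
    induction b, hb using Nat.le_induction with
    | base => norm_num
    | succ n hn ih =>
      have h1 : (n + 1) ^ 9 ≤ 32 * n ^ 9 := by
        have h2 : 10 * (n + 1) ≤ 11 * n := by omega
        have h3 := Nat.pow_le_pow_left h2 9
        rw [mul_pow, mul_pow] at h3
        norm_num at h3
        omega
      calc (n + 1) ^ 9 ≤ 32 * n ^ 9 := h1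
        _ ≤ 32 * 2 ^ (5 * n) := Nat.mul_le_mul_left _ ih
        _ = _ := by rw [Nat.mul_add, pow_add]; norm_num; ring

theorem R_bound {p : ℕ} [hpf : Fact p.Prime] {μ : ℕ} (hμ : 1 ≤ μ) (b : ℕ) (hb : 1 ≤ b)
    (hS : ∀ (H : Type) [Group H], Good μ H →
      Nat.card {U : Subgroup H // U.index ≤ b} ≤ b ^ (7 * μ + 7))
    (H W ι : Type) [Group H] [AddCommGroup W] [Finite W] [Finite ι] (hH : Good μ H)
    (hW : Nat.card W = p ^ b) (ρ : ι → H →* AddMonoid.End W) (hs : ∀ i, IsSimp (ρ i))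
    (hd : ∀ i j, Cj (ρ i) (ρ j) → i = j) : Nat.card ι ≤ (p ^ b) ^ (6 * μ + 4) := by
  have hp := hpf.out
  have := hH.fin
  choose B m hB hm1 hm φ θ hθ hθφ using fun i => struct_lemma b H W hH (ρ i) (hs i) hW
  let T := {U : Subgroup H // U.index ≤ b}
  let D := Σ (x : T × Fin b), (x.1.1 →* (GaloisField p (x.2.1 + 1))ˣ)
  have hfin : ∀ x : T × Fin b, Finite (x.1.1 →* (GaloisField p (x.2.1 + 1))ˣ) := by
    intro x
    have : Finite (GaloisField p (x.2.1 + 1)) := inferInstance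
    exact DFunLike.finite _
  have hD : Nat.card D ≤ (b ^ (7 * μ + 7) * b) * (p ^ b) ^ μ := by
    have := Fintype.ofFinite (T × Fin b)
    rw [Nat.card_sigma]
    have h1 : ∀ x ∈ (Finset.univ : Finset (T × Fin b)),
        Nat.card (x.1.1 →* (GaloisField p (x.2.1 + 1))ˣ) ≤ (p ^ b) ^ μ := by
      intro x _
      have hfG : Finite (GaloisField p (x.2.1 + 1)) := inferInstance
      refine le_trans (card_hom_comm_le (hH.subgroup _).ex _ _ rfl) ?_
      apply Nat.pow_le_pow_left
      refine le_trans (Nat.card_le_card_of_injective _ Units.val_injective) ?_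
      rw [GaloisField.card p _ (Nat.succ_ne_zero _)]
      exact Nat.pow_le_pow_right hp.pos x.2.2
    refine le_trans (Finset.sum_le_card_nsmul _ _ _ h1) ?_
    rw [smul_eq_mul, Finset.card_univ, ← Nat.card_eq_fintype_card, Nat.card_prod, Nat.card_fin]
    exact Nat.mul_le_mul_right _ (Nat.mul_le_mul_right _ (hS H hH))
  have hDf : Finite D := inferInstance
  have hex : ∀ i, ∃ d : D, ∃ θ : GaloisField p (d.1.2.1 + 1) →+ W, θ ≠ 0 ∧
      ∀ (x : d.1.1.1) k, θ (d.2 x * k) = ρ i x (θ k) := by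
    intro i
    obtain ⟨m', hm'⟩ : ∃ m', m i = m' + 1 := ⟨m i - 1, by have := hm1 i; omega⟩
    have h1 := hm i
    have h2 := hθ i
    have h3 := hθφ i
    generalize θ i = θ' at h2 h3
    generalize φ i = φ' at h3
    revert θ' φ'
    rw [hm'] at h1 ⊢
    intro θ' h2 φ' h3
    exact ⟨⟨(⟨B i, hB i⟩, ⟨m', h1⟩), φ'⟩, θ', h2, h3⟩
  choose f θ' hθ' hθφ' using hex
  have hfib := card_le_of_fibers f b (by
    intro d
    have hfG : Finite (GaloisField p (d.1.2.1 + 1)) := inferInstance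
    have h1 : ∀ i : {i // f i = d}, ∃ θ : GaloisField p (d.1.2.1 + 1) →+ W, θ ≠ 0 ∧
      ∀ (x : d.1.1.1) k, θ (d.2 x * k) = ρ i x (θ k) := by
      rintro ⟨i, rfl⟩
      exact ⟨θ' i, hθ' i, hθφ' i⟩
    choose t ht0 ht using h1
    have h2 := card_fibre d.1.1.1 (fun x k => (d.2 x : GaloisField p (d.1.2.1 + 1)) * k)
      (fun i : {i // f i = d} => ρ i) (fun i => hs i)
      (fun i j h => Subtype.ext (hd i j h)) t ht0 ht
    rw [hW, GaloisField.card p _ (Nat.succ_ne_zero _), ← pow_mul, ← pow_mul,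
      Nat.pow_le_pow_iff_right hp.one_lt] at h2
    have h3 : b * Nat.card {i // f i = d} ≤ b * b := by
      refine h2.trans (Nat.mul_le_mul d.1.2.2 d.1.1.2)
    exact Nat.le_of_mul_le_mul_left h3 hb)
  refine hfib.trans ((Nat.mul_le_mul_right _ hD).trans ?_)
  have h1 : b ^ (7 * μ + 9) ≤ 2 ^ (b * (5 * μ + 4)) := by
    apply (Nat.pow_le_pow_iff_left (n := 9) (by norm_num)).1
    calc (b ^ (7 * μ + 9)) ^ 9 = (b ^ 9) ^ (7 * μ + 9) := by rw [← pow_mul, ← pow_mul, mul_comm]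
      _ ≤ (2 ^ (5 * b)) ^ (7 * μ + 9) := Nat.pow_le_pow_left (num1 b) _
      _ = 2 ^ (b * (5 * (7 * μ + 9))) := by rw [← pow_mul]; congr 1; ring
      _ ≤ 2 ^ (b * ((5 * μ + 4) * 9)) :=
        Nat.pow_le_pow_right (by norm_num) (Nat.mul_le_mul_left _ (by omega))
      _ = _ := by rw [← pow_mul]; congr 1; ring
  calc b ^ (7 * μ + 7) * b * (p ^ b) ^ μ * b = b ^ (7 * μ + 9) * (p ^ b) ^ μ := by ring
    _ ≤ p ^ (b * (5 * μ + 4)) * (p ^ b) ^ μ :=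
      Nat.mul_le_mul_right _ (h1.trans (Nat.pow_le_pow_left hp.two_le _))
    _ = (p ^ b) ^ (6 * μ + 4) := by rw [← pow_mul, ← pow_mul, ← pow_add]; congr 1; ring


lemma sum_coset {H W : Type} [Group H] [AddCommGroup W] (P : Subgroup H) [Fintype (H ⧸ P)]
    (d : H → W) (hd : ∀ x, ∀ s ∈ P, d (x * s) = d x) (x : H) :
    ∑ z : H ⧸ P, d (x * z.out) = ∑ z : H ⧸ P, d z.out := by
  have hout : ∀ y : H, d (QuotientGroup.mk y : H ⧸ P).out = d y := by
    intro y
    have hx : y⁻¹ * (QuotientGroup.mk y : H ⧸ P).out ∈ P := by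
      rw [← QuotientGroup.eq, QuotientGroup.out_eq']
    have := hd y _ hx
    rwa [mul_inv_cancel_left] at this
  rw [← Equiv.sum_comp (MulAction.toPerm x : Equiv.Perm (H ⧸ P)) (fun z => d z.out)]
  refine Finset.sum_congr rfl fun z _ => ?_
  rw [← hout]
  congr 2
  rw [MulAction.toPerm_apply]
  conv_rhs => rw [← QuotientGroup.out_eq' z]
  rfl

lemma nsmul_cancel {W : Type} [AddCommGroup W] [Finite W] {n : ℕ} (hn : n.Coprime (Nat.card W))
    {w : W} (h : n • w = 0) : w = 0 := by
  have h1 := addOrderOf_dvd_of_nsmul_eq_zero h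
  have h2 := addOrderOf_dvd_natCard w
  exact AddMonoid.addOrderOf_eq_one_iff.1 (Nat.eq_one_of_dvd_coprimes hn h1 h2)

lemma crossed_card {q a μ : ℕ} (hq : q.Prime) {H W : Type} [Group H] [Finite H] [AddCommGroup W]
    [Finite W] (hW : Nat.card W = q ^ a) (hH : (Nat.card H).factorization q ≤ μ)
    (ρ : H →* AddMonoid.End W)
    (htriv : ∀ P : Subgroup H, IsPGroup q P → ∀ s ∈ P, ρ s = 1) :
    Nat.card {δ : H → W // ∀ x y, δ (x * y) = δ x + ρ x (δ y)} ≤ Nat.card W ^ (μ + 1) := by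
  have : Fact q.Prime := ⟨hq⟩
  have P : Sylow q H := default
  have := Fintype.ofFinite (H ⧸ (P : Subgroup H))
  have hfin : Finite (P →* Multiplicative W) := DFunLike.finite _
  have h1 : Nat.card (P →* Multiplicative W) ≤ Nat.card W ^ μ := card_hom_le hq P.2
      (factorization_le_of_dvd Nat.card_pos.ne' (Subgroup.card_subgroup_dvd_card _) hH)
  have h2 : Nat.card ((P →* Multiplicative W) × W) ≤ Nat.card W ^ (μ + 1) := by
    rw [Nat.card_prod, pow_succ]
    exact Nat.mul_le_mul_right _ h1
  refine le_trans ?_ h2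
  let Z := {δ : H → W // ∀ x y, δ (x * y) = δ x + ρ x (δ y)}
  let r : Z → (P →* Multiplicative W) := fun δ =>
    MonoidHom.mk' (fun s => ofAdd (δ.1 s)) (by
      intro s t
      rw [← ofAdd_add, Subgroup.coe_mul, δ.2, htriv P P.2 s s.2]
      rfl)
  have hr : ∀ δ s, r δ s = ofAdd (δ.1 s) := fun _ _ => rfl
  apply Nat.card_le_card_of_injective (fun δ : Z => (r δ, ∑ z : H ⧸ (P : Subgroup H), δ.1 z.out))
  intro δ δ' h
  rw [Prod.mk.injEq] at h
  obtain ⟨hP, hsum⟩ := h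
  apply Subtype.ext
  let d : H → W := fun x => δ.1 x - δ'.1 x
  have hd : ∀ x y, d (x * y) = d x + ρ x (d y) := by
    intro x y
    simp only [d, δ.2, δ'.2, map_sub]
    abel
  have hd0 : ∀ s ∈ (P : Subgroup H), d s = 0 := by
    intro s hs
    have := DFunLike.congr_fun hP (⟨s, hs⟩ : P)
    rw [hr, hr] at this
    exact sub_eq_zero.2 (ofAdd.injective this)
  have hdP : ∀ x, ∀ s ∈ (P : Subgroup H), d (x * s) = d x := by
    intro x s hs
    rw [hd, hd0 s hs, map_zero, add_zero]
  have hF : ∑ z : H ⧸ (P : Subgroup H), d z.out = 0 := by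
    simp only [d, Finset.sum_sub_distrib]
    exact sub_eq_zero.2 hsum
  funext x
  have h3 := sum_coset (P : Subgroup H) d hdP x
  simp only [hd] at h3
  rw [Finset.sum_add_distrib, ← map_sum, hF, map_zero, add_zero, Finset.sum_const, Finset.card_univ,
    ← Nat.card_eq_fintype_card] at h3
  have h4 : d x = 0 := by
    apply nsmul_cancel _ h3
    rw [hW]
    apply Nat.Coprime.pow_right
    exact ((Nat.Prime.coprime_iff_not_dvd hq).2 P.not_dvd_index).symm
  exact sub_eq_zero.1 h4

theorem max_struct {μ : ℕ} {H : Type} [Group H] (hH : Good μ H) (M : Subgroup H) (hM : IsCoatom M) :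
    ∃ q a : ℕ, q.Prime ∧ 1 ≤ a ∧ M.index = q ^ a ∧
      ∃ ρ : H →* AddMonoid.End (Fin a → ZMod q), IsSimp ρ ∧
        (∀ P : Subgroup H, IsPGroup q P → ∀ s ∈ P, ρ s = 1) ∧
        ∃ δ : H → (Fin a → ZMod q), (∀ x y, δ (x * y) = δ x + ρ x (δ y)) ∧
          ∀ h, h ∈ M ↔ δ h = 0 := by
  have := hH.fin
  let L := M.normalCore
  let π := QuotientGroup.mk' L
  have hπ : Function.Surjective π := QuotientGroup.mk'_surjective L
  have hQ : Good μ (H ⧸ L) := hH.surjective π hπ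
  have hLM : L ≤ M := Subgroup.normalCore_le M
  have hcm : (M.map π).comap π = M := by
    rw [Subgroup.comap_map_eq, QuotientGroup.ker_mk', sup_eq_left]
    exact hLM
  have hmem : ∀ h, π h ∈ M.map π ↔ h ∈ M := by
    intro h
    rw [← Subgroup.mem_comap, hcm]
  have htop : (⊤ : Subgroup (H ⧸ L)) ≠ ⊥ := by
    intro h
    apply hM.1
    rw [eq_top_iff]
    intro x _
    have : π x ∈ (⊥ : Subgroup (H ⧸ L)) := h ▸ Subgroup.mem_top _
    have : x ∈ L := (QuotientGroup.eq_one_iff x).1 this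
    exact hLM this
  obtain ⟨q, a, hq, ha, j, hj, hjn, -, hjmin⟩ := exists_min_normal hQ.sol ⊤ inferInstance htop
  have : Fact q.Prime := ⟨hq⟩
  have hnt : Nontrivial (Fin a → ZMod q) := by
    have : Nonempty (Fin a) := ⟨⟨0, ha⟩⟩
    infer_instance
  have hj1 : j.range ≠ ⊥ := by
    intro h
    obtain ⟨w, hw⟩ := exists_ne (0 : Fin a → ZMod q)
    have h1 : j (ofAdd w) ∈ (⊥ : Subgroup (H ⧸ L)) := h ▸ ⟨_, rfl⟩
    have h2 : j (ofAdd w) = j 1 := by rw [map_one]; exact h1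
    exact hw (hj h2)
  have hnle : ¬ j.range ≤ M.map π := by
    intro h
    apply hj1
    have h1 : j.range.comap π ≤ M := 
      fun x hx => (hmem x).1 (h hx)
    have h2 : j.range.comap π ≤ L := by
      rw [Subgroup.normal_le_normalCore]; exact h1
    rw [eq_bot_iff]
    intro x hx
    obtain ⟨y, rfl⟩ := hπ x
    exact (QuotientGroup.eq_one_iff y).2 (h2 hx)
  have hcomm : ∀ v w, j v * j w = j w * j v := fun v w => by rw [← map_mul, mul_comm, map_mul]
  have hsup : ∀ x : H ⧸ L, ∃ w, (j w)⁻¹ * x ∈ M.map π := by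
    have h1 : M.map π ⊔ j.range = ⊤ := by
      have h2 : M < (M.map π ⊔ j.range).comap π := by
        apply lt_of_le_of_ne
        · intro x hx
          exact Subgroup.mem_sup_left (Subgroup.mem_map_of_mem π hx)
        · intro h
          apply hnle
          intro x hx
          obtain ⟨y, rfl⟩ := hπ x
          have h3 : y ∈ (M.map π ⊔ j.range).comap π := Subgroup.mem_sup_right hx
          rw [← h] at h3
          exact (hmem y).2 h3
      have h3 := hM.2 _ h2
      rw [eq_top_iff]
      intro x _
      obtain ⟨y, rfl⟩ := hπ x
      have : y ∈ (M.map π ⊔ j.range).comap π := h3 ▸ Subgroup.mem_top y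
      exact this
    intro x
    have hx : x ∈ j.range ⊔ M.map π := by rw [sup_comm, h1]; exact Subgroup.mem_top x
    rw [Subgroup.mem_sup_of_normal_left] at hx
    obtain ⟨_, ⟨w, rfl⟩, z, hz, rfl⟩ := hx
    exact ⟨w, by rwa [inv_mul_cancel_left]⟩
  have hinf : M.map π ⊓ j.range = ⊥ := by
    have hn : (M.map π ⊓ j.range).Normal := by
      constructor
      rintro x ⟨hx1, hx2⟩ g
      refine ⟨?_, hjn.conj_mem x hx2 g⟩
      obtain ⟨w, hw⟩ := hsup g
      obtain ⟨v, rfl⟩ := hx2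
      obtain ⟨v', hv'⟩ := hjn.conj_mem (j v) ⟨v, rfl⟩ ((j w)⁻¹ * g)
      have h1 : g * j v * g⁻¹ = j w * (((j w)⁻¹ * g) * j v * ((j w)⁻¹ * g)⁻¹) * (j w)⁻¹ := by group
      have h2 := (M.map π).mul_mem ((M.map π).mul_mem hw hx1) ((M.map π).inv_mem hw)
      rw [h1, ← hv', hcomm, mul_inv_cancel_right, hv']
      exact h2
    rcases hjmin _ hn inf_le_right with h | h
    · exact h
    · exact absurd (inf_eq_right.1 h) hnle
  have huniq : ∀ x v w, (j v)⁻¹ * x ∈ M.map π → (j w)⁻¹ * x ∈ M.map π → v = w := by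
    intro x v w hv hw
    have h1 := (M.map π).mul_mem hv ((M.map π).inv_mem hw)
    have h2 : (j v)⁻¹ * x * ((j w)⁻¹ * x)⁻¹ = j (v⁻¹ * w) := by rw [map_mul, map_inv]; group
    rw [h2] at h1
    have h3 : j (v⁻¹ * w) ∈ M.map π ⊓ j.range := ⟨h1, _, rfl⟩
    rw [hinf] at h3
    have h4 : j (v⁻¹ * w) = j 1 := by rw [map_one]; exact h3
    exact inv_mul_eq_one.1 (hj h4)
  obtain ⟨ρ, hρ⟩ := exists_action j hj hjn
  choose D hD using hsup
  let δ : H → (Fin a → ZMod q) := fun h => toAdd (D (π h))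
  have hδ : ∀ h, (j (ofAdd (δ h)))⁻¹ * π h ∈ M.map π := fun h => hD (π h)
  have hδu : ∀ h w, (j (ofAdd w))⁻¹ * π h ∈ M.map π → δ h = w := by
    intro h w hw
    exact ofAdd.injective (huniq _ _ _ (hδ h) hw)
  have hδM : ∀ h, h ∈ M ↔ δ h = 0 := by
    intro h
    constructor
    · intro hh
      apply hδu
      rw [ofAdd_zero, map_one, inv_one, one_mul]
      exact (hmem h).2 hh
    · intro hh
      have := hδ h
      rw [hh, ofAdd_zero, map_one, inv_one, one_mul] at this
      exact (hmem h).1 this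
  have hcr : ∀ x y, δ (x * y) = δ x + ρ.comp π x (δ y) := by
    intro x y
    apply hδu
    have h1 := (M.map π).mul_mem (hδ x) (hδ y)
    convert h1 using 1
    rw [ofAdd_add, map_mul, MonoidHom.comp_apply, hρ, map_mul]
    obtain ⟨v', hv'⟩ := hjn.conj_mem (j (ofAdd (δ y))) ⟨_, rfl⟩ ((j (ofAdd (δ x)))⁻¹ * π x)
    have h2 : π x * j (ofAdd (δ y)) * (π x)⁻¹ = j v' := by
      have h3 : j (ofAdd (δ x)) * j v' * (j (ofAdd (δ x)))⁻¹ = j v' := by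
        rw [hcomm, mul_inv_cancel_right]
      rw [← h3, hv']; group
    have h4 : (j (ofAdd (δ x)) * (π x * j (ofAdd (δ y)) * (π x)⁻¹))⁻¹ =
        (j (ofAdd (δ x)))⁻¹ * (π x * j (ofAdd (δ y)) * (π x)⁻¹)⁻¹ := by
      rw [h2, hcomm, mul_inv_rev]
    rw [h4]; group
  refine ⟨q, a, hq, ha, ?_, ρ.comp π, isSimp_of_min j hj hjmin π hπ _ (fun h w => hρ (π h) w), ?_,
    δ, hcr, hδM⟩
  · -- index
    have hW : Nat.card (Fin a → ZMod q) = q ^ a := by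
      rw [Nat.card_fun]; simp
    rw [← hW, Subgroup.index]
    have h1 : ∀ x y : H, δ x = δ y ↔ x⁻¹ * y ∈ M := by
      intro x y
      rw [hδM]
      have := hcr x (x⁻¹ * y)
      rw [mul_inv_cancel_left] at this
      constructor
      · intro h
        rw [h, left_eq_add] at this
        have h2 : ρ.comp π x⁻¹ (ρ.comp π x (δ (x⁻¹ * y))) = 0 := by rw [this, map_zero]
        have h3 : ρ.comp π x⁻¹ (ρ.comp π x (δ (x⁻¹ * y))) = δ (x⁻¹ * y) := by
          change (ρ.comp π x⁻¹ * ρ.comp π x) _ = _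
          rw [← map_mul]; simp
        rw [← h3, h2]
      · intro h
        rw [this, h, map_zero, add_zero]
    have hsurj : Function.Surjective δ := by
      intro w
      obtain ⟨h, hh⟩ := hπ (j (ofAdd w))
      refine ⟨h, hδu h w ?_⟩
      rw [hh, inv_mul_cancel]
      exact one_mem _
    apply Nat.card_congr
    refine Equiv.ofBijective (fun z : H ⧸ M => Quotient.liftOn' z δ (fun x y h => (h1 x y).2
      (QuotientGroup.leftRel_apply.1 h))) ⟨?_, ?_⟩
    · intro x y
      induction x using QuotientGroup.induction_on with | _ x =>
      induction y using QuotientGroup.induction_on with | _ y =>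
      intro h
      exact QuotientGroup.eq.2 ((h1 x y).1 h)
    · intro w
      obtain ⟨h, rfl⟩ := hsurj w
      exact ⟨QuotientGroup.mk h, rfl⟩
  · intro P hP s hs
    have hjp : IsPGroup q j.range := by
      rw [IsPGroup.iff_card]
      refine ⟨a, ?_⟩
      rw [← Nat.card_congr (MonoidHom.ofInjective hj).toEquiv]
      rw [Nat.card_congr toAdd, Nat.card_fun]; simp
    have hPp := (hP.map π).to_sup_of_normal_right hjp
    apply AddMonoidHom.ext
    intro w
    change ρ (π s) w = w
    apply ofAdd.injective
    apply hj
    rw [hρ, hQ.ag q hq _ hPp (π s) (Subgroup.mem_sup_left (Subgroup.mem_map_of_mem π hs)) (j (ofAdd w))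
      (Subgroup.mem_sup_right ⟨_, rfl⟩), mul_inv_cancel_right]

theorem max_count {μ : ℕ} (hμ : 1 ≤ μ) (e : ℕ)
    (hS : ∀ b, 1 ≤ b → b < e → ∀ (H : Type) [Group H], Good μ H →
      Nat.card {U : Subgroup H // U.index ≤ b} ≤ b ^ (7 * μ + 7))
    (H : Type) [Group H] (hH : Good μ H) :
    Nat.card {M : Subgroup H // IsCoatom M ∧ M.index = e} ≤ e ^ (7 * μ + 5) := by
  have := hH.fin
  by_cases hne : Nonempty {M : Subgroup H // IsCoatom M ∧ M.index = e}
  swap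
  · rw [not_nonempty_iff] at hne
    simp
  obtain ⟨M0, hM0, hM0e⟩ := hne
  obtain ⟨q, a, hq, ha, hqa, -⟩ := max_struct hH M0 hM0
  rw [hM0e] at hqa
  have : Fact q.Prime := ⟨hq⟩
  have hex : ∀ M : {M : Subgroup H // IsCoatom M ∧ M.index = e},
      ∃ ρ : H →* AddMonoid.End (Fin a → ZMod q), IsSimp ρ ∧
        (∀ P : Subgroup H, IsPGroup q P → ∀ s ∈ P, ρ s = 1) ∧
        ∃ δ : H → (Fin a → ZMod q), (∀ x y, δ (x * y) = δ x + ρ x (δ y)) ∧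
          ∀ h, h ∈ M.1 ↔ δ h = 0 := by
    rintro ⟨M, hM, hMe⟩
    obtain ⟨q', a', hq', ha', hqa', h⟩ := max_struct hH M hM
    rw [hMe, hqa] at hqa'
    have h1 : q = q' := by
      have h2 : q ∣ q' ^ a' := hqa' ▸ dvd_pow_self q (by omega)
      exact (Nat.prime_dvd_prime_iff_eq hq hq').1 (hq.dvd_of_dvd_pow h2)
    subst h1
    have h2 : a = a' := Nat.pow_right_injective hq.two_le hqa'
    subst h2
    exact h
  choose ρ hs ht δ hδ hδM using hex
  have hW : Nat.card (Fin a → ZMod q) = q ^ a := by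
    rw [Nat.card_fun]; simp
  let r : Setoid {M : Subgroup H // IsCoatom M ∧ M.index = e} :=
    ⟨fun M M' => Cj (ρ M) (ρ M'), fun M => Cj.refl _, fun h => h.symm, fun h h' => h.trans h'⟩
  have h1 := card_le_of_classes r (e ^ (6 * μ + 4)) (e ^ (μ + 1)) (by
    intro s hsd
    have hlt : a < e := hqa.symm ▸ Nat.lt_pow_self hq.one_lt
    refine le_trans ?_ (le_of_eq (congrArg (fun x => x ^ (6 * μ + 4)) hqa.symm))
    exact R_bound hμ a ha (hS a ha hlt) H (Fin a → ZMod q) s hH hW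
      (fun i => ρ i) (fun i => hs i) (fun i j h => Subtype.ext (hsd i i.2 j j.2 h))) (by
    intro M
    have h2 := crossed_card hq hW (hH.ex q hq) (ρ M) (ht M)
    rw [hW, ← hqa] at h2
    refine le_trans ?_ h2
    have hcj : ∀ M' : {M' // r M M'}, Cj (ρ M) (ρ M') := fun M' => M'.2
    choose t ht' using hcj
    apply Nat.card_le_card_of_injective (fun M' : {M' // r M M'} =>
      (⟨fun h => (t M').symm (δ M' h), by
        intro x y
        apply (t M').injective
        rw [map_add, ht']
        simp [hδ]⟩ :
        {δ : H → (Fin a → ZMod q) // ∀ x y, δ (x * y) = δ x + ρ M x (δ y)}))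
    intro M1 M2 h12
    have h3 := congrArg Subtype.val h12
    apply Subtype.ext
    apply Subtype.ext
    ext h
    have h4 : (t M1).symm (δ M1 h) = (t M2).symm (δ M2 h) := congrFun h3 h
    rw [hδM, hδM, ← (t M1).symm.map_eq_zero_iff, h4, (t M2).symm.map_eq_zero_iff])
  refine h1.trans (le_of_eq ?_)
  rw [← pow_add]; congr 1; ring


lemma sum_sq (k : ℕ) (hk : 1 ≤ k) : ∑ e ∈ Finset.Icc 2 k, 1 / (e : ℝ) ^ 2 ≤ 1 - 1 / (k : ℝ) := by
  induction k, hk using Nat.le_induction with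
  | base => simp
  | succ n hn ih =>
    rw [Finset.sum_Icc_succ_top (by omega)]
    have hn' : (0 : ℝ) < n := by exact_mod_cast hn
    have h : 1 / ((n + 1 : ℕ) : ℝ) ^ 2 ≤ 1 / n - 1 / ((n + 1 : ℕ) : ℝ) := by
      push_cast
      rw [div_sub_div _ _ hn'.ne' (by positivity), div_le_div_iff₀ (by positivity) (by positivity)]
      nlinarith
    linarith

theorem S_bound {μ : ℕ} (hμ : 1 ≤ μ) (k : ℕ) : 1 ≤ k → ∀ (H : Type) [Group H], Good μ H →
      Nat.card {U : Subgroup H // U.index ≤ k} ≤ k ^ (7 * μ + 7) := by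
  induction k using Nat.strong_induction_on with
  | _ k IH =>
  intro hk H _ hH
  have := hH.fin
  let T := Σ e : Finset.Icc 2 k, Σ M : {M : Subgroup H // IsCoatom M ∧ M.index = e},
    {V : Subgroup M.1 // V.index ≤ k / e}
  let g : Option T → Subgroup H := fun o => o.elim ⊤ (fun t => t.2.2.1.map t.2.1.1.subtype)
  have hg : ∀ U : {U : Subgroup H // U.index ≤ k}, ∃ o, g o = U.1 := by
    rintro ⟨U, hU⟩
    by_cases hUt : U = ⊤
    · exact ⟨none, hUt.symm⟩
    obtain ⟨M, hM, hUM⟩ := (eq_top_or_exists_le_coatom U).resolve_left hUt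
    have h1 : U.relIndex M * M.index = U.index := Subgroup.relIndex_mul_index hUM
    have h2 : M.index ≠ 0 := Subgroup.index_ne_zero_of_finite
    have h3 : M.index ≠ 1 := fun h => hM.1 (Subgroup.index_eq_one.1 h)
    have h4 : U.index ≠ 0 := Subgroup.index_ne_zero_of_finite
    have h5 : M.index ≤ U.index := Nat.le_of_dvd (Nat.pos_of_ne_zero h4) ⟨_, by rw [← h1, mul_comm]⟩
    refine ⟨some ⟨⟨M.index, Finset.mem_Icc.2 ⟨by omega, h5.trans hU⟩⟩, ⟨M, hM, rfl⟩,
      ⟨U.subgroupOf M, ?_⟩⟩, ?_⟩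
    · rw [Nat.le_div_iff_mul_le (Nat.pos_of_ne_zero h2)]
      exact h1.le.trans hU
    · exact (Subgroup.map_subgroupOf_eq_of_le hUM)
  choose f hf using hg
  have hinj : Function.Injective f := by
    intro U V h
    apply Subtype.ext
    rw [← hf, ← hf, h]
  have hcard := Nat.card_le_card_of_injective f hinj
  refine hcard.trans ?_
  have hT : Nat.card T ≤ ∑ e ∈ Finset.Icc 2 k, e ^ (7 * μ + 5) * (k / e) ^ (7 * μ + 7) := by
    rw [Nat.card_sigma, ← Finset.sum_coe_sort (Finset.Icc 2 k)
      (fun e => e ^ (7 * μ + 5) * (k / e) ^ (7 * μ + 7))]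
    apply Finset.sum_le_sum
    rintro ⟨e, he⟩ _
    rw [Finset.mem_Icc] at he
    have := Fintype.ofFinite {M : Subgroup H // IsCoatom M ∧ M.index = e}
    rw [Nat.card_sigma]
    have h1 : ∀ M ∈ (Finset.univ : Finset {M : Subgroup H // IsCoatom M ∧ M.index = e}),
        Nat.card {V : Subgroup M.1 // V.index ≤ k / e} ≤ (k / e) ^ (7 * μ + 7) := by
      intro M _
      exact IH (k / e) (Nat.div_lt_self hk he.1) (Nat.div_pos he.2 (by omega)) M.1 (hH.subgroup _)
    refine (Finset.sum_le_card_nsmul _ _ _ h1).trans ?_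
    rw [smul_eq_mul, Finset.card_univ, ← Nat.card_eq_fintype_card]
    apply Nat.mul_le_mul_right
    exact max_count hμ e (fun b hb hbe => IH b (lt_of_lt_of_le hbe he.2) hb) H hH
  rw [Finite.card_option]
  refine (Nat.add_le_add_right hT 1).trans ?_
  have hk' : (0 : ℝ) < k := by exact_mod_cast hk
  have hreal : ((∑ e ∈ Finset.Icc 2 k, e ^ (7 * μ + 5) * (k / e) ^ (7 * μ + 7) : ℕ) : ℝ) + 1 ≤
      (k : ℝ) ^ (7 * μ + 7) := by
    push_cast
    have h1 : ∀ e ∈ Finset.Icc 2 k, (e : ℝ) ^ (7 * μ + 5) * ((k / e : ℕ) : ℝ) ^ (7 * μ + 7) ≤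
        (k : ℝ) ^ (7 * μ + 7) * (1 / (e : ℝ) ^ 2) := by
      intro e he
      rw [Finset.mem_Icc] at he
      have he' : (0 : ℝ) < e := by exact_mod_cast (by omega : 0 < e)
      calc (e : ℝ) ^ (7 * μ + 5) * ((k / e : ℕ) : ℝ) ^ (7 * μ + 7)
          ≤ (e : ℝ) ^ (7 * μ + 5) * ((k : ℝ) / e) ^ (7 * μ + 7) := by
            gcongr; exact Nat.cast_div_le
        _ = _ := by
          rw [div_pow, pow_add (e : ℝ) (7 * μ) 5, pow_add (e : ℝ) (7 * μ) 7]
          field_simp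
    refine (add_le_add_left (Finset.sum_le_sum h1) 1).trans ?_
    rw [← Finset.mul_sum]
    have h2 := mul_le_mul_of_nonneg_left (sum_sq k hk) (by positivity : 0 ≤ (k : ℝ) ^ (7 * μ + 7))
    have h3 : 1 ≤ (k : ℝ) ^ (7 * μ + 7) * (1 / k) := by
      rw [pow_succ]
      field_simp
      exact one_le_pow₀ (by exact_mod_cast hk)
    linarith
  exact_mod_cast hreal

theorem R_bound' {p : ℕ} [hpf : Fact p.Prime] {μ : ℕ} (hμ : 1 ≤ μ) (b : ℕ) (hb : 1 ≤ b)
    (H W ι : Type) [Group H] [AddCommGroup W] [Finite W] [Finite ι] (hH : Good μ H)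
    (hW : Nat.card W = p ^ b) (ρ : ι → H →* AddMonoid.End W) (hs : ∀ i, IsSimp (ρ i))
    (hd : ∀ i j, Cj (ρ i) (ρ j) → i = j) : Nat.card ι ≤ (p ^ b) ^ (6 * μ + 4) :=
  R_bound hμ b hb (S_bound hμ b hb) H W ι hH hW ρ hs hd


/-- an extension of `H` by `W` with action `ρ` -/
structure IsExt {H W G : Type} [Group H] [AddCommGroup W] [Group G] (ρ : H →* AddMonoid.End W)
    (j : Multiplicative W →* G) (π : G →* H) : Prop where
  inj : Function.Injective j
  surj : Function.Surjective π
  exact : ∀ g, π g = 1 ↔ g ∈ j.range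
  act : ∀ g w, j (ofAdd (ρ (π g) w)) = g * j (ofAdd w) * g⁻¹

section
variable {H W G : Type} [Group H] [AddCommGroup W] [Group G] {ρ : H →* AddMonoid.End W}
    {j : Multiplicative W →* G} {π : G →* H}

lemma IsExt.comm (h : IsExt ρ j π) (g : G) (w : W) :
    g * j (ofAdd w) = j (ofAdd (ρ (π g) w)) * g := by
  rw [h.act, inv_mul_cancel_right]

lemma IsExt.add (v w : W) : j (ofAdd (v + w)) = j (ofAdd v) * j (ofAdd w) := by
  rw [ofAdd_add, map_mul]

lemma IsExt.exists_eq (h : IsExt ρ j π) {g g' : G} (hg : π g = π g') :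
    ∃ w, g = j (ofAdd w) * g' := by
  have : π (g * g'⁻¹) = 1 := by rw [map_mul, map_inv, hg, mul_inv_cancel]
  obtain ⟨w, hw⟩ := (h.exact _).1 this
  refine ⟨toAdd w, ?_⟩
  rw [ofAdd_toAdd, hw, inv_mul_cancel_right]

lemma IsExt.pi_j (h : IsExt ρ j π) (w : W) : π (j (ofAdd w)) = 1 := (h.exact _).2 ⟨_, rfl⟩

lemma IsExt.cancel (h : IsExt ρ j π) {v w : W} {g : G} (hg : j (ofAdd v) * g = j (ofAdd w) * g) :
    v = w := ofAdd.injective (h.inj (mul_right_cancel hg))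

/-- bijection with `W × H` -/
lemma IsExt.bij (h : IsExt ρ j π) (σ : H → G) (hσ : ∀ x, π (σ x) = x) :
    Function.Bijective (fun z : W × H => j (ofAdd z.1) * σ z.2) := by
  constructor
  · rintro ⟨v, x⟩ ⟨w, y⟩ hz
    simp only at hz
    have h1 : x = y := by
      have := congrArg π hz
      rwa [map_mul, map_mul, h.pi_j, h.pi_j, one_mul, one_mul, hσ, hσ] at this
    subst h1
    rw [h.cancel hz]
  · intro g
    obtain ⟨w, hw⟩ := h.exists_eq (g := g) (g' := σ (π g)) (hσ _).symm
    exact ⟨(w, π g), hw.symm⟩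

lemma IsExt.mul_formula (h : IsExt ρ j π) (σ : H → G) (hσ : ∀ x, π (σ x) = x) (f : H → H → W)
    (hf : ∀ x y, σ x * σ y = j (ofAdd (f x y)) * σ (x * y)) (v w : W) (x y : H) :
    (j (ofAdd v) * σ x) * (j (ofAdd w) * σ y) = j (ofAdd (v + ρ x w + f x y)) * σ (x * y) := by
  have h1 := h.comm (σ x) w
  rw [hσ] at h1
  rw [IsExt.add, IsExt.add, mul_assoc _ _ (σ (x * y)), ← hf]
  calc j (ofAdd v) * σ x * (j (ofAdd w) * σ y) = j (ofAdd v) * (σ x * j (ofAdd w)) * σ y := by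
        simp only [mul_assoc]
    _ = _ := by rw [h1]; simp only [mul_assoc]
end

lemma iso_of_factor {H W G₁ G₂ : Type} [Group H] [AddCommGroup W] [Group G₁] [Group G₂]
    {ρ : H →* AddMonoid.End W} {j₁ : Multiplicative W →* G₁} {π₁ : G₁ →* H}
    {j₂ : Multiplicative W →* G₂} {π₂ : G₂ →* H} (h₁ : IsExt ρ j₁ π₁) (h₂ : IsExt ρ j₂ π₂)
    (σ₁ : H → G₁) (hσ₁ : ∀ x, π₁ (σ₁ x) = x) (σ₂ : H → G₂) (hσ₂ : ∀ x, π₂ (σ₂ x) = x)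
    (f : H → H → W) (hf₁ : ∀ x y, σ₁ x * σ₁ y = j₁ (ofAdd (f x y)) * σ₁ (x * y))
    (hf₂ : ∀ x y, σ₂ x * σ₂ y = j₂ (ofAdd (f x y)) * σ₂ (x * y)) : Nonempty (G₁ ≃* G₂) := by
  let e₁ := Equiv.ofBijective _ (h₁.bij σ₁ hσ₁)
  let e₂ := Equiv.ofBijective _ (h₂.bij σ₂ hσ₂)
  have he₁ : ∀ z, e₁ z = j₁ (ofAdd z.1) * σ₁ z.2 := fun _ => rfl
  have he₂ : ∀ z, e₂ z = j₂ (ofAdd z.1) * σ₂ z.2 := fun _ => rfl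
  have hm₁ : ∀ z z', e₁ z * e₁ z' = e₁ (z.1 + ρ z.2 z'.1 + f z.2 z'.2, z.2 * z'.2) := fun z z' => by
    rw [he₁, he₁, he₁, h₁.mul_formula σ₁ hσ₁ f hf₁]
  have hm₂ : ∀ z z', e₂ z * e₂ z' = e₂ (z.1 + ρ z.2 z'.1 + f z.2 z'.2, z.2 * z'.2) := fun z z' => by
    rw [he₂, he₂, he₂, h₂.mul_formula σ₂ hσ₂ f hf₂]
  refine ⟨⟨e₁.symm.trans e₂, ?_⟩⟩
  intro x y
  obtain ⟨z, rfl⟩ := e₁.surjective x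
  obtain ⟨z', rfl⟩ := e₁.surjective y
  simp only [Equiv.toFun_as_coe, Equiv.trans_apply, Equiv.symm_apply_apply]
  rw [hm₁, hm₂, Equiv.symm_apply_apply]

lemma exists_factor {H W G : Type} [Group H] [AddCommGroup W] [Group G]
    {ρ : H →* AddMonoid.End W} {j : Multiplicative W →* G} {π : G →* H} (h : IsExt ρ j π)
    (S : Subgroup H) (σ : H → G) (hσ : ∀ s ∈ S, π (σ s) = s) (c : H → H → W)
    (hc : ∀ s ∈ S, ∀ t ∈ S, σ s * σ t = j (ofAdd (c s t)) * σ (s * t)) :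
    ∃ τ : H → G, (∀ x, π (τ x) = x) ∧
      (∀ x, ∀ s ∈ S, τ x * σ s = j (ofAdd (ρ (QuotientGroup.mk x : H ⧸ S).out
        (c ((QuotientGroup.mk x : H ⧸ S).out⁻¹ * x) s))) * τ (x * s)) := by
  choose l hl using h.surj
  have hx : ∀ x, (QuotientGroup.mk x : H ⧸ S).out⁻¹ * x ∈ S := by
    intro x
    rw [← QuotientGroup.eq, QuotientGroup.out_eq']
  refine ⟨fun x => l (QuotientGroup.mk x : H ⧸ S).out * σ ((QuotientGroup.mk x : H ⧸ S).out⁻¹ * x),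
    ?_, ?_⟩
  · intro x
    rw [map_mul, hl, hσ _ (hx x), mul_inv_cancel_left]
  · intro x s hs
    have h1 : (QuotientGroup.mk (x * s) : H ⧸ S) = QuotientGroup.mk x := by
      rw [eq_comm, QuotientGroup.eq, inv_mul_cancel_left]
      exact hs
    simp only [h1]
    rw [mul_assoc, hc _ (hx x) s hs, ← mul_assoc, h.comm, hl, mul_assoc, mul_assoc]

lemma factor_props {H W G : Type} [Group H] [AddCommGroup W] [Group G]
    {ρ : H →* AddMonoid.End W} {j : Multiplicative W →* G} {π : G →* H} (h : IsExt ρ j π)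
    (S : Subgroup H) (σ τ : H → G) (hτ : ∀ x, π (τ x) = x) (u : H → H → W)
    (hu : ∀ x, ∀ s ∈ S, τ x * σ s = j (ofAdd (u x s)) * τ (x * s)) :
    ∃ f : H → H → W, (∀ x y, τ x * τ y = j (ofAdd (f x y)) * τ (x * y)) ∧
      (∀ x y z, f x y + f (x * y) z = ρ x (f y z) + f x (y * z)) ∧
      (∀ x y, ∀ s ∈ S, ρ x (u y s) + f x (y * s) = f x y + u (x * y) s) := by
  have hex : ∀ x y, ∃ w, τ x * τ y = j (ofAdd w) * τ (x * y) := by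
    intro x y
    apply h.exists_eq
    rw [map_mul, hτ, hτ, hτ]
  choose f hf using hex
  have hcm : ∀ x w, τ x * j (ofAdd w) = j (ofAdd (ρ x w)) * τ x := by
    intro x w
    rw [h.comm, hτ]
  refine ⟨f, hf, ?_, ?_⟩
  · intro x y z
    apply h.cancel (g := τ (x * y * z))
    calc j (ofAdd (f x y + f (x * y) z)) * τ (x * y * z) = τ x * τ y * τ z := by
          rw [IsExt.add, mul_assoc, ← hf, ← mul_assoc, ← hf]
      _ = τ x * (τ y * τ z) := mul_assoc _ _ _
      _ = _ := by
          rw [hf, ← mul_assoc, hcm, mul_assoc, hf, IsExt.add, mul_assoc, ← mul_assoc x]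
  · intro x y s hs
    apply h.cancel (g := τ (x * y * s))
    calc j (ofAdd (ρ x (u y s) + f x (y * s))) * τ (x * y * s) = τ x * (τ y * σ s) := by
          rw [hu _ s hs, ← mul_assoc (τ x), hcm, mul_assoc _ (τ x), hf, IsExt.add, ← mul_assoc x]
          simp only [mul_assoc]
      _ = τ x * τ y * σ s := (mul_assoc _ _ _).symm
      _ = _ := by
          rw [hf, mul_assoc, hu _ s hs, IsExt.add]
          simp only [mul_assoc]

lemma coh_iso {H W G₁ G₂ : Type} [Group H] [Finite H] [AddCommGroup W] [Finite W] [Group G₁] [Group G₂]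
    {ρ : H →* AddMonoid.End W} {j₁ : Multiplicative W →* G₁} {π₁ : G₁ →* H}
    {j₂ : Multiplicative W →* G₂} {π₂ : G₂ →* H} (h₁ : IsExt ρ j₁ π₁) (h₂ : IsExt ρ j₂ π₂)
    (S : Subgroup H) (hS : S.index.Coprime (Nat.card W))
    (σ₁ : H → G₁) (hσ₁ : ∀ s ∈ S, π₁ (σ₁ s) = s) (σ₂ : H → G₂) (hσ₂ : ∀ s ∈ S, π₂ (σ₂ s) = s)
    (c : H → H → W) (hc₁ : ∀ s ∈ S, ∀ t ∈ S, σ₁ s * σ₁ t = j₁ (ofAdd (c s t)) * σ₁ (s * t))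
    (hc₂ : ∀ s ∈ S, ∀ t ∈ S, σ₂ s * σ₂ t = j₂ (ofAdd (c s t)) * σ₂ (s * t)) :
    Nonempty (G₁ ≃* G₂) := by
  have := Fintype.ofFinite (H ⧸ S)
  obtain ⟨τ₁, hτ₁, hu₁⟩ := exists_factor h₁ S σ₁ hσ₁ c hc₁
  obtain ⟨τ₂, hτ₂, hu₂⟩ := exists_factor h₂ S σ₂ hσ₂ c hc₂
  obtain ⟨f₁, hf₁, hco₁, hS₁⟩ := factor_props h₁ S σ₁ τ₁ hτ₁ _ hu₁
  obtain ⟨f₂, hf₂, hco₂, hS₂⟩ := factor_props h₂ S σ₂ τ₂ hτ₂ _ hu₂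
  let d : H → H → W := fun x y => f₁ x y - f₂ x y
  have hd : ∀ x y z, d x y + d (x * y) z = ρ x (d y z) + d x (y * z) := by
    intro x y z
    have e1 := hco₁ x y z
    have e2 := hco₂ x y z
    simp only [d, map_sub]
    have e3 := congrArg₂ (· - ·) e1 e2
    calc _ = f₁ x y + f₁ (x * y) z - (f₂ x y + f₂ (x * y) z) := by abel
      _ = _ := e3
      _ = _ := by abel
  have hdS : ∀ x y, ∀ s ∈ S, d x (y * s) = d x y := by
    intro x y s hs
    have e1 := hS₁ x y s hs
    have e2 := hS₂ x y s hs
    have e3 := congrArg₂ (· - ·) e1 e2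
    simp only [d]
    rw [add_sub_add_left_eq_sub, add_sub_add_right_eq_sub] at e3
    exact e3
  let F : H → W := fun x => ∑ z : H ⧸ S, d x z.out
  have hF : ∀ x y, S.index • d x y + F (x * y) = ρ x (F y) + F x := by
    intro x y
    have h3 := sum_coset S (d x) (hdS x) y
    have h4 : ∑ z : H ⧸ S, (d x y + d (x * y) z.out) =
        ∑ z : H ⧸ S, (ρ x (d y z.out) + d x (y * z.out)) :=
      Finset.sum_congr rfl fun z _ => hd x y z.out
    rw [Finset.sum_add_distrib, Finset.sum_add_distrib, h3, ← map_sum, Finset.sum_const,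
      Finset.card_univ, ← Nat.card_eq_fintype_card] at h4
    exact h4
  -- invert the index
  obtain ⟨k, hk⟩ : ∃ k : ℤ, ∀ w : W, k • (S.index • w) = w := by
    refine ⟨Nat.gcdA S.index (Nat.card W), fun w => ?_⟩
    have h3 := Nat.gcd_eq_gcd_ab S.index (Nat.card W)
    rw [hS.gcd_eq_one] at h3
    have h4 : ((Nat.card W : ℕ) : ℤ) • w = 0 := by rw [natCast_zsmul]; exact card_nsmul_eq_zero'
    calc _ = ((S.index : ℤ) * Nat.gcdA S.index (Nat.card W)) • w := by
          rw [mul_comm, mul_smul, natCast_zsmul]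
      _ = ((S.index : ℤ) * Nat.gcdA S.index (Nat.card W) +
            (Nat.card W : ℤ) * Nat.gcdB S.index (Nat.card W)) • w := by
          rw [add_smul, mul_comm (Nat.card W : ℤ), mul_smul _ (Nat.card W : ℤ), h4, smul_zero, add_zero]
      _ = w := by rw [← h3]; simp
  let g : H → W := fun x => k • F x
  have hg : ∀ x y, d x y + g (x * y) = ρ x (g y) + g x := by
    intro x y
    simp only [g]
    rw [map_zsmul, ← smul_add, ← hF, smul_add, hk]
  refine iso_of_factor h₁ h₂ τ₁ hτ₁ (fun x => j₂ (ofAdd (g x)) * τ₂ x) ?_ f₁ hf₁ ?_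
  · intro x
    rw [map_mul, h₂.pi_j, hτ₂, one_mul]
  · intro x y
    rw [h₂.mul_formula τ₂ hτ₂ f₂ hf₂, ← mul_assoc, ← IsExt.add]
    congr 3
    have := hg x y
    have h5 : f₁ x y = d x y + f₂ x y := by simp [d]
    rw [h5]
    calc g x + ρ x (g y) + f₂ x y = (ρ x (g y) + g x) + f₂ x y := by abel
      _ = _ := by rw [← this]; abel


lemma card_hom_sublattice {m : ℕ} (K : Subgroup (Fin m → Multiplicative ℤ)) (W : Type)
    [AddCommGroup W] [Finite W] :
    Finite (K →* Multiplicative W) ∧ Nat.card (K →* Multiplicative W) ≤ Nat.card W ^ m := by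
  let A : AddSubgroup (Fin m → ℤ) :=
    { carrier := {v | (fun i => ofAdd (v i)) ∈ K}
      zero_mem' := K.one_mem
      add_mem' := fun ha hb => K.mul_mem ha hb
      neg_mem' := fun ha => K.inv_mem ha }
  let K' : Submodule ℤ (Fin m → ℤ) := AddSubgroup.toIntSubmodule A
  obtain ⟨n, snf⟩ := Submodule.smithNormalForm (Pi.basisFun ℤ (Fin m)) K'
  have hn : n ≤ m := by simpa using Fintype.card_le_of_embedding snf.f
  have hmem : ∀ v : K', (fun i => ofAdd (v.1 i)) ∈ K := fun v => v.2
  let F : (K →* Multiplicative W) → (Fin n → W) := fun κ i =>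
    toAdd (κ ⟨_, hmem (snf.bN i)⟩)
  have hF : Function.Injective F := by
    intro κ κ' h
    let lin : (K →* Multiplicative W) → (K' →ₗ[ℤ] W) := fun κ => AddMonoidHom.toIntLinearMap
      (AddMonoidHom.mk' (fun v : K' => toAdd (κ ⟨_, hmem v⟩)) (by
        intro v w
        rw [← toAdd_mul, ← map_mul]
        rfl))
    have h1 : lin κ = lin κ' := snf.bN.ext fun i => congrFun h i
    ext ⟨k, hk⟩
    have h2 : (fun i => toAdd (k i)) ∈ A := hk
    have h3 := DFunLike.congr_fun h1 (⟨fun i => toAdd (k i), h2⟩ : K')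
    exact toAdd.injective h3
  have hfin : Finite (K →* Multiplicative W) := Finite.of_injective F hF
  refine ⟨hfin, (Nat.card_le_card_of_injective F hF).trans ?_⟩
  rw [Nat.card_fun, Nat.card_fin]
  exact Nat.pow_le_pow_right Nat.card_pos hn

lemma exists_hom_of_comm {G : Type} [Group G] {m : ℕ} (y : Fin m → G)
    (hc : ∀ i j, y i * y j = y j * y i) :
    ∃ ψ : (Fin m → Multiplicative ℤ) →* G, ∀ i, ψ (Pi.mulSingle i (ofAdd 1)) = y i := by
  have hc' : Pairwise fun i j => ∀ (a b : Multiplicative ℤ),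
      Commute (zpowersHom G (y i) a) (zpowersHom G (y j) b) := by
    intro i j _ a b
    have h1 : Commute (y i) (y j) := hc i j
    simp only [zpowersHom_apply]
    exact h1.zpow_zpow _ _
  refine ⟨MonoidHom.noncommPiCoprod (fun i => zpowersHom G (y i)) hc', ?_⟩
  intro i
  have h2 := MonoidHom.noncommPiCoprod_mulSingle (fun i => zpowersHom G (y i)) (hcomm := hc') i (ofAdd 1)
  refine h2.trans ?_
  simp

lemma hom_ext_gens {G : Type} [Group G] {m : ℕ} (ψ ψ' : (Fin m → Multiplicative ℤ) →* G)
    (h : ∀ i, ψ (Pi.mulSingle i (ofAdd 1)) = ψ' (Pi.mulSingle i (ofAdd 1))) : ψ = ψ' := by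
  ext v
  have h1 : ∏ i, Pi.mulSingle i (v i) ∈ ψ.eqLocus ψ' := by
    apply Subgroup.prod_mem
    intro i _
    have h2 : (Pi.mulSingle i (v i) : Fin m → Multiplicative ℤ) =
        (Pi.mulSingle i (ofAdd 1)) ^ (toAdd (v i)) := by
      rw [← Pi.mulSingle_zpow, ← ofAdd_zsmul]
      simp
    rw [h2]
    exact Subgroup.zpow_mem _ (h i) _
  rw [Finset.univ_prod_mulSingle] at h1
  exact h1

lemma L1 {p b μ : ℕ} (hp : p.Prime) {H W ι : Type} [Group H] [AddCommGroup W] [Finite W]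
    (hW : Nat.card W = p ^ b) (hH : Good μ H) (ρ : H →* AddMonoid.End W) (G : ι → Type)
    [∀ i, Group (G i)] (hG : ∀ i, Good μ (G i)) (j : ∀ i, Multiplicative W →* G i)
    (π : ∀ i, G i →* H) (hE : ∀ i, IsExt ρ (j i) (π i))
    (hiso : ∀ i i', Nonempty (G i ≃* G i') → i = i') : Nat.card ι ≤ (p ^ b) ^ μ := by
  have : Fact p.Prime := ⟨hp⟩
  have := hH.fin
  have S : Sylow p H := default
  obtain ⟨x, hx⟩ := exists_gens hp S.2 (m := μ)
    (factorization_le_of_dvd Nat.card_pos.ne' (Subgroup.card_subgroup_dvd_card _) (hH.ex p hp))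
  obtain ⟨ψ, hψ⟩ := exists_hom_of_comm (fun k => (x k : H))
    (fun k l => hH.ag p hp S S.2 _ (x k).2 _ (x l).2)
  have hr : ∀ s : H, ∃ v, s ∈ (S : Subgroup H) → ψ v = s := by
    intro s
    by_cases hs : s ∈ (S : Subgroup H)
    · have h1 : Subgroup.closure (Set.range x) ≤ ψ.range.subgroupOf S := by
        rw [Subgroup.closure_le]
        rintro _ ⟨k, rfl⟩
        exact ⟨_, hψ k⟩
      rw [hx] at h1
      have h2 := h1 (Subgroup.mem_top (⟨s, hs⟩ : S))
      obtain ⟨v, hv⟩ := h2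
      exact ⟨v, fun _ => hv⟩
    · exact ⟨1, fun h => absurd h hs⟩
  choose r hr using hr
  have hlift : ∀ i, ∃ φ : (Fin μ → Multiplicative ℤ) →* G i, (π i).comp φ = ψ := by
    intro i
    have hGf := (hG i).fin
    choose y hy using fun k => (hE i).surj (x k : H)
    have hker : IsPGroup p (π i).ker := by
      have h1 : (π i).ker = (j i).range := by
        ext g
        rw [MonoidHom.mem_ker, (hE i).exact]
      rw [h1, IsPGroup.iff_card]
      refine ⟨b, ?_⟩
      rw [← Nat.card_congr (MonoidHom.ofInjective (hE i).inj).toEquiv, ← hW]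
      exact Nat.card_congr toAdd
    have hP := S.2.comap_of_ker_isPGroup (π i) hker
    have hyP : ∀ k, y k ∈ (S : Subgroup H).comap (π i) := fun k => by
      rw [Subgroup.mem_comap, hy]; exact (x k).2
    obtain ⟨φ, hφ⟩ := exists_hom_of_comm y (fun k l => (hG i).ag p hp _ hP _ (hyP k) _ (hyP l))
    refine ⟨φ, hom_ext_gens _ _ fun k => ?_⟩
    rw [hψ, MonoidHom.comp_apply, hφ, hy]
  choose φ hφ using hlift
  have hφ' : ∀ i v, π i (φ i v) = ψ v := fun i v => DFunLike.congr_fun (hφ i) v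
  have hκ : ∀ i, ∃ κ : ψ.ker →* Multiplicative W, ∀ v, j i (κ v) = φ i v := by
    intro i
    have h1 : ∀ v : ψ.ker, (φ i).comp ψ.ker.subtype v ∈ (j i).range := by
      intro v
      rw [← (hE i).exact]
      change π i (φ i v) = 1
      rw [hφ']
      exact v.2
    refine ⟨(MonoidHom.ofInjective (hE i).inj).symm.toMonoidHom.comp
      (((φ i).comp ψ.ker.subtype).codRestrict _ h1), fun v => ?_⟩
    have := MonoidHom.apply_ofInjective_symm (hE i).inj
      ((((φ i).comp ψ.ker.subtype).codRestrict _ h1) v)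
    exact this
  choose κ hκ using hκ
  obtain ⟨hfin, hcard⟩ := card_hom_sublattice ψ.ker W
  rw [hW] at hcard
  refine le_trans ?_ hcard
  apply Nat.card_le_card_of_injective κ
  intro i i' hii
  apply hiso
  classical
  let c : H → H → W := fun s t => if h : r s * r t * (r (s * t))⁻¹ ∈ ψ.ker then
    toAdd (κ i ⟨_, h⟩) else 0
  have hker : ∀ s ∈ (S : Subgroup H), ∀ t ∈ (S : Subgroup H), r s * r t * (r (s * t))⁻¹ ∈ ψ.ker := by
    intro s hs t ht
    rw [MonoidHom.mem_ker, map_mul, map_mul, map_inv, hr s hs, hr t ht, hr _ (mul_mem hs ht),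
      mul_inv_cancel]
  have hc : ∀ i₀, κ i₀ = κ i → ∀ s ∈ (S : Subgroup H), ∀ t ∈ (S : Subgroup H),
      φ i₀ (r s) * φ i₀ (r t) = j i₀ (ofAdd (c s t)) * φ i₀ (r (s * t)) := by
    intro i₀ h0 s hs t ht
    simp only [c, dif_pos (hker s hs t ht), ofAdd_toAdd]
    rw [← h0, hκ]
    simp only [← map_mul]
    rw [inv_mul_cancel_right]
  refine coh_iso (hE i) (hE i') (S : Subgroup H) ?_ (fun s => φ i (r s)) ?_ (fun s => φ i' (r s)) ?_ c
    (hc i rfl) (hc i' hii.symm)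
  · rw [hW]
    apply Nat.Coprime.pow_right
    exact ((Nat.Prime.coprime_iff_not_dvd hp).2 S.not_dvd_index).symm
  · intro s hs
    change π i (φ i (r s)) = s
    rw [hφ', hr s hs]
  · intro s hs
    change π i' (φ i' (r s)) = s
    rw [hφ', hr s hs]

lemma IsExt.conj {H W G : Type} [Group H] [AddCommGroup W] [Group G] {ρ ρ' : H →* AddMonoid.End W}
    {j : Multiplicative W →* G} {π : G →* H} (h : IsExt ρ j π) (hc : Cj ρ' ρ) :
    ∃ j' : Multiplicative W →* G, IsExt ρ' j' π := by
  obtain ⟨t, ht⟩ := hc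
  refine ⟨j.comp (AddMonoidHom.toMultiplicative t.toAddMonoidHom), ?_, h.surj, ?_, ?_⟩
  · exact h.inj.comp (fun a c hac => t.injective hac)
  · intro g
    rw [h.exact]
    constructor
    · rintro ⟨w, rfl⟩
      refine ⟨ofAdd (t.symm (toAdd w)), ?_⟩
      change j (ofAdd (t (t.symm (toAdd w)))) = _
      simp
    · rintro ⟨w, rfl⟩
      exact ⟨_, rfl⟩
  · intro g w
    change j (ofAdd (t (ρ' (π g) w))) = g * j (ofAdd (t w)) * g⁻¹
    rw [ht, h.act]

lemma L2 {p b μ : ℕ} (hp : p.Prime) (hμ : 1 ≤ μ) (hb : 1 ≤ b) {H W ι : Type} [Finite ι] [Group H]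
    [AddCommGroup W] [Finite W]
    (hW : Nat.card W = p ^ b) (hH : Good μ H) (ρ : ι → H →* AddMonoid.End W) (hs : ∀ i, IsSimp (ρ i))
    (G : ι → Type)
    [∀ i, Group (G i)] (hG : ∀ i, Good μ (G i)) (j : ∀ i, Multiplicative W →* G i)
    (π : ∀ i, G i →* H) (hE : ∀ i, IsExt (ρ i) (j i) (π i))
    (hiso : ∀ i i', Nonempty (G i ≃* G i') → i = i') : Nat.card ι ≤ (p ^ b) ^ (7 * μ + 4) := by
  have : Fact p.Prime := ⟨hp⟩
  let r : Setoid ι :=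
    ⟨fun i i' => Cj (ρ i) (ρ i'), fun M => Cj.refl _, fun h => h.symm, fun h h' => h.trans h'⟩
  have h1 := card_le_of_classes r ((p ^ b) ^ (6 * μ + 4)) ((p ^ b) ^ μ) (by
    intro s hsd
    exact R_bound' hμ b hb H W s hH hW (fun i => ρ i) (fun i => hs i)
      (fun i j h => Subtype.ext (hsd i i.2 j j.2 h))) (by
    intro i
    have hex : ∀ i' : {i' // r i i'}, ∃ j' : Multiplicative W →* G i', IsExt (ρ i) j' (π i') :=
      fun i' => (hE i').conj i'.2
    choose j' hj' using hex
    exact L1 hp hW hH (ρ i) (fun i' : {i' // r i i'} => G i') (fun i' => hG i') j' (fun i' => π i') hj'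
      (fun i₁ i₂ h => Subtype.ext (hiso _ _ h)))
  refine h1.trans (le_of_eq ?_)
  rw [← pow_add]; congr 1; ring

lemma IsExt.compEquiv {H H' W G : Type} [Group H] [Group H'] [AddCommGroup W] [Group G]
    {ρ : H →* AddMonoid.End W} {j : Multiplicative W →* G} {π : G →* H} (h : IsExt ρ j π)
    (e : H ≃* H') : IsExt (ρ.comp e.symm.toMonoidHom) j (e.toMonoidHom.comp π) := by
  refine ⟨h.inj, e.surjective.comp h.surj, ?_, ?_⟩
  · intro g
    rw [← h.exact]
    change e (π g) = 1 ↔ _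
    exact e.map_eq_one_iff
  · intro g w
    change j (ofAdd (ρ (e.symm (e (π g))) w)) = _
    rw [e.symm_apply_apply, h.act]

lemma L3 {p b μ h : ℕ} (hp : p.Prime) (hμ : 1 ≤ μ) (hb : 1 ≤ b) {W ι : Type} [Finite ι]
    [AddCommGroup W] [Finite W]
    (hW : Nat.card W = p ^ b)
    (IH : ∀ (ι : Type) [Finite ι] (G : ι → Type) [∀ i, Group (G i)], (∀ i, Good μ (G i)) →
      (∀ i, Nat.card (G i) = h) → (∀ i i', Nonempty (G i ≃* G i') → i = i') →
      Nat.card ι ≤ h ^ (7 * μ + 6))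
    (H : ι → Type) [∀ i, Group (H i)] (hH : ∀ i, Good μ (H i)) (hHc : ∀ i, Nat.card (H i) = h)
    (ρ : ∀ i, H i →* AddMonoid.End W) (hs : ∀ i, IsSimp (ρ i))
    (G : ι → Type)
    [∀ i, Group (G i)] (hG : ∀ i, Good μ (G i)) (j : ∀ i, Multiplicative W →* G i)
    (π : ∀ i, G i →* H i) (hE : ∀ i, IsExt (ρ i) (j i) (π i))
    (hiso : ∀ i i', Nonempty (G i ≃* G i') → i = i') :
    Nat.card ι ≤ h ^ (7 * μ + 6) * (p ^ b) ^ (7 * μ + 4) := by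
  let r : Setoid ι :=
    ⟨fun i i' => Nonempty (H i ≃* H i'), fun M => ⟨MulEquiv.refl _⟩, fun ⟨h⟩ => ⟨h.symm⟩,
      fun ⟨h⟩ ⟨h'⟩ => ⟨h.trans h'⟩⟩
  apply card_le_of_classes r
  · intro s hsd
    exact IH s (fun i => H i) (fun i => hH i) (fun i => hHc i)
      (fun i j h => Subtype.ext (hsd i i.2 j j.2 h))
  · intro i
    have hex : ∀ i' : {i' // r i i'}, Nonempty (H i' ≃* H i) := fun i' => i'.2.map MulEquiv.symm
    let e : ∀ i' : {i' // r i i'}, H i' ≃* H i := fun i' => (hex i').some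
    refine L2 hp hμ hb hW (hH i) (fun i' : {i' // r i i'} => (ρ i').comp (e i').symm.toMonoidHom) ?_
      (fun i' => G i') (fun i' => hG i') (fun i' => j i') (fun i' => (e i').toMonoidHom.comp (π i'))
      (fun i' => (hE i').compEquiv (e i')) (fun i₁ i₂ h => Subtype.ext (hiso _ _ h))
    intro i'
    refine ⟨(hs i').1, fun X hX => (hs i').2 X fun g x hx => ?_⟩
    have := hX (e i' g) x hx
    change ρ i' ((e i').symm (e i' g)) x ∈ X at this
    rwa [(e i').symm_apply_apply] at this


lemma ext_struct {μ : ℕ} {G : Type} [Group G] (hG : Good μ G) (h1 : 1 < Nat.card G) :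
    ∃ p b : ℕ, p.Prime ∧ 1 ≤ b ∧ Nat.card G = p ^ b * (Nat.card G / p ^ b) ∧
      ∃ (H : Type) (_ : Group H) (ρ : H →* AddMonoid.End (Fin b → ZMod p))
        (j : Multiplicative (Fin b → ZMod p) →* G) (π : G →* H), IsExt ρ j π ∧ IsSimp ρ ∧ Good μ H ∧
        Nat.card H = Nat.card G / p ^ b := by
  have := hG.fin
  have hnt : Nontrivial G := Finite.one_lt_card_iff_nontrivial.1 h1
  obtain ⟨p, b, hp, hb, j, hj, hn, -, hmin⟩ :=
    exists_min_normal hG.sol (⊤ : Subgroup G) inferInstance top_ne_bot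
  have : Fact p.Prime := ⟨hp⟩
  have : Nonempty (Fin b) := ⟨⟨0, hb⟩⟩
  obtain ⟨ρ₀, hρ₀⟩ := exists_action j hj hn
  have hker : j.range ≤ ρ₀.ker := by
    rintro _ ⟨v, rfl⟩
    rw [MonoidHom.mem_ker]
    refine DFunLike.ext _ _ fun w => ?_
    apply ofAdd.injective
    apply hj
    rw [hρ₀, ← map_mul, mul_comm v, map_mul, mul_inv_cancel_right]
    rfl
  have hsimp : IsSimp ρ₀ := isSimp_of_min j hj hmin id Function.surjective_id ρ₀ hρ₀
  have hcard : Nat.card G = Nat.card (G ⧸ j.range) * p ^ b := by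
    rw [Subgroup.card_eq_card_quotient_mul_card_subgroup j.range]
    congr 1
    rw [← Nat.card_congr (MonoidHom.ofInjective hj).toEquiv]
    change Nat.card (Fin b → ZMod p) = p ^ b
    rw [Nat.card_fun]; simp
  have hdiv : Nat.card (G ⧸ j.range) = Nat.card G / p ^ b := by
    rw [hcard, Nat.mul_div_cancel _ (pow_pos hp.pos b)]
  refine ⟨p, b, hp, hb, ?_, G ⧸ j.range, inferInstance, QuotientGroup.lift j.range ρ₀ hker, j,
    QuotientGroup.mk' j.range, ⟨hj, QuotientGroup.mk'_surjective _, ?_, ?_⟩, ?_, ?_, hdiv⟩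
  · rw [← hdiv, mul_comm]; exact hcard
  · intro g
    rw [← MonoidHom.mem_ker, QuotientGroup.ker_mk']
  · intro g w
    exact hρ₀ g w
  · exact ⟨hsimp.1, fun X hX => hsimp.2 X fun g x hx => hX (QuotientGroup.mk' j.range g) x hx⟩
  · exact hG.surjective _ (QuotientGroup.mk'_surjective j.range)

theorem L4 {μ : ℕ} (hμ : 1 ≤ μ) (n : ℕ) : ∀ (ι : Type) [Finite ι] (G : ι → Type)
    [∀ i, Group (G i)], (∀ i, Good μ (G i)) →
      (∀ i, Nat.card (G i) = n) → (∀ i i', Nonempty (G i ≃* G i') → i = i') →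
      Nat.card ι ≤ n ^ (7 * μ + 6) := by
  induction n using Nat.strong_induction_on with
  | _ n IH =>
  intro ι _ G _ hG hn hiso
  rcases isEmpty_or_nonempty ι with he | ⟨⟨i₀⟩⟩
  · simp
  have hn0 : 0 < n := by
    have := (hG i₀).fin
    rw [← hn i₀]; exact Nat.card_pos
  rcases Nat.lt_or_ge 1 n with hn1 | hn1
  swap
  · have hn1' : n = 1 := by omega
    subst hn1'
    have : Subsingleton ι := ⟨fun i i' => hiso i i' (by
      have := (Nat.card_eq_one_iff_unique.1 (hn i)).1
      have := (Nat.card_eq_one_iff_unique.1 (hn i')).1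
      exact ⟨{ toFun := fun _ => 1, invFun := fun _ => 1, left_inv := fun _ => Subsingleton.elim _ _,
               right_inv := fun _ => Subsingleton.elim _ _,
               map_mul' := fun _ _ => Subsingleton.elim _ _ }⟩)⟩
    rw [one_pow]
    exact Finite.card_le_one_iff_subsingleton.2 this
  have hex := fun i => ext_struct (hG i) (by rw [hn i]; exact hn1)
  simp only [hn] at hex
  choose p b hp hb hpb H iH ρ j π hE hs hH hHc using hex
  let d : ι → Finset.Icc 2 n := fun i => ⟨p i ^ b i, Finset.mem_Icc.2 ⟨
    (hp i).two_le.trans (Nat.le_self_pow (by have := hb i; omega) _),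
    Nat.le_of_dvd hn0 ⟨_, hpb i⟩⟩⟩
  have hfib : ∀ e : Finset.Icc 2 n, Nat.card {i // d i = e} ≤
      (n / e) ^ (7 * μ + 6) * (e : ℕ) ^ (7 * μ + 4) := by
    intro e
    rcases isEmpty_or_nonempty {i // d i = e} with he | ⟨⟨i₁, h₁⟩⟩
    · simp
    have he1 : p i₁ ^ b i₁ = e := congrArg Subtype.val h₁
    have hex : ∀ i : {i // d i = e}, ∃ (H : Type) (_ : Group H)
        (ρ : H →* AddMonoid.End (Fin (b i₁) → ZMod (p i₁)))
        (j : Multiplicative (Fin (b i₁) → ZMod (p i₁)) →* G i) (π : G i →* H),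
        IsExt ρ j π ∧ IsSimp ρ ∧ Good μ H ∧ Nat.card H = n / e := by
      rintro ⟨i, hi⟩
      have hei : p i ^ b i = e := congrArg Subtype.val hi
      have hee : p i₁ ^ b i₁ = p i ^ b i := he1.trans hei.symm
      have h2 : p i₁ = p i := by
        have h3 : p i₁ ∣ p i ^ b i := hee ▸ dvd_pow_self _ (by have := hb i₁; omega)
        exact (Nat.prime_dvd_prime_iff_eq (hp _) (hp _)).1 ((hp _).dvd_of_dvd_pow h3)
      have h4 : b i₁ = b i := by
        rw [h2] at hee
        exact Nat.pow_right_injective (hp i).two_le hee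
      rw [h2, h4, ← hei]
      exact ⟨H i, iH i, ρ i, j i, π i, hE i, hs i, hH i, hHc i⟩
    have hpf : Fact (p i₁).Prime := ⟨hp i₁⟩
    choose H' iH' ρ' j' π' hE' hs' hH' hHc' using hex
    have hW : Nat.card (Fin (b i₁) → ZMod (p i₁)) = p i₁ ^ b i₁ := by
      rw [Nat.card_fun]; simp
    have he2 := Finset.mem_Icc.1 e.2
    have := L3 (hp i₁) hμ (hb i₁) hW (IH (n / e) (Nat.div_lt_self hn0 he2.1)) H' hH' hHc' ρ' hs'
      (fun i => G i) (fun i => hG i) j' π' hE' (fun i i' h => Subtype.ext (hiso _ _ h))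
    rwa [he1] at this
  rw [Nat.card_congr (Equiv.sigmaFiberEquiv d).symm, Nat.card_sigma]
  have hT : ∑ e : Finset.Icc 2 n, Nat.card {i // d i = e} ≤
      ∑ e ∈ Finset.Icc 2 n, (n / e) ^ (7 * μ + 6) * e ^ (7 * μ + 4) := by
    rw [← Finset.sum_coe_sort (Finset.Icc 2 n)
      (fun e => (n / e) ^ (7 * μ + 6) * e ^ (7 * μ + 4))]
    exact Finset.sum_le_sum fun e _ => hfib e
  refine hT.trans ?_
  have hreal : ((∑ e ∈ Finset.Icc 2 n, (n / e) ^ (7 * μ + 6) * e ^ (7 * μ + 4) : ℕ) : ℝ) ≤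
      (n : ℝ) ^ (7 * μ + 6) := by
    push_cast
    have h1 : ∀ e ∈ Finset.Icc 2 n, ((n / e : ℕ) : ℝ) ^ (7 * μ + 6) * (e : ℝ) ^ (7 * μ + 4) ≤
        (n : ℝ) ^ (7 * μ + 6) * (1 / (e : ℝ) ^ 2) := by
      intro e he
      rw [Finset.mem_Icc] at he
      have he' : (0 : ℝ) < e := by exact_mod_cast (by omega : 0 < e)
      calc ((n / e : ℕ) : ℝ) ^ (7 * μ + 6) * (e : ℝ) ^ (7 * μ + 4)
          ≤ ((n : ℝ) / e) ^ (7 * μ + 6) * (e : ℝ) ^ (7 * μ + 4) := by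
            gcongr; exact Nat.cast_div_le
        _ = _ := by
          rw [div_pow, pow_add (e : ℝ) (7 * μ) 4, pow_add (e : ℝ) (7 * μ) 6]
          field_simp
    refine (Finset.sum_le_sum h1).trans ?_
    rw [← Finset.mul_sum]
    have h2 := sum_sq n hn0
    have h3 : 0 ≤ 1 / (n : ℝ) := by positivity
    exact mul_le_of_le_one_right (by positivity) (by linarith)
  exact_mod_cast hreal


lemma agp_of_isAGroup {G : Type} [Group G] [Finite G] (h : IsAGroup G) : AGp G := by
  intro p hp P hP a ha b hb
  have : Fact p.Prime := ⟨hp⟩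
  obtain ⟨Q, hQ⟩ := hP.exists_le_sylow
  have hQ' : IsSylow' p (Q : Subgroup G) :=
    ⟨Q.2, ((Nat.Prime.coprime_iff_not_dvd hp).2 Q.not_dvd_index).symm⟩
  exact congrArg Subtype.val (h p hp Q hQ' ⟨a, hQ ha⟩ ⟨b, hQ hb⟩)

lemma good_of_isAGroup {n : ℕ} [Group (Fin n)]
    (h : IsAGroup (Fin n)) (hs : Group.IsSolvable (Fin n)) : Good (muExp n) (Fin n) := by
  refine ⟨inferInstance, hs, agp_of_isAGroup h, fun p _ => ?_⟩
  rw [Nat.card_fin]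
  by_cases hp : p ∈ n.factorization.support
  · exact Finset.le_sup (f := n.factorization) hp
  · rw [Finsupp.notMem_support_iff.1 hp]
    exact Nat.zero_le _

lemma groupIsoOf_of_subsingleton {α : Type} [Subsingleton α] (g h : Group α) : GroupIsoOf g h := by
  let _ := g
  exact ⟨@MulEquiv.mk α α g.toMul h.toMul (Equiv.refl _) fun _ _ => Subsingleton.elim (α := α) _ _⟩

lemma muExp_pos {n : ℕ} (hn : 1 < n) : 1 ≤ muExp n := by
  obtain ⟨p, hp, hd⟩ := Nat.exists_prime_and_dvd hn.ne'
  have h1 : 1 ≤ n.factorization p := hp.factorization_pos_of_dvd (by omega) hd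
  have h2 : p ∈ n.factorization.support := by
    rw [Finsupp.mem_support_iff]; omega
  exact h1.trans (Finset.le_sup (f := n.factorization) h2)

/-- `f_{A,sol}(n) ≤ n^{7μ(n)+6}` for all `n ≥ 1`, where `f_{A,sol}`
counts isomorphism classes of solvable `A`-groups of order `n`. -/
theorem solvable_agroup_count_le (n : ℕ) (hn : 1 ≤ n) :
    numGroups n (fun G g => letI := g; IsAGroup G ∧ IsSolvable G) ≤
      n ^ (7 * muExp n + 6) := by
  have hf : Finite (Group (Fin n)) := by
    have : Function.Injective (fun (g : Group (Fin n)) => g.mul) := by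
      intro g g' h
      exact Group.ext h
    exact Finite.of_injective _ this
  rcases Nat.lt_or_ge 1 n with hn1 | hn1
  swap
  · have hn1' : n = 1 := by omega
    subst hn1'
    rw [one_pow]
    unfold numGroups
    apply Finite.card_le_one_iff_subsingleton.2
    refine ⟨fun x y => ?_⟩
    induction x using Quot.ind with
    | _ x =>
    induction y using Quot.ind with
    | _ y =>
    apply Quot.sound
    exact groupIsoOf_of_subsingleton _ _
  · unfold numGroups
    let G : (Quot fun g h : {g : Group (Fin n) // IsAGroup (Fin n) ∧ Group.IsSolvable (Fin n)} =>
      GroupIsoOf g.1 h.1) → Type := fun _ => Fin n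
    let inst : ∀ i, Group (G i) := fun i => (Quot.out i).1
    refine @L4 _ (muExp_pos hn1) n _ _ G inst ?_ ?_ ?_
    · intro i
      let _ : Group (Fin n) := (Quot.out i).1
      exact good_of_isAGroup (Quot.out i).2.1 (Quot.out i).2.2
    · intro i
      exact Nat.card_fin n
    · intro i i' h
      rw [← Quot.out_eq i, ← Quot.out_eq i']
      exact Quot.sound h
end

section
/- Let p and q be distinct primes and let 𝔘 be the class of finite groups lying in 𝔄_p𝔄_q. Then for every natural number n ≥ 1, f_𝔘(n) ≤ n^{c_{p,q}·μ(n) + 1}. -/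
/-- A group is abelian of exponent dividing `p`. -/
def ElemAbelian (p : ℕ) (G : Type*) [Group G] : Prop :=
  (∀ a b : G, a * b = b * a) ∧ ∀ a : G, a ^ p = 1

/-- `G` lies in the product variety `𝔄_p𝔄_q`: there is a normal subgroup `N` that is
abelian of exponent dividing `p` such that `G/N` is abelian of exponent dividing `q`
(expressed by: all commutators and all `q`-th powers lie in `N`). -/
def InApAq (p q : ℕ) (G : Type*) [Group G] : Prop :=
  ∃ N : Subgroup G, N.Normal ∧ ElemAbelian p N ∧
    (∀ a b : G, a * b * a⁻¹ * b⁻¹ ∈ N) ∧ ∀ a : G, a ^ q ∈ N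

/-- `G` lies in `𝔄_p𝔄_q𝔄_r`: there is a normal subgroup `N`, abelian of exponent
dividing `p`, with `G/N ∈ 𝔄_q𝔄_r`. -/
def InApAqAr (p q r : ℕ) (G : Type*) [Group G] : Prop :=
  ∃ N : Subgroup G, ∃ _ : N.Normal, ElemAbelian p N ∧ InApAq q r (G ⧸ N)

/-- The constant `c_{p,q} = 1/d − 2√((log p/log q)² + log p/(d·log q)) + 2·log p/log q`,
where `d` is the multiplicative order of `p` modulo `q`.  (The quotients of logarithms do
not depend on the base of the logarithm.) -/
noncomputable def cpq (p q : ℕ) : ℝ :=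
  1 / (orderOf (p : ZMod q) : ℝ)
    - 2 * Real.sqrt ((Real.log p / Real.log q) ^ 2
        + Real.log p / ((orderOf (p : ZMod q) : ℝ) * Real.log q))
    + 2 * (Real.log p / Real.log q)


theorem simple_field (p q : ℕ) [Fact p.Prime] [Fact q.Prime] (hpq : p ≠ q)
    {K : Type} [Field K] [Fintype K] [Algebra (ZMod p) K]
    (hK : Fintype.card K = p ^ orderOf (p : ZMod q)) {ζ : K} (hζ : IsPrimitiveRoot ζ q)
    {L : Type} [Field L] [Finite L] [Algebra (ZMod p) L]
    {Q : Type} [AddCommGroup Q] [Module (ZMod q) Q] (u : Multiplicative Q →* L)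
    (hgen : Algebra.adjoin (ZMod p) (Set.range u) = ⊤) :
    (∃ e : L ≃+ ZMod p, ∀ h x, e (u h * x) = e x) ∨
    (∃ (χ : Q →ₗ[ZMod q] ZMod q) (e : L ≃+ K),
      ∀ h x, e (u h * x) = AddChar.zmodChar q hζ.pow_eq_one (χ h.toAdd) * e x) := by
  classical
  have hp : p.Prime := Fact.out
  have hq : q.Prime := Fact.out
  have : Fintype L := Fintype.ofFinite L
  have huq : ∀ h, u h ^ q = 1 := by
    intro h
    rw [← map_pow]
    have : h ^ q = 1 := by
      have h2 : q • h.toAdd = 0 := by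
        rw [← Nat.cast_smul_eq_nsmul (ZMod q)]; simp
      exact h2
    rw [this, map_one]
  by_cases htriv : ∀ h, u h = 1
  · left
    have hsurj : Function.Surjective (algebraMap (ZMod p) L) := by
      intro x
      have hx : x ∈ Algebra.adjoin (ZMod p) (Set.range u) := by rw [hgen]; trivial
      have : Algebra.adjoin (ZMod p) (Set.range u) ≤ ⊥ := by
        rw [Algebra.adjoin_le_iff]
        rintro _ ⟨h, rfl⟩
        rw [htriv]; exact one_mem _
      exact Algebra.mem_bot.1 (this hx)
    let e := AddEquiv.ofBijective (algebraMap (ZMod p) L : ZMod p →+ L)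
      ⟨(algebraMap (ZMod p) L).injective, hsurj⟩
    exact ⟨e.symm, fun h x => by rw [htriv, one_mul]⟩
  · right
    push Not at htriv
    obtain ⟨h0, hh0⟩ := htriv
    have hord : orderOf (u h0) = q := orderOf_eq_prime (huq h0) hh0
    have : CharP L p := by rw [← Algebra.charP_iff (ZMod p) L p]; exact ZMod.charP p
    obtain ⟨e, he0, he⟩ := FiniteField.card L p
    -- q ∣ p^e - 1
    have hcop : (p : ZMod q) ≠ 0 := by
      rw [Ne, ZMod.natCast_eq_zero_iff]
      exact fun h => hpq ((Nat.prime_dvd_prime_iff_eq hq hp).1 h).symm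
    have hmod : ∀ k : ℕ, (q ∣ p ^ k - 1) ↔ orderOf (p : ZMod q) ∣ k := by
      intro k
      rw [orderOf_dvd_iff_pow_eq_one]
      rw [← Nat.modEq_iff_dvd' (Nat.one_le_pow _ _ hp.pos), ← ZMod.natCast_eq_natCast_iff]
      push_cast
      exact eq_comm
    have hde : orderOf (p : ZMod q) ∣ (e : ℕ) := by
      rw [← hmod, ← he, ← hord]
      apply orderOf_dvd_of_pow_eq_one
      apply FiniteField.pow_card_sub_one_eq_one
      intro h
      have := huq h0
      rw [h, zero_pow hq.ne_zero] at this
      exact zero_ne_one this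
    have hfix : ∀ x : L, x ^ p ^ (orderOf (p : ZMod q)) = x := by
      intro x
      have hx : x ∈ Algebra.adjoin (ZMod p) (Set.range u) := by rw [hgen]; trivial
      induction hx using Algebra.adjoin_induction with
      | mem x hx =>
        obtain ⟨h, rfl⟩ := hx
        obtain ⟨c, hc⟩ := (hmod _).2 (dvd_refl (orderOf (p : ZMod q)))
        have : p ^ orderOf (p : ZMod q) = q * c + 1 := by
          have := Nat.one_le_pow (orderOf (p : ZMod q)) p hp.pos
          omega
        rw [this, pow_succ, pow_mul, huq, one_pow, one_mul]
      | algebraMap r => rw [← map_pow, ZMod.pow_card_pow]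
      | add x y _ _ hx hy => rw [add_pow_char_pow, hx, hy]
      | mul x y _ _ hx hy => rw [mul_pow, hx, hy]
    have hd0 : 0 < orderOf (p : ZMod q) := Nat.pos_of_dvd_of_pos hde e.pos
    have hle : Fintype.card L ≤ p ^ orderOf (p : ZMod q) := by
      have h1 : 1 < p ^ orderOf (p : ZMod q) := Nat.one_lt_pow hd0.ne' hp.one_lt
      have hne := FiniteField.X_pow_card_sub_X_ne_zero L h1
      have hdeg := FiniteField.X_pow_card_sub_X_natDegree_eq L h1
      rw [← hdeg, ← Finset.card_univ]
      refine le_trans (Finset.card_le_card (t := (Polynomial.X ^ (p ^ orderOf (p : ZMod q)) - Polynomial.X : Polynomial L).roots.toFinset) ?_) ((Multiset.toFinset_card_le _).trans (Polynomial.card_roots' _))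
      intro x _
      rw [Multiset.mem_toFinset, Polynomial.mem_roots hne]
      simp [hfix x]
    have hLK : Fintype.card L = Fintype.card K := by
      rw [hK]
      refine le_antisymm hle ?_
      rw [he]
      exact Nat.pow_le_pow_right hp.pos (Nat.le_of_dvd e.pos hde)
    let σ := FiniteField.algEquivOfCardEq p hLK
    let ψ := AddChar.zmodChar q hζ.pow_eq_one
    have hψ : Function.Injective ψ := by
      intro a b hab
      have hab' : ζ ^ a.val = ζ ^ b.val := hab
      exact ZMod.val_injective q (hζ.pow_inj (ZMod.val_lt a) (ZMod.val_lt b) hab')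
    have hex : ∀ x : Q, ∃ a : ZMod q, ψ a = σ (u (Multiplicative.ofAdd x)) := by
      intro x
      obtain ⟨i, hi, hi2⟩ := hζ.eq_pow_of_pow_eq_one
        (ξ := σ (u (Multiplicative.ofAdd x))) (by rw [← map_pow, huq, map_one])
      refine ⟨(i : ZMod q), ?_⟩
      rw [← hi2]
      exact AddChar.zmodChar_apply' _ _
    choose χ hχ using hex
    have hadd : ∀ x y, χ (x + y) = χ x + χ y := by
      intro x y
      apply hψ
      rw [AddChar.map_add_eq_mul, hχ, hχ, hχ, ofAdd_add, map_mul, map_mul]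
    refine ⟨AddMonoidHom.toZModLinearMap q (AddMonoidHom.mk' χ hadd), σ.toRingEquiv.toAddEquiv, ?_⟩
    intro h x
    change σ (u h * x) = ψ (χ h.toAdd) * σ x
    rw [map_mul, hχ]
    rfl

open MonoidAlgebra in
theorem simple_mod (p q : ℕ) [Fact p.Prime] [Fact q.Prime] (hpq : p ≠ q)
    {K : Type} [Field K] [Fintype K] [Algebra (ZMod p) K]
    (hK : Fintype.card K = p ^ orderOf (p : ZMod q)) {ζ : K} (hζ : IsPrimitiveRoot ζ q)
    {Q : Type} [AddCommGroup Q] [Module (ZMod q) Q] [Finite Q]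
    {M : Type} [AddCommGroup M] [Module (MonoidAlgebra (ZMod p) (Multiplicative Q)) M]
    [IsSimpleModule (MonoidAlgebra (ZMod p) (Multiplicative Q)) M] :
    (∃ e : M ≃+ ZMod p, ∀ h x, e (of (ZMod p) (Multiplicative Q) h • x) = e x) ∨
    (∃ (χ : Q →ₗ[ZMod q] ZMod q) (e : M ≃+ K),
      ∀ h x, e (of (ZMod p) (Multiplicative Q) h • x)
        = AddChar.zmodChar q hζ.pow_eq_one (χ h.toAdd) * e x) := by
  obtain ⟨I, hI, ⟨f⟩⟩ := isSimpleModule_iff_quot_maximal.1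
    (inferInstance : IsSimpleModule (MonoidAlgebra (ZMod p) (Multiplicative Q)) M)
  let _ : Field (MonoidAlgebra (ZMod p) (Multiplicative Q) ⧸ I) := Ideal.Quotient.field I
  have hfin : Finite (MonoidAlgebra (ZMod p) (Multiplicative Q)) :=
    Module.finite_of_finite (ZMod p)
  have : Finite (MonoidAlgebra (ZMod p) (Multiplicative Q) ⧸ I) :=
    Finite.of_surjective _ (Ideal.Quotient.mk_surjective (I := I))
  let u : Multiplicative Q →* (MonoidAlgebra (ZMod p) (Multiplicative Q) ⧸ I) :=
    ((Ideal.Quotient.mk I : _ →+* _) : _ →* _).comp (of (ZMod p) (Multiplicative Q))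
  have hgen : Algebra.adjoin (ZMod p) (Set.range u) = ⊤ := by
    rw [eq_top_iff]
    rintro x -
    obtain ⟨y, rfl⟩ := Ideal.Quotient.mk_surjective x
    induction y using MonoidAlgebra.induction_on with
    | of m => exact Algebra.subset_adjoin ⟨m, rfl⟩
    | add x y hx hy => rw [map_add]; exact add_mem hx hy
    | smul r x hx =>
      have := Subalgebra.smul_mem _ hx r
      exact this
  have hf : ∀ h x, f (of (ZMod p) (Multiplicative Q) h • x) = u h * f x := by
    intro h x
    rw [map_smul, Algebra.smul_def]; rfl
  rcases simple_field p q hpq hK hζ u hgen with ⟨e, he⟩ | ⟨χ, e, he⟩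
  · left
    refine ⟨f.toAddEquiv.trans e, fun h x => ?_⟩
    change e (f _) = e (f _)
    rw [hf, he]
  · right
    refine ⟨χ, f.toAddEquiv.trans e, fun h x => ?_⟩
    change e (f _) = _ * e (f _)
    rw [hf, he]

open MonoidAlgebra in
theorem rep_decomp (p q : ℕ) [Fact p.Prime] [Fact q.Prime] (hpq : p ≠ q)
    {K : Type} [Field K] [Fintype K] [Algebra (ZMod p) K]
    (hK : Fintype.card K = p ^ orderOf (p : ZMod q)) {ζ : K} (hζ : IsPrimitiveRoot ζ q)
    {Q : Type} [AddCommGroup Q] [Module (ZMod q) Q] [Finite Q]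
    {V : Type} [AddCommGroup V] [Module (ZMod p) V] [Finite V]
    (ρ : Representation (ZMod p) (Multiplicative Q) V) :
    ∃ (ι τ : Type) (_ : Finite ι) (_ : Finite τ) (χ : ι → (Q →ₗ[ZMod q] ZMod q))
      (e : V ≃+ (ι → K) × (τ → ZMod p)),
      ∀ h x, e (ρ h x) = (fun i => AddChar.zmodChar q hζ.pow_eq_one (χ i h.toAdd) * (e x).1 i,
        (e x).2) := by
  classical
  have hp : p.Prime := Fact.out
  have hq : q.Prime := Fact.out
  have hcard : NeZero (Nat.card (Multiplicative Q) : ZMod p) := by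
    constructor
    have : Nat.card (Multiplicative Q) = Nat.card Q := rfl
    rw [this, ← FiniteField.pow_finrank_eq_natCard q Q, Ne, ZMod.natCast_eq_zero_iff]
    intro h
    exact hpq ((Nat.prime_dvd_prime_iff_eq hp hq).1 (hp.dvd_of_dvd_pow h))
  let _ : AddCommGroup ρ.asModule := inferInstanceAs (AddCommGroup V)
  have hfinM : Finite ρ.asModule := inferInstanceAs (Finite V)
  have hMF : Module.Finite (MonoidAlgebra (ZMod p) (Multiplicative Q)) ρ.asModule :=
    Module.Finite.of_finite
  obtain ⟨n, S, f, hS⟩ := IsSemisimpleModule.exists_linearEquiv_fin_dfinsupp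
    (MonoidAlgebra (ZMod p) (Multiplicative Q)) ρ.asModule
  have key := fun i => (haveI := hS i; simple_mod p q hpq hK hζ (Q := Q) (M := S i))
  let P : Fin n → Prop := fun i => ∃ (χ : Q →ₗ[ZMod q] ZMod q) (e : S i ≃+ K),
      ∀ h x, e (of (ZMod p) (Multiplicative Q) h • x)
        = AddChar.zmodChar q hζ.pow_eq_one (χ h.toAdd) * e x
  have h1 : ∀ i : {i // P i}, ∃ (χ : Q →ₗ[ZMod q] ZMod q) (e : S i.1 ≃+ K),
      ∀ h x, e (of (ZMod p) (Multiplicative Q) h • x)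
        = AddChar.zmodChar q hζ.pow_eq_one (χ h.toAdd) * e x := fun i => i.2
  have h2 : ∀ i : {i // ¬ P i}, ∃ e : S i.1 ≃+ ZMod p,
      ∀ h x, e (of (ZMod p) (Multiplicative Q) h • x) = e x :=
    fun i => (key i.1).resolve_right i.2
  choose χ e1 he1 using h1
  choose e2 he2 using h2
  let F : V →+ ({i // P i} → K) × ({i // ¬ P i} → ZMod p) :=
    AddMonoidHom.mk' (fun v => (fun i => e1 i (f (ρ.asModuleEquiv.symm v) i.1),
      fun i => e2 i (f (ρ.asModuleEquiv.symm v) i.1))) (by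
        intro a b
        ext i <;> simp)
  have hF : Function.Bijective F := by
    constructor
    · intro a b hab
      have ha := congrArg Prod.fst hab
      have hb := congrArg Prod.snd hab
      apply ρ.asModuleEquiv.symm.injective
      apply f.injective
      ext1 i
      by_cases hi : P i
      · exact (e1 ⟨i, hi⟩).injective (congrFun ha ⟨i, hi⟩)
      · exact (e2 ⟨i, hi⟩).injective (congrFun hb ⟨i, hi⟩)
    · rintro ⟨a, b⟩
      let w : ∀ i, S i := fun i => if hi : P i then (e1 ⟨i, hi⟩).symm (a ⟨i, hi⟩)
        else (e2 ⟨i, hi⟩).symm (b ⟨i, hi⟩)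
      have hw : ∀ i, (DFinsupp.equivFunOnFintype.symm w) i = w i := fun i =>
        congrFun (Equiv.apply_symm_apply DFinsupp.equivFunOnFintype w) i
      refine ⟨ρ.asModuleEquiv (f.symm (DFinsupp.equivFunOnFintype.symm w)), ?_⟩
      ext i
      · change e1 i (f (ρ.asModuleEquiv.symm _) i.1) = a i
        rw [LinearEquiv.symm_apply_apply, LinearEquiv.apply_symm_apply, hw]
        simp [w, i.2]
      · change e2 i (f (ρ.asModuleEquiv.symm _) i.1) = b i
        rw [LinearEquiv.symm_apply_apply, LinearEquiv.apply_symm_apply, hw]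
        simp [w, i.2]
  refine ⟨{i // P i}, {i // ¬ P i}, inferInstance, inferInstance, χ, AddEquiv.ofBijective F hF, ?_⟩
  intro h x
  change (_, _) = (_, _)
  have hh : f (ρ.asModuleEquiv.symm (ρ h x)) =
      of (ZMod p) (Multiplicative Q) h • f (ρ.asModuleEquiv.symm x) := by
    rw [Representation.asModuleEquiv_symm_map_rho, map_smul]
  congr 1
  · funext i
    change e1 i (f (ρ.asModuleEquiv.symm (ρ h x)) i.1) = _ * e1 i (f (ρ.asModuleEquiv.symm x) i.1)
    rw [hh, DFinsupp.smul_apply, he1]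
  · funext i
    change e2 i (f (ρ.asModuleEquiv.symm (ρ h x)) i.1) = e2 i (f (ρ.asModuleEquiv.symm x) i.1)
    rw [hh, DFinsupp.smul_apply, he2]


abbrev VD (K : Type) (p r s m : ℕ) : Type := (Fin r → K) × (Fin s → K) × (Fin m → ZMod p)
abbrev QD (q r t : ℕ) : Type := (Fin r → ZMod q) × (Fin t → ZMod q)

/-- The action of the normal form attached to the matrix `A`. -/
def actD {K : Type} [Field K] {p q r s m t : ℕ} (ψ : ZMod q → K) (A : Fin s → Fin r → ZMod q)
    (x : QD q r t) (v : VD K p r s m) : VD K p r s m :=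
  (fun i => ψ (x.1 i) * v.1 i, fun j => ψ (∑ l, A j l * x.1 l) * v.2.1 j, v.2.2)

/-- The group `G` is described by the normal form with matrix `A`. -/
def HasData {K : Type} [Field K] (p : ℕ) {q : ℕ} (ψ : ZMod q → K) (r s m t : ℕ)
    (A : Fin s → Fin r → ZMod q) (G : Type) [Group G] : Prop :=
  ∃ e : G ≃ VD K p r s m × QD q r t,
    ∀ g h, e (g * h) = ((e g).1 + actD ψ A (e g).2 (e h).1, (e g).2 + (e h).2)

theorem HasData.iso {K : Type} [Field K] {p : ℕ} {q : ℕ} {ψ : ZMod q → K} {r s m t : ℕ}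
    {A : Fin s → Fin r → ZMod q} {G H : Type} [Group G] [Group H]
    (hG : HasData p ψ r s m t A G) (hH : HasData p ψ r s m t A H) : Nonempty (G ≃* H) := by
  obtain ⟨e, he⟩ := hG
  obtain ⟨f, hf⟩ := hH
  refine ⟨MulEquiv.mk' (e.trans f.symm) fun g h => ?_⟩
  apply f.injective
  simp [hf, he]

theorem rep_normal (p q : ℕ) [Fact p.Prime] [Fact q.Prime] (hpq : p ≠ q)
    {K : Type} [Field K] [Fintype K] [Algebra (ZMod p) K]
    (hK : Fintype.card K = p ^ orderOf (p : ZMod q)) {ζ : K} (hζ : IsPrimitiveRoot ζ q)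
    {Q : Type} [AddCommGroup Q] [Module (ZMod q) Q] [Finite Q]
    {V : Type} [AddCommGroup V] [Module (ZMod p) V] [Finite V]
    (ρ : Representation (ZMod p) (Multiplicative Q) V) :
    ∃ (r s m t : ℕ) (A : Fin s → Fin r → ZMod q)
      (eV : V ≃+ VD K p r s m) (eQ : Q ≃+ QD q r t),
      ∀ h x, eV (ρ h x) = actD (AddChar.zmodChar q hζ.pow_eq_one) A (eQ h.toAdd) (eV x) := by
  classical
  obtain ⟨ι, τ, hι, hτ, χ, e, he⟩ := rep_decomp p q hpq hK hζ ρ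
  obtain ⟨κ, a, ha, hspan, hli⟩ := exists_linearIndependent' (K := ZMod q) χ
  have hκ : Finite κ := Finite.of_injective a ha
  obtain ⟨r, ⟨ek⟩⟩ := Finite.exists_equiv_fin κ
  obtain ⟨s, ⟨es⟩⟩ := Finite.exists_equiv_fin ((Set.range a)ᶜ : Set ι)
  obtain ⟨m, ⟨eτ⟩⟩ := Finite.exists_equiv_fin τ
  let E : Fin r ⊕ Fin s ≃ ι :=
    (Equiv.sumCongr (ek.symm.trans (Equiv.ofInjective a ha)) es.symm).trans
      (Equiv.Set.sumCompl (Set.range a))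
  have hE : ∀ l, E (Sum.inl l) = a (ek.symm l) := fun l => rfl
  -- coordinates on V
  let F : V →+ VD K p r s m := AddMonoidHom.mk' (fun v =>
    (fun i => (e v).1 (E (Sum.inl i)), fun j => (e v).1 (E (Sum.inr j)),
      fun j => (e v).2 (eτ.symm j))) (by intro v w; ext <;> simp)
  have hF : Function.Bijective F := by
    constructor
    · intro v w hvw
      have h1 := congrArg Prod.fst hvw
      have h2 := congrArg (fun z => z.2.1) hvw
      have h3 := congrArg (fun z => z.2.2) hvw
      apply e.injective
      refine Prod.ext ?_ ?_
      · funext i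
        obtain ⟨x, rfl⟩ := E.surjective i
        rcases x with x | x
        · exact congrFun h1 x
        · exact congrFun h2 x
      · funext i
        obtain ⟨x, rfl⟩ := eτ.symm.surjective i
        exact congrFun h3 x
    · rintro ⟨x, y, z⟩
      refine ⟨e.symm (fun i => Sum.elim x y (E.symm i), fun i => z (eτ i)), ?_⟩
      change (_, _, _) = (_, _, _)
      simp
  -- coordinates on Q
  let g : Q →ₗ[ZMod q] (Fin r → ZMod q) := LinearMap.pi fun l => χ (E (Sum.inl l))
  have hg : Function.Surjective g := by
    rw [← LinearMap.dualMap_injective_iff, injective_iff_map_eq_zero]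
    intro φ hφ
    have hli' : LinearIndependent (ZMod q) (fun l => χ (E (Sum.inl l))) :=
      hli.comp ek.symm ek.symm.injective
    rw [Fintype.linearIndependent_iff] at hli'
    have := hli' (fun l => φ (Pi.single l 1)) (by
      ext x
      have h1 : φ (g x) = 0 := LinearMap.congr_fun hφ x
      rw [LinearMap.pi_apply_eq_sum_univ φ (g x)] at h1
      simp only [LinearMap.sum_apply, LinearMap.smul_apply, LinearMap.zero_apply]
      rw [← h1]
      refine Finset.sum_congr rfl fun l _ => ?_
      rw [smul_eq_mul, smul_eq_mul, mul_comm]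
      congr 2
      funext j
      simp [Pi.single_apply, eq_comm])
    refine LinearMap.pi_ext' fun l => LinearMap.ext_ring ?_
    simpa using this l
  obtain ⟨π, hπ⟩ := LinearMap.exists_leftInverse_of_injective (LinearMap.ker g).subtype
    (by simp)
  let b := (Module.finBasis (ZMod q) (LinearMap.ker g)).equivFun
  have hπ' : ∀ k : LinearMap.ker g, π k = k := fun k => LinearMap.congr_fun hπ k
  let H : Q →+ QD q r _ := AddMonoidHom.mk' (fun x => (g x, b (π x))) (by
    intro x y; simp)
  have hH : Function.Bijective H := by
    constructor
    · rw [injective_iff_map_eq_zero]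
      intro x hx
      have h1 : g x = 0 := congrArg Prod.fst hx
      have h2 : b (π x) = 0 := congrArg Prod.snd hx
      have h3 : π x = 0 := by simpa using h2
      have := hπ' ⟨x, h1⟩
      rw [h3] at this
      exact (congrArg Subtype.val this).symm
    · rintro ⟨y, z⟩
      obtain ⟨x, rfl⟩ := hg y
      refine ⟨x - π x + b.symm z, ?_⟩
      change (_, _) = (_, _)
      have h1 : ∀ k : LinearMap.ker g, g k = 0 := fun k => k.2
      simp [h1, hπ']
  have hA : ∀ j : Fin s, ∃ A : Fin r → ZMod q, ∑ l, A l • χ (E (Sum.inl l)) = χ (E (Sum.inr j)) := by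
    intro j
    rw [← Submodule.mem_span_range_iff_exists_fun]
    have h1 : Set.range (fun l => χ (E (Sum.inl l))) = Set.range (χ ∘ a) := by
      exact ek.symm.surjective.range_comp (χ ∘ a)
    rw [h1, hspan]
    exact Submodule.subset_span ⟨_, rfl⟩
  choose A hA using hA
  refine ⟨r, s, m, _, A, AddEquiv.ofBijective F hF, AddEquiv.ofBijective H hH, ?_⟩
  intro h x
  change F (ρ h x) = actD _ A (H h.toAdd) (F x)
  change (_, _, _) = (_, _, _)
  rw [he]
  refine Prod.ext ?_ (Prod.ext ?_ ?_)
  · rfl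
  · funext j
    change AddChar.zmodChar q hζ.pow_eq_one (χ (E (Sum.inr j)) h.toAdd) * _ =
      AddChar.zmodChar q hζ.pow_eq_one (∑ l, A j l * χ (E (Sum.inl l)) h.toAdd) * _
    rw [← hA]
    simp
    exact Or.inl rfl
  · rfl

theorem hasData_of_split (p q : ℕ) [Fact p.Prime] [Fact q.Prime] (hpq : p ≠ q)
    {K : Type} [Field K] [Fintype K] [Algebra (ZMod p) K]
    (hK : Fintype.card K = p ^ orderOf (p : ZMod q)) {ζ : K} (hζ : IsPrimitiveRoot ζ q)
    {Q : Type} [AddCommGroup Q] [Module (ZMod q) Q] [Finite Q]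
    {V : Type} [AddCommGroup V] [Module (ZMod p) V] [Finite V]
    (G : Type) [Group G] (iV : Multiplicative V →* G) (iQ : Multiplicative Q →* G)
    (hbij : Function.Bijective
      (fun z : V × Q => iV (Multiplicative.ofAdd z.1) * iQ (Multiplicative.ofAdd z.2)))
    (hnorm : ∀ (x : Multiplicative Q) (v : V), ∃ w : V,
      iQ x * iV (Multiplicative.ofAdd v) * (iQ x)⁻¹ = iV (Multiplicative.ofAdd w)) :
    ∃ (r s m t : ℕ) (A : Fin s → Fin r → ZMod q),
      HasData p (AddChar.zmodChar q hζ.pow_eq_one) r s m t A G := by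
  have hinj : ∀ v w : V, iV (Multiplicative.ofAdd v) = iV (Multiplicative.ofAdd w) → v = w := by
    intro v w h
    have := @hbij.1 (v, 0) (w, 0) (by simpa using h)
    exact congrArg Prod.fst this
  choose c hc using hnorm
  have hadd : ∀ x v w, c x (v + w) = c x v + c x w := by
    intro x v w
    apply hinj
    rw [ofAdd_add, map_mul, ← hc, ← hc, ← hc, ofAdd_add, map_mul]
    group
  let ρ : Representation (ZMod p) (Multiplicative Q) V :=
    { toFun := fun x => AddMonoidHom.toZModLinearMap p (AddMonoidHom.mk' (c x) (hadd x))
      map_one' := by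
        ext v
        apply hinj
        change iV (Multiplicative.ofAdd (c 1 v)) = _
        rw [← hc]; simp
      map_mul' := by
        intro x y
        ext v
        apply hinj
        change iV (Multiplicative.ofAdd (c (x * y) v)) = iV (Multiplicative.ofAdd (c x (c y v)))
        rw [← hc, ← hc, ← hc, map_mul]
        group }
  have hρ : ∀ x v, ρ x v = c x v := fun _ _ => rfl
  obtain ⟨r, s, m, t, A, eV, eQ, h⟩ := rep_normal p q hpq hK hζ ρ
  refine ⟨r, s, m, t, A, (Equiv.ofBijective _ hbij).symm.trans
    (Equiv.prodCongr eV.toEquiv eQ.toEquiv), ?_⟩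
  intro g1 g2
  obtain ⟨⟨v, x⟩, rfl⟩ := (Equiv.ofBijective _ hbij).surjective g1
  obtain ⟨⟨w, y⟩, rfl⟩ := (Equiv.ofBijective _ hbij).surjective g2
  have hmul : (Equiv.ofBijective _ hbij) (v, x) * (Equiv.ofBijective _ hbij) (w, y) =
      (Equiv.ofBijective _ hbij) (v + c (Multiplicative.ofAdd x) w, x + y) := by
    simp only [Equiv.ofBijective_apply]
    rw [ofAdd_add, ofAdd_add, map_mul, map_mul, ← hc]
    group
  rw [hmul]
  simp only [Equiv.trans_apply, Equiv.symm_apply_apply]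
  change (eV _, eQ _) = (eV v + actD _ A (eQ x) (eV w), eQ x + eQ y)
  rw [map_add, map_add, ← hρ, h]
  rfl

theorem hasData_of_InApAq (p q : ℕ) [Fact p.Prime] [Fact q.Prime] (hpq : p ≠ q)
    {K : Type} [Field K] [Fintype K] [Algebra (ZMod p) K]
    (hK : Fintype.card K = p ^ orderOf (p : ZMod q)) {ζ : K} (hζ : IsPrimitiveRoot ζ q)
    (G : Type) [Group G] [Finite G] (hG : InApAq p q G) :
    ∃ (r s m t : ℕ) (A : Fin s → Fin r → ZMod q),
      HasData p (AddChar.zmodChar q hζ.pow_eq_one) r s m t A G := by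
  have hp : p.Prime := Fact.out
  have hq : q.Prime := Fact.out
  obtain ⟨N, hN, ⟨hcomm, hexp⟩, hcommQ, hexpQ⟩ := hG
  have hNp : IsPGroup p N := fun g => ⟨1, by rw [pow_one]; exact hexp g⟩
  have hQq : IsPGroup q (G ⧸ N) := by
    intro g
    obtain ⟨g, rfl⟩ := QuotientGroup.mk_surjective g
    refine ⟨1, ?_⟩
    rw [pow_one, ← QuotientGroup.mk_pow, QuotientGroup.eq_one_iff]
    exact hexpQ g
  obtain ⟨α, hα⟩ := IsPGroup.iff_card.1 hNp
  obtain ⟨β, hβ⟩ := IsPGroup.iff_card.1 hQq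
  have hcop : (p ^ α).Coprime (q ^ β) := Nat.Coprime.pow _ _ ((Nat.coprime_primes hp hq).2 hpq)
  have hcop' : Nat.Coprime (Nat.card N) N.index := by
    rw [hα, Subgroup.index, hβ]; exact hcop
  obtain ⟨H, hH⟩ := Subgroup.exists_right_complement'_of_coprime hcop'
  have hdisj : ∀ x : G, x ∈ N → x ∈ H → x = 1 := by
    intro x h1 h2
    exact Subgroup.disjoint_def.1 hH.disjoint h1 h2
  let _ : CommGroup N := { (inferInstance : Group N) with mul_comm := hcomm }
  let _ : CommGroup H := { (inferInstance : Group H) with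
    mul_comm := by
      intro a b
      have h1 := hdisj (a * b * (a : G)⁻¹ * (b : G)⁻¹) (hcommQ a b)
        (H.mul_mem (H.mul_mem (H.mul_mem a.2 b.2) (H.inv_mem a.2)) (H.inv_mem b.2))
      apply Subtype.ext
      have h2 : (a * b : G) = b * a := by
        rw [mul_inv_eq_one, mul_inv_eq_iff_eq_mul] at h1
        exact h1
      exact h2 }
  let _ : Module (ZMod p) (Additive N) := AddCommGroup.zmodModule (by
    intro x
    exact hexp x.toMul)
  let _ : Module (ZMod q) (Additive H) := AddCommGroup.zmodModule (by
    intro x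
    have : x.toMul ^ q = 1 := by
      apply Subtype.ext
      exact hdisj _ (hexpQ _) (H.pow_mem x.toMul.2 q)
    exact this)
  have fN : Finite (Additive N) := inferInstanceAs (Finite N)
  have fH : Finite (Additive H) := inferInstanceAs (Finite H)
  refine hasData_of_split p q hpq hK hζ (Q := Additive H) (V := Additive N) G
    (N.subtype : N →* G) (H.subtype : H →* G) ?_ ?_
  · exact hH
  · intro x v
    exact ⟨Additive.ofMul ⟨_, hN.conj_mem v.toMul.1 v.toMul.2 (x.toAdd.toMul : H).1⟩, rfl⟩


theorem HasData.card {K : Type} [Field K] [Fintype K] {p q : ℕ} [Fact p.Prime] [Fact q.Prime]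
    {d : ℕ} (hK : Fintype.card K = p ^ d)
    {ψ : ZMod q → K} {r s m t : ℕ} {A : Fin s → Fin r → ZMod q} {G : Type} [Group G]
    (h : HasData p ψ r s m t A G) : Nat.card G = p ^ (d * (r + s) + m) * q ^ (r + t) := by
  obtain ⟨e, -⟩ := h
  rw [Nat.card_congr e]
  have hK' : Nat.card K = p ^ d := by rw [Nat.card_eq_fintype_card, hK]
  simp only [Nat.card_prod, Nat.card_fun, Nat.card_zmod, hK', Nat.card_fin]
  ring

theorem pow_mul_pow_inj {p q : ℕ} (hp : p.Prime) (hq : q.Prime) (hpq : p ≠ q) {a b a' b' : ℕ}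
    (h : p ^ a * q ^ b = p ^ a' * q ^ b') : a = a' ∧ b = b' := by
  have hf : ∀ a b : ℕ, (p ^ a * q ^ b).factorization p = a ∧
      (p ^ a * q ^ b).factorization q = b := by
    intro a b
    rw [Nat.factorization_mul (pow_ne_zero _ hp.ne_zero) (pow_ne_zero _ hq.ne_zero),
      hp.factorization_pow, hq.factorization_pow]
    simp [hpq, hpq.symm]
  exact ⟨by rw [← (hf a b).1, h, (hf a' b').1], by rw [← (hf a b).2, h, (hf a' b').2]⟩

theorem le_muExp (n p : ℕ) : n.factorization p ≤ muExp n := by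
  by_cases h : n.factorization p = 0
  · rw [h]; exact Nat.zero_le _
  · exact Finset.le_sup (f := n.factorization) (Finsupp.mem_support_iff.2 h)

theorem orderOf_pos_aux {p q : ℕ} (hp : p.Prime) (hq : q.Prime) (hpq : p ≠ q) :
    0 < orderOf (p : ZMod q) := by
  have : Fact q.Prime := ⟨hq⟩
  have hcop : (p : ZMod q) ≠ 0 := by
    rw [Ne, ZMod.natCast_eq_zero_iff]
    exact fun h => hpq ((Nat.prime_dvd_prime_iff_eq hq hp).1 h).symm
  rw [orderOf_pos_iff, isOfFinOrder_iff_pow_eq_one]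
  exact ⟨q - 1, by have := hq.two_le; omega, ZMod.pow_card_sub_one_eq_one hcop⟩

theorem cpq_nonneg {p q : ℕ} (hp : p.Prime) (hq : q.Prime) : 0 ≤ cpq p q := by
  unfold cpq
  have hlp : 0 < Real.log p := Real.log_pos (by exact_mod_cast hp.one_lt)
  have hlq : 0 < Real.log q := Real.log_pos (by exact_mod_cast hq.one_lt)
  set d : ℝ := (orderOf (p : ZMod q) : ℝ)
  have hd : 0 ≤ d := Nat.cast_nonneg _
  have e : Real.log p / (d * Real.log q) = (1 / d) * (Real.log p / Real.log q) := by
    rw [div_mul_div_comm, one_mul]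
  rw [e]
  set x := Real.log p / Real.log q
  have hx : 0 < x := div_pos hlp hlq
  set a := 1 / d
  have ha : 0 ≤ a := by positivity
  have : Real.sqrt (x ^ 2 + a * x) ≤ x + a / 2 := by
    apply Real.sqrt_le_iff.2
    constructor
    · positivity
    · nlinarith [sq_nonneg a]
  linarith

theorem main_ineq {p q : ℕ} (hp : p.Prime) (hq : q.Prime) (hpq : p ≠ q) {r s α β : ℕ}
    (hr : r ≤ β) (hs : orderOf (p : ZMod q) * (r + s) ≤ α) :
    (q : ℝ) ^ (r * s) ≤ ((p ^ α * q ^ β : ℕ) : ℝ) ^ (cpq p q * α) := by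
  have hc := cpq_nonneg hp hq
  have hd := orderOf_pos_aux hp hq hpq
  have hlp : 0 < Real.log p := Real.log_pos (by exact_mod_cast hp.one_lt)
  have hlq : 0 < Real.log q := Real.log_pos (by exact_mod_cast hq.one_lt)
  have hp0 : (0 : ℝ) < p := by exact_mod_cast hp.pos
  have hq0 : (0 : ℝ) < q := by exact_mod_cast hq.pos
  have hn0 : (0 : ℝ) < ((p ^ α * q ^ β : ℕ) : ℝ) := by push_cast; positivity
  rw [← Real.log_le_log_iff (by positivity) (Real.rpow_pos_of_pos hn0 _), Real.log_rpow hn0]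
  push_cast
  rw [Real.log_mul (by positivity) (by positivity), Real.log_pow, Real.log_pow, Real.log_pow]
  push_cast
  have hs' : (orderOf (p : ZMod q) : ℝ) * (r + s) ≤ α := by exact_mod_cast hs
  have hr' : (r : ℝ) ≤ β := by exact_mod_cast hr
  have hd' : (0 : ℝ) < (orderOf (p : ZMod q) : ℝ) := by exact_mod_cast hd
  have hr0 : (0 : ℝ) ≤ r := Nat.cast_nonneg _
  have hα0 : (0 : ℝ) ≤ α := Nat.cast_nonneg _
  have hkey : (r : ℝ) * s ≤ cpq p q * α * (α * (Real.log p / Real.log q) + r) := by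
    have e : Real.log p / ((orderOf (p : ZMod q) : ℝ) * Real.log q)
        = (1 / (orderOf (p : ZMod q) : ℝ)) * (Real.log p / Real.log q) := by
      rw [div_mul_div_comm, one_mul]
    have hx : 0 < Real.log p / Real.log q := div_pos hlp hlq
    unfold cpq
    rw [e]
    have hs2 : (r : ℝ) + s ≤ (1 / (orderOf (p : ZMod q) : ℝ)) * α := by
      rw [one_div_mul_eq_div, le_div_iff₀ hd']; linarith
    have ha : 0 ≤ 1 / (orderOf (p : ZMod q) : ℝ) := by positivity
    generalize 1 / (orderOf (p : ZMod q) : ℝ) = a at *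
    generalize Real.log p / Real.log q = x at *
    have hy : Real.sqrt (x ^ 2 + a * x) ^ 2 = x ^ 2 + a * x := Real.sq_sqrt (by positivity)
    generalize Real.sqrt (x ^ 2 + a * x) = y at *
    have h1 : (r : ℝ) * s ≤ r * (a * α - r) := mul_le_mul_of_nonneg_left (by linarith) hr0
    have h2 : (a - 2 * y + 2 * x) * α * (α * x + r) - r * (a * α - r)
        = (r + α * (x - y)) ^ 2 := by
      linear_combination (-(α : ℝ) ^ 2) * hy
    nlinarith [sq_nonneg ((r : ℝ) + α * (x - y))]
  calc (r : ℝ) * s * Real.log q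
      ≤ cpq p q * α * (α * (Real.log p / Real.log q) + r) * Real.log q :=
        mul_le_mul_of_nonneg_right hkey hlq.le
    _ = cpq p q * α * (α * Real.log p + r * Real.log q) := by field_simp
    _ ≤ cpq p q * α * (α * Real.log p + β * Real.log q) := by gcongr

theorem succ_le_pow_aux {p : ℕ} (hp : p.Prime) (a : ℕ) : a + 1 ≤ p ^ a := Nat.lt_pow_self hp.one_lt

theorem ApAq_count_upper_bound (p q : ℕ) (hp : p.Prime) (hq : q.Prime) (hpq : p ≠ q)
    (n : ℕ) (hn : 1 ≤ n) :
    (numGroups n (fun G g => letI := g; InApAq p q G) : ℝ) ≤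
      (n : ℝ) ^ (cpq p q * (muExp n : ℝ) + 1) := by
  classical
  have : Fact p.Prime := ⟨hp⟩
  have : Fact q.Prime := ⟨hq⟩
  have hd := orderOf_pos_aux hp hq hpq
  -- the field
  let K := GaloisField p (orderOf (p : ZMod q))
  let _ : Fintype K := Fintype.ofFinite K
  have hK : Fintype.card K = p ^ orderOf (p : ZMod q) := by
    rw [← Nat.card_eq_fintype_card]; exact GaloisField.card p _ hd.ne'
  obtain ⟨z, hz⟩ : ∃ z : Kˣ, orderOf z = q := by
    apply exists_prime_orderOf_dvd_card'
    rw [Nat.card_eq_fintype_card, Fintype.card_units, hK]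
    rw [← Nat.modEq_iff_dvd' (Nat.one_le_pow _ _ hp.pos), ← ZMod.natCast_eq_natCast_iff]
    push_cast
    exact (pow_orderOf_eq_one _).symm
  have hζ : IsPrimitiveRoot (z : K) q := by
    rw [IsPrimitiveRoot.coe_units_iff]
    have h := IsPrimitiveRoot.orderOf z
    rwa [hz] at h
  unfold numGroups
  let S := {g : Group (Fin n) // (fun (G : Type) (g : Group G) => letI := g; InApAq p q G) (Fin n) g}
  change ((Nat.card (Quot fun g h : S => GroupIsoOf g.1 h.1) : ℕ) : ℝ) ≤ _
  have hdata : ∀ g : S, ∃ (r s m t : ℕ) (A : Fin s → Fin r → ZMod q),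
      @HasData K _ p q (AddChar.zmodChar q hζ.pow_eq_one) r s m t A (Fin n) g.1 := by
    intro g
    let _ := g.1
    exact hasData_of_InApAq p q hpq hK hζ (Fin n) g.2
  have hn0 : (0 : ℝ) < n := by exact_mod_cast hn
  rcases isEmpty_or_nonempty S with hS | ⟨⟨g0⟩⟩
  · have : IsEmpty (Quot fun g h : S => GroupIsoOf g.1 h.1) := ⟨fun c => hS.false c.out⟩
    rw [Nat.card_of_isEmpty, Nat.cast_zero]
    positivity
  have hcard : ∀ (g : S) (r s m t : ℕ) (A : Fin s → Fin r → ZMod q),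
      @HasData K _ p q (AddChar.zmodChar q hζ.pow_eq_one) r s m t A (Fin n) g.1 →
      n = p ^ (orderOf (p : ZMod q) * (r + s) + m) * q ^ (r + t) := by
    intro g r s m t A h
    let _ := g.1
    have := HasData.card hK h
    simpa using this
  obtain ⟨α, β, hαβ⟩ : ∃ α β, n = p ^ α * q ^ β := by
    obtain ⟨r, s, m, t, A, h⟩ := hdata g0
    exact ⟨_, _, hcard g0 r s m t A h⟩
  let I := {rs : Fin (β + 1) × Fin (α + 1) //
    orderOf (p : ZMod q) * ((rs.1 : ℕ) + (rs.2 : ℕ)) ≤ α}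
  let D := Σ i : I, (Fin (i.1.2 : ℕ) → Fin (i.1.1 : ℕ) → ZMod q)
  have hD : ∀ g : S, ∃ x : D,
      @HasData K _ p q (AddChar.zmodChar q hζ.pow_eq_one) x.1.1.1 x.1.1.2
        (α - orderOf (p : ZMod q) * ((x.1.1.1 : ℕ) + (x.1.1.2 : ℕ))) (β - x.1.1.1)
        x.2 (Fin n) g.1 := by
    intro g
    obtain ⟨r, s, m, t, A, h⟩ := hdata g
    have h1 := hcard g r s m t A h
    rw [hαβ] at h1
    obtain ⟨h2, h3⟩ := pow_mul_pow_inj hp hq hpq h1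
    have h4 : s ≤ orderOf (p : ZMod q) * (r + s) :=
      le_trans (Nat.le_add_left s r) (Nat.le_mul_of_pos_left _ hd)
    refine ⟨⟨⟨(⟨r, by omega⟩, ⟨s, by omega⟩), ?_⟩, A⟩, ?_⟩
    · change orderOf (p : ZMod q) * (r + s) ≤ α
      omega
    · change @HasData K _ p q (AddChar.zmodChar q hζ.pow_eq_one) r s
        (α - orderOf (p : ZMod q) * (r + s)) (β - r) A (Fin n) g.1
      have e1 : α - orderOf (p : ZMod q) * (r + s) = m := by omega
      have e2 : β - r = t := by omega
      rw [e1, e2]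
      exact h
  choose F hF using hD
  have hinj : Function.Injective
      (fun c : Quot (fun g h : S => GroupIsoOf g.1 h.1) => F c.out) := by
    intro c c' hcc
    have h1 := hF c.out
    have h2 := hF c'.out
    have hcc' : F c.out = F c'.out := hcc
    rw [← hcc'] at h2
    rw [← Quot.out_eq c, ← Quot.out_eq c']
    apply Quot.sound
    exact @HasData.iso _ _ _ _ _ _ _ _ _ _ _ _ c.out.1 c'.out.1 h1 h2
  have hle : Nat.card (Quot fun g h : S => GroupIsoOf g.1 h.1) ≤ Nat.card D :=
    Nat.card_le_card_of_injective _ hinj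
  have hα : α ≤ muExp n := by
    have h1 : n.factorization p = α := by
      rw [hαβ, Nat.factorization_mul (pow_ne_zero _ hp.ne_zero) (pow_ne_zero _ hq.ne_zero),
        hp.factorization_pow, hq.factorization_pow]
      simp [hpq, hpq.symm]
    rw [← h1]
    exact le_muExp n p
  have hterm : ∀ i : I, ((q : ℝ) ^ ((i.1.1 : ℕ) * (i.1.2 : ℕ))) ≤
      (n : ℝ) ^ (cpq p q * (muExp n : ℝ)) := by
    intro i
    have h1 := main_ineq hp hq hpq (Nat.lt_succ_iff.1 i.1.1.2) i.2
    rw [← hαβ] at h1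
    refine h1.trans (Real.rpow_le_rpow_of_exponent_le (by exact_mod_cast hn) ?_)
    exact mul_le_mul_of_nonneg_left (by exact_mod_cast hα) (cpq_nonneg hp hq)
  have hDcard : (Nat.card D : ℝ) = ∑ i : I, (q : ℝ) ^ ((i.1.1 : ℕ) * (i.1.2 : ℕ)) := by
    rw [Nat.card_sigma]
    push_cast
    refine Finset.sum_congr rfl fun i _ => ?_
    simp only [Nat.card_fun, Nat.card_zmod, Nat.card_fin]
    push_cast
    rw [← pow_mul]
  have hIcard : Fintype.card I ≤ n := by
    calc Fintype.card I ≤ Fintype.card (Fin (β + 1) × Fin (α + 1)) := Fintype.card_subtype_le _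
      _ = (α + 1) * (β + 1) := by simp [mul_comm]
      _ ≤ p ^ α * q ^ β := Nat.mul_le_mul (succ_le_pow_aux hp α) (succ_le_pow_aux hq β)
      _ = n := hαβ.symm
  calc ((Nat.card (Quot fun g h : S => GroupIsoOf g.1 h.1) : ℕ) : ℝ)
      ≤ (Nat.card D : ℝ) := by exact_mod_cast hle
    _ = ∑ i : I, (q : ℝ) ^ ((i.1.1 : ℕ) * (i.1.2 : ℕ)) := hDcard
    _ ≤ ∑ _i : I, (n : ℝ) ^ (cpq p q * (muExp n : ℝ)) := Finset.sum_le_sum fun i _ => hterm i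
    _ = (Fintype.card I : ℝ) * (n : ℝ) ^ (cpq p q * (muExp n : ℝ)) := by
        rw [Finset.sum_const, Finset.card_univ, nsmul_eq_mul]
    _ ≤ n * (n : ℝ) ^ (cpq p q * (muExp n : ℝ)) := by
        apply mul_le_mul_of_nonneg_right (by exact_mod_cast hIcard)
        positivity
    _ = (n : ℝ) ^ (cpq p q * (muExp n : ℝ) + 1) := by
        rw [Real.rpow_add hn0, Real.rpow_one, mul_comm]
end

section
/- Let p and q be distinct primes and let 𝔘 be the class of finite groups lying in 𝔄_p𝔄_q. Then for every ε > 0 there exist infinitely many natural numbers n such that f_𝔘(n) > n^{(c_{p,q} − ε)·μ(n)}. -/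
set_option linter.style.haveILetI false

/-- Underlying type of the semidirect product of `ι → K` by `W`, twisted by `M`. -/
@[ext] structure TwGrp (q m : ℕ) (K W : Type) (z : ZMod q → K)
    (M : Fin m → W → ZMod q) : Type where
  v : Fin m → K
  a : W

section Tw
variable {q m : ℕ} {K W : Type} [Field K] [AddCommGroup W]

/-- the group structure -/
@[reducible] def twGroup (z : ZMod q → K) (M : Fin m → W → ZMod q)
    (z0 : z 0 = 1) (zadd : ∀ a b, z (a + b) = z a * z b)
    (hM0 : ∀ i, M i 0 = 0) (hM : ∀ i a b, M i (a + b) = M i a + M i b) :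
    Group (TwGrp q m K W z M) :=
  letI : Mul (TwGrp q m K W z M) := ⟨fun x y => ⟨fun i => x.v i + z (M i x.a) * y.v i, x.a + y.a⟩⟩
  letI : One (TwGrp q m K W z M) := ⟨⟨0, 0⟩⟩
  letI : Inv (TwGrp q m K W z M) := ⟨fun x => ⟨fun i => - (z (M i (-x.a)) * x.v i), -x.a⟩⟩
  Group.ofLeftAxioms
    (by
      intro x y w
      ext i
      · change (x.v i + z (M i x.a) * y.v i) + z (M i (x.a + y.a)) * w.v i
          = x.v i + z (M i x.a) * (y.v i + z (M i y.a) * w.v i)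
        rw [hM, zadd]; ring
      · change x.a + y.a + w.a = x.a + (y.a + w.a)
        rw [add_assoc])
    (by
      intro x
      ext i
      · change (0 : K) + z (M i 0) * x.v i = x.v i
        rw [hM0, z0]; ring
      · change 0 + x.a = x.a
        rw [zero_add])
    (by
      intro x
      ext i
      · change - (z (M i (-x.a)) * x.v i) + z (M i (-x.a)) * x.v i = 0
        ring
      · change -x.a + x.a = 0
        rw [neg_add_cancel])

end Tw

section Lin
variable {p q m : ℕ} [Fact q.Prime] {K W : Type} [Field K] [AddCommGroup W] [Module (ZMod q) W]

/-- the group attached to a tuple of functionals -/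
@[reducible] def linGroup (z : ZMod q → K) (z0 : z 0 = 1) (zadd : ∀ a b, z (a + b) = z a * z b)
    (M : Fin m → (W →ₗ[ZMod q] ZMod q)) : Group (TwGrp q m K W z (fun i => M i)) :=
  twGroup z (fun i => M i) z0 zadd (fun i => map_zero _) (fun i a b => map_add _ a b)

variable (z : ZMod q → K) (z0 : z 0 = 1) (zadd : ∀ a b, z (a + b) = z a * z b)

lemma lin_pow_a (M : Fin m → (W →ₗ[ZMod q] ZMod q)) (x : TwGrp q m K W z (fun i => M i)) (k : ℕ) :
    letI := linGroup z z0 zadd M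
    (x ^ k).a = k • x.a := by
  letI := linGroup z z0 zadd M
  induction k with
  | zero => rw [pow_zero, zero_smul]; rfl
  | succ k ih => rw [pow_succ, succ_nsmul, ← ih]; rfl

lemma lin_pow_v (M : Fin m → (W →ₗ[ZMod q] ZMod q)) (v : Fin m → K) (k : ℕ) :
    letI := linGroup z z0 zadd M
    (⟨v, 0⟩ : TwGrp q m K W z (fun i => M i)) ^ k = ⟨k • v, 0⟩ := by
  letI := linGroup z z0 zadd M
  induction k with
  | zero => rw [pow_zero, zero_smul]; rfl
  | succ k ih =>
    rw [pow_succ, ih]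
    ext i
    · change (k • v) i + z (M i 0) * v i = ((k + 1) • v) i
      rw [map_zero, z0, succ_nsmul, one_mul]; rfl
    · change (0 : W) + 0 = 0
      rw [add_zero]

lemma lin_pow_eq_one [CharP K p] (hp : p.Prime) (hq : q.Prime) (hpq : p ≠ q)
    (M : Fin m → (W →ₗ[ZMod q] ZMod q))
    (x : TwGrp q m K W z (fun i => M i)) :
    letI := linGroup z z0 zadd M
    x ^ p = 1 ↔ x.a = 0 := by
  letI := linGroup z z0 zadd M
  constructor
  · intro h
    have h1 : (x ^ p).a = 0 := by rw [h]; rfl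
    rw [lin_pow_a, ← Nat.cast_smul_eq_nsmul (ZMod q)] at h1
    rcases smul_eq_zero.1 h1 with h2 | h2
    · rw [ZMod.natCast_eq_zero_iff] at h2
      exact absurd ((Nat.prime_dvd_prime_iff_eq hq hp).1 h2).symm hpq
    · exact h2
  · intro h
    obtain ⟨v, a⟩ := x
    simp only at h
    subst h
    rw [lin_pow_v]
    ext i
    · change (p • v) i = 0
      simp
    · rfl

lemma lin_mem [CharP K p] (hp : p.Prime) (hq : q.Prime) (hpq : p ≠ q)
    (M : Fin m → (W →ₗ[ZMod q] ZMod q)) :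
    letI := linGroup z z0 zadd M
    InApAq p q (TwGrp q m K W z (fun i => M i)) := by
  letI := linGroup z z0 zadd M
  let f : TwGrp q m K W z (fun i => M i) →* Multiplicative W :=
    { toFun := fun x => Multiplicative.ofAdd x.a
      map_one' := rfl
      map_mul' := fun _ _ => rfl }
  have hf : ∀ x : TwGrp q m K W z (fun i => M i), x ∈ f.ker ↔ x.a = 0 := fun x => Iff.rfl
  refine ⟨f.ker, inferInstance, ⟨?_, ?_⟩, ?_, ?_⟩
  · rintro ⟨x, hx⟩ ⟨y, hy⟩
    rw [hf] at hx hy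
    apply Subtype.ext
    ext i
    · change x.v i + z (M i x.a) * y.v i = y.v i + z (M i y.a) * x.v i
      rw [hx, hy, map_zero, z0]; ring
    · change x.a + y.a = y.a + x.a
      rw [add_comm]
  · rintro ⟨x, hx⟩
    rw [hf] at hx
    apply Subtype.ext
    exact (lin_pow_eq_one z z0 zadd hp hq hpq M x).2 hx
  · intro a b
    rw [MonoidHom.mem_ker]
    simp only [map_mul, map_inv]
    rw [mul_comm (f a) (f b), mul_inv_cancel_right, mul_inv_cancel]
  · intro a
    rw [hf, lin_pow_a, ← Nat.cast_smul_eq_nsmul (ZMod q)]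
    simp

lemma lin_iso [CharP K p] (hp : p.Prime) (hq : q.Prime) (hpq : p ≠ q)
    (zinj : ∀ a, z a = 1 → a = 0)
    (M M' : Fin m → (W →ₗ[ZMod q] ZMod q))
    (h : GroupIsoOf (linGroup z z0 zadd M) (linGroup z z0 zadd M')) :
    ∃ (B : W →ₗ[ZMod q] W) (s : Fin m → Fin m × ZMod q),
      M = fun i => (s i).2 • (M' (s i).1 ∘ₗ B) := by
  letI := linGroup z z0 zadd M
  letI := linGroup z z0 zadd M'
  obtain ⟨f⟩ := h
  have key : ∀ x, (f x).a = 0 ↔ x.a = 0 := by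
    intro x
    rw [← lin_pow_eq_one z z0 zadd hp hq hpq M x, ← lin_pow_eq_one z z0 zadd hp hq hpq M' (f x),
      ← map_pow]
    exact map_eq_one_iff f f.injective
  let B0 : W →+ W :=
    { toFun := fun a => (f ⟨0, a⟩).a
      map_zero' := (key _).2 rfl
      map_add' := by
        intro a b
        have : (⟨0, a + b⟩ : TwGrp q m K W z (fun i => M i)) = ⟨0, a⟩ * ⟨0, b⟩ := by
          ext i
          · change (0 : K) = 0 + z (M i a) * 0
            ring
          · rfl
        rw [this, map_mul]; rfl }
  let B : W →ₗ[ZMod q] W := AddMonoidHom.toZModLinearMap q B0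
  let A : (Fin m → K) → (Fin m → K) := fun v => (f ⟨v, 0⟩).v
  have hfA : ∀ v, f ⟨v, 0⟩ = ⟨A v, 0⟩ := by
    intro v
    ext i
    · rfl
    · exact (key _).2 rfl
  have Aadd : ∀ v w, A (v + w) = A v + A w := by
    intro v w
    have : (⟨v + w, 0⟩ : TwGrp q m K W z (fun i => M i)) = ⟨v, 0⟩ * ⟨w, 0⟩ := by
      ext i
      · change v i + w i = v i + z (M i 0) * w i
        rw [map_zero, z0, one_mul]
      · change (0 : W) = 0 + 0
        rw [add_zero]
    ext i
    change (f ⟨v + w, 0⟩).v i = _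
    rw [this, map_mul, hfA, hfA]
    change A v i + z (M' i 0) * A w i = A v i + A w i
    rw [map_zero, z0, one_mul]
  have Ainj : ∀ v, A v = 0 → v = 0 := by
    intro v hv
    have h1 : f ⟨v, 0⟩ = 1 := by rw [hfA, hv]; rfl
    have h2 := (map_eq_one_iff f f.injective).1 h1
    exact congrArg TwGrp.v h2
  have Atw : ∀ (a : W) (v : Fin m → K) (j : Fin m),
      A (fun i => z (M i a) * v i) j = z (M' j (B a)) * A v j := by
    intro a v j
    have h1 : (⟨0, a⟩ * ⟨v, 0⟩ : TwGrp q m K W z (fun i => M i))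
        = ⟨fun i => z (M i a) * v i, 0⟩ * ⟨0, a⟩ := by
      ext i
      · change (0 : K) + z (M i a) * v i = z (M i a) * v i + z (M i 0) * 0
        ring
      · change a + 0 = 0 + a
        rw [add_comm]
    have h2 := congrArg (fun x => (f x).v j) h1
    simp only [map_mul, hfA] at h2
    change (f ⟨0, a⟩).v j + z (M' j (B a)) * A v j
      = A (fun i => z (M i a) * v i) j + z (M' j 0) * (f ⟨0, a⟩).v j at h2
    rw [map_zero, z0] at h2
    linear_combination -h2
  have main : ∀ i, ∃ t : Fin m × ZMod q, M i = t.2 • (M' t.1 ∘ₗ B) := by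
    intro i
    have hne : A (Pi.single i 1) ≠ 0 := by
      intro h
      have := congrFun (Ainj _ h) i
      simp at this
    obtain ⟨j, hj⟩ := Function.ne_iff.1 hne
    have hker : ∀ a, M' j (B a) = 0 → M i a = 0 := by
      intro a ha
      by_contra hne'
      have hz : z (M i a) - 1 ≠ 0 := fun h => hne' (zinj _ (sub_eq_zero.1 h))
      set x : K := (z (M i a) - 1)⁻¹ with hx
      have h1 := Atw a (Pi.single i x) j
      rw [ha, z0, one_mul] at h1
      have h2 : (fun i' => z (M i' a) * (Pi.single i x : Fin m → K) i')
          = Pi.single i x + Pi.single i 1 := by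
        ext i'
        by_cases h : i' = i
        · subst h
          simp only [Pi.single_eq_same, Pi.add_apply]
          have : (z (M i' a) - 1) * x = 1 := mul_inv_cancel₀ hz
          linear_combination this
        · simp [h]
      rw [h2, Aadd] at h1
      apply hj
      simpa using h1
    have hle : (M' j ∘ₗ B).ker ≤ (M i).ker := by
      intro a ha
      exact hker a ha
    have hmem : M i ∈ Submodule.span (ZMod q) (Set.range (fun _ : Unit => M' j ∘ₗ B)) := by
      apply mem_span_of_iInf_ker_le_ker
      simpa using hle
    rw [Set.range_const, Submodule.mem_span_singleton] at hmem
    obtain ⟨k, hk⟩ := hmem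
    exact ⟨(j, k), hk.symm⟩
  choose s hs using main
  exact ⟨B, s, funext hs⟩

end Lin

instance finiteGroupFin (n : ℕ) : Finite (Group (Fin n)) := by
  apply Finite.of_injective (fun g : Group (Fin n) => (g.mul : Fin n → Fin n → Fin n))
  intro g h hgh
  apply Group.ext
  exact hgh

lemma inApAq_of_equiv {p q : ℕ} {G H : Type} [Group G] [Group H] (e : G ≃* H)
    (h : InApAq p q G) : InApAq p q H := by
  obtain ⟨N, hN, ⟨h1, h2⟩, h3, h4⟩ := h
  refine ⟨N.comap e.symm.toMonoidHom, hN.comap _, ⟨?_, ?_⟩, ?_, ?_⟩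
  · rintro ⟨a, ha⟩ ⟨b, hb⟩
    have := congrArg Subtype.val (h1 ⟨_, ha⟩ ⟨_, hb⟩)
    apply Subtype.ext
    apply e.symm.injective
    simp only [Subgroup.coe_mul, Subgroup.coe_pow, Subgroup.coe_one, map_mul, map_pow,
      map_one] at this ⊢
    exact this
  · rintro ⟨a, ha⟩
    have := congrArg Subtype.val (h2 ⟨_, ha⟩)
    apply Subtype.ext
    apply e.symm.injective
    simp only [Subgroup.coe_mul, Subgroup.coe_pow, Subgroup.coe_one, map_mul, map_pow,
      map_one] at this ⊢
    exact this
  · intro a b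
    simpa using h3 (e.symm a) (e.symm b)
  · intro a
    simpa using h4 (e.symm a)

lemma exists_transport {α β : Type} (g : Group α) (e : α ≃ β) : ∃ h : Group β, GroupIsoOf g h := by
  let h := e.symm.group
  exact ⟨h, ⟨e.symm.mulEquiv.symm⟩⟩

lemma GroupIsoOf.trans' {α β γ : Type} {g : Group α} {h : Group β} {k : Group γ}
    (h1 : GroupIsoOf g h) (h2 : GroupIsoOf h k) : GroupIsoOf g k := by
  obtain ⟨e⟩ := h1
  obtain ⟨e'⟩ := h2
  exact ⟨e.trans e'⟩

lemma GroupIsoOf.symm' {α β : Type} {g : Group α} {h : Group β}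
    (h1 : GroupIsoOf g h) : GroupIsoOf h g := by
  obtain ⟨e⟩ := h1
  exact ⟨e.symm⟩

lemma GroupIsoOf.inApAq {p q : ℕ} {α β : Type} {g : Group α} {h : Group β}
    (h1 : GroupIsoOf g h) (h2 : @InApAq p q α g) : @InApAq p q β h := by
  obtain ⟨e⟩ := h1
  exact inApAq_of_equiv e h2

lemma groupIso_equivalence (n : ℕ) (S : (G : Type) → Group G → Prop) :
    Equivalence (fun g h : {g : Group (Fin n) // S (Fin n) g} => GroupIsoOf g.1 h.1) := by
  refine ⟨?_, ?_, ?_⟩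
  · intro g; exact ⟨@MulEquiv.refl _ g.1.toMul⟩
  · intro g h e; exact e.symm'
  · intro g h k e e'; exact e.trans' e'

lemma exists_char {p q : ℕ} (hp : p.Prime) (hq : q.Prime) (hpq : p ≠ q) [Fact p.Prime] :
    0 < orderOf (p : ZMod q) ∧
    ∃ z : ZMod q → GaloisField p (orderOf (p : ZMod q)), z 0 = 1 ∧
      (∀ a b, z (a + b) = z a * z b) ∧ ∀ a, z a = 1 → a = 0 := by
  haveI : Fact q.Prime := ⟨hq⟩
  have hp0 : (p : ZMod q) ≠ 0 := by
    rw [Ne, ZMod.natCast_eq_zero_iff]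
    intro h
    exact hpq ((Nat.prime_dvd_prime_iff_eq hq hp).1 h).symm
  have hd : 0 < orderOf (p : ZMod q) := by
    rw [orderOf_pos_iff, isOfFinOrder_iff_pow_eq_one]
    exact ⟨q - 1, by have := hq.two_le; omega, ZMod.pow_card_sub_one_eq_one hp0⟩
  refine ⟨hd, ?_⟩
  set d := orderOf (p : ZMod q) with hdd
  have hdvd : q ∣ Nat.card (GaloisField p d)ˣ := by
    rw [Nat.card_units, GaloisField.card p d hd.ne', ← ZMod.natCast_eq_zero_iff,
      Nat.cast_sub (Nat.one_le_pow _ _ hp.pos)]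
    push_cast
    rw [hdd, pow_orderOf_eq_one, sub_self]
  obtain ⟨ζ, hζ⟩ := exists_prime_orderOf_dvd_card' q hdvd
  refine ⟨fun a => ((ζ ^ a.val : (GaloisField p d)ˣ) : GaloisField p d), ?_, ?_, ?_⟩
  · simp
  · intro a b
    beta_reduce
    rw [← Units.val_mul, ← pow_add, ZMod.val_add]
    congr 1
    conv_rhs => rw [← pow_mod_orderOf, hζ]
  · intro a ha
    have h1 : ζ ^ a.val = 1 := Units.ext ha
    have h2 := orderOf_dvd_of_pow_eq_one h1
    rw [hζ] at h2
    have h3 := Nat.eq_zero_of_dvd_of_lt h2 (ZMod.val_lt a)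
    exact (ZMod.val_eq_zero a).1 h3

lemma count_bound {p q : ℕ} (hp : p.Prime) (hq : q.Prime) (hpq : p ≠ q) (m b : ℕ) :
    q ^ (m * b) ≤ numGroups (p ^ (orderOf (p : ZMod q) * m) * q ^ b)
      (fun G g => letI := g; InApAq p q G) * q ^ (b * b) * (m * q) ^ m := by
  haveI : Fact q.Prime := ⟨hq⟩
  haveI : Fact p.Prime := ⟨hp⟩
  obtain ⟨hd, z, z0, zadd, zinj⟩ := exists_char hp hq hpq
  generalize orderOf (p : ZMod q) = d at *
  set n := p ^ (d * m) * q ^ b with hn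
  let W := Fin b → ZMod q
  let X := Fin m → (W →ₗ[ZMod q] ZMod q)
  let T : X → Type := fun M => TwGrp q m (GaloisField p d) W z (fun i => M i)
  letI gT : ∀ M : X, Group (T M) := fun M => linGroup z z0 zadd M
  have hcard : ∀ M : X, Nonempty (T M ≃ Fin n) := by
    intro M
    let e : T M ≃ (Fin m → GaloisField p d) × W :=
      { toFun := fun x => (x.v, x.a)
        invFun := fun x => ⟨x.1, x.2⟩
        left_inv := fun _ => rfl
        right_inv := fun _ => rfl }
    have hc : Nat.card (T M) = n := by
      rw [Nat.card_congr e, Nat.card_prod, Nat.card_fun, Nat.card_fun,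
        GaloisField.card p d hd.ne']
      simp [hn, pow_mul]
    haveI : Finite (T M) := Finite.of_equiv _ e.symm
    exact ⟨(Finite.equivFin (T M)).trans (finCongr hc)⟩
  have htr : ∀ M : X, ∃ h : Group (Fin n), GroupIsoOf (gT M) h := fun M =>
    exists_transport (gT M) (hcard M).some
  choose g0 hg0 using htr
  let g : X → {g : Group (Fin n) // (letI := g; InApAq p q (Fin n))} := fun M =>
    ⟨g0 M, (hg0 M).inApAq (lin_mem z z0 zadd hp hq hpq M)⟩
  let r := fun g h : {g : Group (Fin n) // (letI := g; InApAq p q (Fin n))} => GroupIsoOf g.1 h.1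
  have hr : Equivalence r := groupIso_equivalence n (fun G g => letI := g; InApAq p q G)
  let cl : X → Quot r := fun M => Quot.mk r (g M)
  have hcl : ∀ M M' : X, cl M = cl M' → GroupIsoOf (gT M) (gT M') := by
    intro M M' h
    have h1 : r (g M) (g M') := by
      have := Quot.eqvGen_exact h
      rwa [hr.eqvGen_iff] at this
    exact ((hg0 M).trans' h1).trans' (hg0 M').symm'
  let rep : Quot r → X := Function.invFun cl
  let F : (Quot r × (W →ₗ[ZMod q] W)) × (Fin m → Fin m × ZMod q) → X := fun t i =>
    (t.2 i).2 • (rep t.1.1 (t.2 i).1 ∘ₗ t.1.2)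
  have hF : Function.Surjective F := by
    intro M
    have h1 : cl (rep (cl M)) = cl M := Function.invFun_eq ⟨M, rfl⟩
    obtain ⟨B, s, h⟩ := lin_iso z z0 zadd hp hq hpq zinj M _ (hcl _ _ h1.symm)
    exact ⟨((cl M, B), s), h.symm⟩
  haveI : Finite (W →ₗ[ZMod q] W) := Module.finite_of_finite (ZMod q)
  haveI : Finite (Quot r) := inferInstance
  have hle := Nat.card_le_card_of_surjective F hF
  rw [Nat.card_prod, Nat.card_prod] at hle
  have c1 : Nat.card X = q ^ (m * b) := by
    rw [Nat.card_fun, Module.natCard_eq_pow_finrank (K := ZMod q)]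
    simp [W, Module.finrank_linearMap, ← pow_mul, mul_comm]
  have c2 : Nat.card (W →ₗ[ZMod q] W) = q ^ (b * b) := by
    rw [Module.natCard_eq_pow_finrank (K := ZMod q)]
    simp [W, Module.finrank_linearMap]
  have c3 : Nat.card (Fin m → Fin m × ZMod q) = (m * q) ^ m := by
    rw [Nat.card_fun]; simp
  rw [c1, c2, c3] at hle
  exact hle

lemma muExp_eq {p q : ℕ} (hp : p.Prime) (hq : q.Prime) (hpq : p ≠ q) (α β : ℕ) (h : β ≤ α) :
    muExp (p ^ α * q ^ β) = α := by
  have hf : (p ^ α * q ^ β).factorization = Finsupp.single p α + Finsupp.single q β := by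
    rw [Nat.factorization_mul (pow_ne_zero _ hp.ne_zero) (pow_ne_zero _ hq.ne_zero),
      hp.factorization_pow, hq.factorization_pow]
  unfold muExp
  rw [hf]
  apply le_antisymm
  · apply Finset.sup_le
    intro x _
    simp only [Finsupp.add_apply, Finsupp.single_apply]
    split_ifs with h1 h2
    · exact absurd (h1.trans h2.symm) hpq
    · omega
    · omega
    · omega
  · rcases Nat.eq_zero_or_pos α with h0 | h0
    · omega
    · have hv : (Finsupp.single p α + Finsupp.single q β : ℕ →₀ ℕ) p = α := by
        simp [Finsupp.single_apply, hpq.symm]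
      have := Finset.le_sup (f := ⇑(Finsupp.single p α + Finsupp.single q β : ℕ →₀ ℕ))
        (s := (Finsupp.single p α + Finsupp.single q β : ℕ →₀ ℕ).support) (b := p)
        (by rw [Finsupp.mem_support_iff, hv]; omega)
      rwa [hv] at this

lemma analytic (d : ℕ) (hd : 0 < d) (lp lq q ε c x : ℝ) (hlp : 0 < lp) (hlq : 0 < lq) (hq : 1 < q)
    (hε : 0 < ε) (hx : 0 ≤ x) (hc : (1 / d - x) * x * lq = c * (lp + x * lq)) :
    ∀ᶠ m : ℕ in Filter.atTop,
      (c - ε) * (d * m) * (d * m * lp + (⌊x * d * m⌋₊ : ℝ) * lq)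
        + (⌊x * d * m⌋₊ : ℝ) * ⌊x * d * m⌋₊ * lq + m * Real.log (m * q)
        < m * ⌊x * d * m⌋₊ * lq := by
  have hy : Filter.Tendsto (fun m : ℕ => (⌊x * d * m⌋₊ : ℝ) / m) Filter.atTop (nhds (x * d)) :=
    (tendsto_nat_floor_mul_div_atTop (R := ℝ) (by positivity : 0 ≤ x * d)).comp
      tendsto_natCast_atTop_atTop
  have hl : Filter.Tendsto (fun m : ℕ => Real.log (m * q) / m) Filter.atTop (nhds 0) := by
    have h1 : Filter.Tendsto (fun t : ℝ => Real.log t / t) Filter.atTop (nhds 0) := by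
      simpa using Real.tendsto_pow_log_div_mul_add_atTop 1 0 1 one_ne_zero
    have h2 : Filter.Tendsto (fun m : ℕ => (m : ℝ) * q) Filter.atTop Filter.atTop :=
      tendsto_natCast_atTop_atTop.atTop_mul_const (by linarith)
    have h3 := (h1.comp h2).mul_const q
    rw [zero_mul] at h3
    refine h3.congr ?_
    intro m
    simp only [Function.comp]
    have : q ≠ 0 := by linarith
    field_simp
  have hd' : (0 : ℝ) < d := by exact_mod_cast hd
  have hlim : Filter.Tendsto (fun m : ℕ => (⌊x * d * m⌋₊ : ℝ) / m * lq
      - ((c - ε) * d * (d * lp + (⌊x * d * m⌋₊ : ℝ) / m * lq)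
        + (⌊x * d * m⌋₊ : ℝ) / m * ((⌊x * d * m⌋₊ : ℝ) / m) * lq + Real.log (m * q) / m))
      Filter.atTop (nhds (x * d * lq - ((c - ε) * d * (d * lp + x * d * lq)
        + x * d * (x * d) * lq + 0))) := by
    refine (hy.mul_const lq).sub ((((((hy.mul_const lq).const_add _).const_mul _)).add
      ((hy.mul hy).mul_const lq)).add hl)
  have hpos : 0 < x * d * lq - ((c - ε) * d * (d * lp + x * d * lq)
        + x * d * (x * d) * lq + 0) := by
    have : x * d * lq - ((c - ε) * d * (d * lp + x * d * lq)
        + x * d * (x * d) * lq + 0) = ε * (d * d) * (lp + x * lq) := by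
      have h1 : (1 / d - x) * x * lq * (d * d) = x * d * lq - x * d * (x * d) * lq := by
        field_simp
      rw [hc] at h1
      linear_combination -h1
    rw [this]; positivity
  filter_upwards [hlim.eventually_const_lt hpos, Filter.eventually_gt_atTop 0] with m hm hm0
  have hm' : (0 : ℝ) < m := by exact_mod_cast hm0
  have h2 := mul_pos hm (mul_pos hm' hm')
  rw [← sub_pos]
  refine lt_of_lt_of_eq h2 ?_
  field_simp

/-- For distinct primes `p, q` and `𝔘` the class of finite groups in
`𝔄_p𝔄_q`: for every `ε > 0` there are infinitely many `n` with
`f_𝔘(n) > n^{(c_{p,q} − ε)·μ(n)}`. -/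
theorem ApAq_count_lower_bound (p q : ℕ) (hp : p.Prime) (hq : q.Prime) (hpq : p ≠ q)
    (ε : ℝ) (hε : 0 < ε) :
    ∀ N : ℕ, ∃ n : ℕ, N < n ∧
      (n : ℝ) ^ ((cpq p q - ε) * (muExp n : ℝ)) <
        (numGroups n (fun G g => letI := g; InApAq p q G) : ℝ) := by
  intro N
  haveI : Fact p.Prime := ⟨hp⟩
  have hd := (exists_char hp hq hpq).1
  have hp1 : (1 : ℝ) < p := by exact_mod_cast hp.one_lt
  have hq1 : (1 : ℝ) < q := by exact_mod_cast hq.one_lt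
  have hlp := Real.log_pos hp1
  have hlq := Real.log_pos hq1
  have hcdef : cpq p q = 1 / (orderOf (p : ZMod q) : ℝ)
    - 2 * Real.sqrt ((Real.log p / Real.log q) ^ 2
        + Real.log p / ((orderOf (p : ZMod q) : ℝ) * Real.log q))
    + 2 * (Real.log p / Real.log q) := rfl
  have hcb := count_bound hp hq hpq
  set c := cpq p q
  set d := orderOf (p : ZMod q) with hdd
  have hd' : (1 : ℝ) ≤ d := by exact_mod_cast hd
  set lp := Real.log p with hlpd
  set lq := Real.log q with hlqd
  set L := lp / lq with hL
  have hL0 : 0 < L := by positivity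
  have hlpL : lp = L * lq := by rw [hL]; field_simp
  have hLd : lp / (d * lq) = L / d := by rw [hL]; field_simp
  rw [hLd] at hcdef
  set S := Real.sqrt (L ^ 2 + L / d) with hS
  have hS2 : S * S = L ^ 2 + L / d := Real.mul_self_sqrt (by positivity)
  have hSL : L ≤ S := Real.le_sqrt_of_sq_le (by
    have : 0 ≤ L / d := by positivity
    linarith)
  have hSu : S ≤ L + 1 / d := by
    apply Real.sqrt_le_iff.2
    refine ⟨by positivity, ?_⟩
    have : (L + 1 / d) ^ 2 = L ^ 2 + L / d + (L / d + (1 / d) ^ 2) := by ring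
    rw [this]
    have : 0 ≤ L / d + (1 / (d : ℝ)) ^ 2 := by positivity
    linarith
  have hxc : (1 / (d : ℝ) - (S - L)) * (S - L) * lq = c * (lp + (S - L) * lq) := by
    rw [hlpL, hcdef]
    have h2 : S * S = L ^ 2 + L * (1 / d) := by rw [hS2]; ring
    linear_combination lq * h2
  have hev := analytic d hd lp lq q ε c (S - L) hlp hlq hq1 hε (by linarith) hxc
  obtain ⟨m, hm, hmN⟩ := (hev.and (Filter.eventually_gt_atTop N)).exists
  set b := ⌊(S - L) * d * m⌋₊ with hb
  have hm0 : (0 : ℝ) < m := by exact_mod_cast (Nat.zero_le N).trans_lt hmN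
  have hbm : b ≤ m := by
    apply Nat.floor_le_of_le
    have h1 : (S - L) * d ≤ 1 := by
      have : S - L ≤ 1 / d := by linarith
      calc (S - L) * d ≤ 1 / d * d := by gcongr
        _ = 1 := by field_simp
    nlinarith
  have hbd : b ≤ d * m := hbm.trans (Nat.le_mul_of_pos_left m hd)
  refine ⟨p ^ (d * m) * q ^ b, ?_, ?_⟩
  · calc N < m := hmN
      _ ≤ d * m := Nat.le_mul_of_pos_left m hd
      _ < p ^ (d * m) := Nat.lt_pow_self hp.one_lt
      _ ≤ _ := Nat.le_mul_of_pos_right _ (pow_pos hq.pos _)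
  · rw [muExp_eq hp hq hpq _ _ hbd]
    have hcb' := hcb m b
    set A := numGroups (p ^ (d * m) * q ^ b) (fun G g => letI := g; InApAq p q G)
    have hR : (q : ℝ) ^ (m * b) ≤ A * (q : ℝ) ^ (b * b) * (m * q) ^ m := by exact_mod_cast hcb'
    have hq0 : (0 : ℝ) < q := by linarith
    have hp0 : (0 : ℝ) < p := by linarith
    have hn0 : (0 : ℝ) < ((p ^ (d * m) * q ^ b : ℕ) : ℝ) := by push_cast; positivity
    set Y := ((p ^ (d * m) * q ^ b : ℕ) : ℝ) ^ ((c - ε) * ((d * m : ℕ) : ℝ)) with hY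
    have hY0 : 0 < Y := Real.rpow_pos_of_pos hn0 _
    have hYlog : Real.log Y = (c - ε) * (d * m) * (d * m * lp + b * lq) := by
      rw [hY, Real.log_rpow hn0]
      push_cast
      rw [Real.log_mul (by positivity) (by positivity), Real.log_pow, Real.log_pow]
      push_cast
      ring
    have hlt : Y * (q : ℝ) ^ (b * b) * (m * q) ^ m < (q : ℝ) ^ (m * b) := by
      apply (Real.log_lt_log_iff (by positivity) (by positivity)).1
      rw [Real.log_mul (by positivity) (by positivity), Real.log_mul (by positivity) (by positivity),
        hYlog, Real.log_pow, Real.log_pow, Real.log_pow]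
      push_cast
      exact hm
    have h3 := hlt.trans_le hR
    have h4 : (0 : ℝ) < (q : ℝ) ^ (b * b) * (m * q) ^ m := by positivity
    rw [mul_assoc, mul_assoc] at h3
    exact lt_of_mul_lt_mul_right h3 h4.le
end
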